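/- Fix η > 0 and suppose M^η ≤ T ≤ M^{2−η}. Then for all ε > 0, ∫_{𝒟*} |𝒢_α(M,T) − V̂*(0)·Ŵ(0)·M²/T|² d*_hyp α ≪_ε M^{4 − 1/44 + ε}/T² + M^{2+ε}/T, with implied constant depending only on ε, η, V, W and 𝒟*. -/

import Mathlib

open MeasureTheory
open scoped Classical

noncomputable section

/-- The quadratic form `q_α(m,n) = α₁m² + mn + α₃n²` for `α = (α₁, α₃)`
(middle coefficient normalized to 1). -/
def qf (α : ℝ × ℝ) (m n : ℤ) : ℝ :=
  α.1 * (m : ℝ) ^ 2 + (m : ℝ) * (n : ℝ) + α.2 * (n : ℝ) ^ 2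

/-- `D(α) = π⁻¹ (4α₁α₃ - 1)^{1/2}`. -/
def Dfun (α : ℝ × ℝ) : ℝ := Real.sqrt (4 * α.1 * α.2 - 1) / Real.pi

/-- The smoothed pair-counting function `𝒢_α(M,T)`, a sum over quadruples
`(x₁, y₁, x₂, y₂) ∈ ℤ⁴` with `(x₁,y₁) ≠ ±(x₂,y₂)`; here `p.1 = (x₁,y₁)`, `p.2 = (x₂,y₂)`. -/
def Gsum (V W : ℝ → ℝ) (α : ℝ × ℝ) (M T : ℝ) : ℝ :=
  (1 / 4) * ∑' p : (ℤ × ℤ) × (ℤ × ℤ),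
    if p.1 ≠ p.2 ∧ p.1 ≠ -p.2 then
      W (T * (qf α p.1.1 p.1.2 - qf α p.2.1 p.2.2) / Dfun α) *
      V (qf α p.1.1 p.1.2 / (M ^ 2 * Dfun α))
    else 0

/-- The hyperbolic measure `d*_hyp α = dα₁dα₃/(4α₁α₃ - 1)^{3/2}`. -/
def hypStar : Measure (ℝ × ℝ) :=
  volume.withDensity fun α => ENNReal.ofReal ((4 * α.1 * α.2 - 1) ^ (-(3 : ℝ) / 2))

end

/-- The divisor bound `τ(n) ≪_ε n^ε`. -/
theorem card_divisors_le_rpow (ε : ℝ) (hε : 0 < ε) :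
    ∃ C : ℝ, 1 ≤ C ∧ ∀ n : ℕ, n ≠ 0 → (n.divisors.card : ℝ) ≤ C * (n : ℝ) ^ ε := by
  set δ : ℝ := (2 : ℝ) ^ ε - 1 with hδ
  have h2 : (1 : ℝ) < (2 : ℝ) ^ ε := Real.one_lt_rpow (by norm_num) hε
  have hδ0 : 0 < δ := by linarith
  obtain ⟨P, hP⟩ := exists_nat_gt ((2 : ℝ) ^ (1 / ε))
  set A : ℝ := 1 + 1 / δ with hA
  have hA1 : 1 ≤ A := by
    have : 0 < 1 / δ := by positivity
    linarith
  refine ⟨A ^ P, one_le_pow₀ hA1, fun n hn => ?_⟩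
  have key : ∀ p ∈ n.primeFactors, ((n.factorization p + 1 : ℕ) : ℝ) ≤
      (if p < P then A else 1) * ((p : ℝ) ^ (n.factorization p)) ^ ε := by
    intro p hp
    have hpp := Nat.prime_of_mem_primeFactors hp
    set e := n.factorization p
    have hp2 : (2 : ℝ) ≤ p := by exact_mod_cast hpp.two_le
    have hpe : ((p : ℝ) ^ e) ^ ε = ((p : ℝ) ^ ε) ^ e := by
      rw [← Real.rpow_natCast, ← Real.rpow_natCast, ← Real.rpow_mul (by linarith),
        ← Real.rpow_mul (by linarith), mul_comm]
    rw [hpe]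
    split_ifs with h
    · have h3 : ((2 : ℝ) ^ ε) ^ e ≤ ((p : ℝ) ^ ε) ^ e := by gcongr
      have h4 : 1 + (e : ℝ) * δ ≤ ((2 : ℝ) ^ ε) ^ e := by
        have := one_add_mul_le_pow (a := δ) (by linarith) e
        simpa [hδ] using this
      have h5 : ((e + 1 : ℕ) : ℝ) ≤ A * (1 + e * δ) := by
        have : A * (1 + e * δ) = 1 + e + 1 / δ + e * δ := by
          rw [hA]; field_simp; ring
        rw [this]; push_cast
        have : 0 ≤ 1 / δ + e * δ := by positivity
        linarith
      exact h5.trans (by gcongr; exact h4.trans h3)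
    · have h3 : (2 : ℝ) ≤ (p : ℝ) ^ ε := by
        have : (2 : ℝ) ^ (1 / ε) ≤ p := hP.le.trans (by exact_mod_cast not_lt.mp h)
        calc (2 : ℝ) = ((2 : ℝ) ^ (1 / ε)) ^ ε := by
              rw [← Real.rpow_mul (by norm_num)]; field_simp; simp
          _ ≤ _ := by gcongr
      rw [one_mul]
      calc ((e + 1 : ℕ) : ℝ) ≤ (2 : ℝ) ^ e := by
            exact_mod_cast Nat.lt_two_pow_self
        _ ≤ _ := by gcongr
  rw [Nat.card_divisors hn]
  push_cast
  calc ∏ p ∈ n.primeFactors, ((n.factorization p : ℝ) + 1)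
      ≤ ∏ p ∈ n.primeFactors, ((if p < P then A else 1) * ((p : ℝ) ^ (n.factorization p)) ^ ε) := by
        refine Finset.prod_le_prod (fun _ _ => by positivity) fun p hp => ?_
        have := key p hp
        push_cast at this
        exact this
    _ = (∏ p ∈ n.primeFactors, if p < P then A else 1) *
          (∏ p ∈ n.primeFactors, (p : ℝ) ^ (n.factorization p)) ^ ε := by
        rw [Finset.prod_mul_distrib, Real.finsetProd_rpow]
        intro i _; positivity
    _ ≤ A ^ P * (n : ℝ) ^ ε := by
        have h1 : (∏ p ∈ n.primeFactors, (p : ℝ) ^ (n.factorization p)) = n := by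
          conv_rhs => rw [← Nat.prod_factorization_pow_eq_self hn]
          rw [Finsupp.prod]
          push_cast
          rfl
        rw [h1]
        gcongr
        rw [Finset.prod_ite]
        simp only [Finset.prod_const, one_pow, mul_one]
        apply pow_le_pow_right₀ hA1
        calc _ ≤ (Finset.range P).card := by
              apply Finset.card_le_card
              intro p hp
              simp at hp ⊢
              exact hp.2
          _ = P := by simp

/-- The nonzero integers of absolute value at most `N`. -/
noncomputable def nzInts (N : ℕ) : Finset ℤ := (Finset.Icc (-(N : ℤ)) N).erase 0

theorem mem_nzInts {N : ℕ} {x : ℤ} : x ∈ nzInts N ↔ x ≠ 0 ∧ x.natAbs ≤ N := by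
  simp only [nzInts, Finset.mem_erase, Finset.mem_Icc]
  omega

theorem card_nzInts (N : ℕ) : (nzInts N).card = 2 * N := by
  rw [nzInts, Finset.card_erase_of_mem (by simp), Int.card_Icc]
  omega

theorem sum_nzInts_le (f : ℕ → ℝ) (hf : ∀ n, 0 ≤ f n) (N : ℕ) :
    ∑ x ∈ nzInts N, f x.natAbs ≤ 2 * ∑ k ∈ Finset.Icc 1 N, f k := by
  have hsub : nzInts N ⊆ (Finset.Icc 1 N).image (fun k : ℕ => (k : ℤ)) ∪
      (Finset.Icc 1 N).image (fun k : ℕ => -(k : ℤ)) := by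
    intro x hx
    rw [mem_nzInts] at hx
    simp only [Finset.mem_union, Finset.mem_image, Finset.mem_Icc]
    rcases le_or_gt 0 x with h | h
    · exact Or.inl ⟨x.natAbs, by omega, by omega⟩
    · exact Or.inr ⟨x.natAbs, by omega, by omega⟩
  calc ∑ x ∈ nzInts N, f x.natAbs ≤ ∑ x ∈ (Finset.Icc 1 N).image (fun k : ℕ => (k : ℤ)) ∪
      (Finset.Icc 1 N).image (fun k : ℕ => -(k : ℤ)), f x.natAbs :=
        Finset.sum_le_sum_of_subset_of_nonneg hsub fun _ _ _ => hf _
    _ ≤ ∑ x ∈ (Finset.Icc 1 N).image (fun k : ℕ => (k : ℤ)), f x.natAbs +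
        ∑ x ∈ (Finset.Icc 1 N).image (fun k : ℕ => -(k : ℤ)), f x.natAbs := by
        rw [← Finset.sum_union_inter]
        have : 0 ≤ ∑ x ∈ (Finset.Icc 1 N).image (fun k : ℕ => (k : ℤ)) ∩
          (Finset.Icc 1 N).image (fun k : ℕ => -(k : ℤ)), f x.natAbs :=
          Finset.sum_nonneg fun _ _ => hf _
        linarith
    _ = 2 * ∑ k ∈ Finset.Icc 1 N, f k := by
        rw [Finset.sum_image (by intro a _ b _ h; simpa using h),
          Finset.sum_image (by intro a _ b _ h; simpa using h)]
        simp only [Int.natAbs_neg, Int.natAbs_natCast]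
        ring

theorem sum_Icc_one_div_sqrt_le (N : ℕ) :
    ∑ k ∈ Finset.Icc 1 N, 1 / √(k : ℝ) ≤ 2 * √(N : ℝ) := by
  induction N with
  | zero => simp
  | succ n ih =>
    rw [Finset.sum_Icc_succ_top (by omega)]
    refine (add_le_add_left ih _).trans ?_
    push_cast
    set a := √(n : ℝ)
    have ha : 0 ≤ a := Real.sqrt_nonneg _
    have hb : 0 < √((n : ℝ) + 1) := Real.sqrt_pos.mpr (by positivity)
    have ha2 : a ^ 2 = n := Real.sq_sqrt (by positivity)
    have hb2 : √((n : ℝ) + 1) ^ 2 = n + 1 := Real.sq_sqrt (by positivity)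
    set b := √((n : ℝ) + 1)
    have hab : a ≤ b := Real.sqrt_le_sqrt (by linarith)
    have : 1 / b ≤ 2 * (b - a) := by
      rw [div_le_iff₀ hb]
      nlinarith
    linarith

theorem sum_nzInts_one_div_sqrt_le (N : ℕ) :
    ∑ x ∈ nzInts N, 1 / √|(x : ℝ)| ≤ 4 * √(N : ℝ) := by
  have h := sum_nzInts_le (fun n => 1 / √(n : ℝ)) (fun n => by positivity) N
  simp only [Nat.cast_natAbs, Int.cast_abs] at h
  linarith [sum_Icc_one_div_sqrt_le N]

theorem sum_Icc_one_div_sqrt_one_add_le (n : ℕ) (hn : 1 ≤ n) :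
    ∑ a ∈ Finset.Icc (-(n : ℤ)) n, 1 / √(1 + |(a : ℝ)|) ≤ 5 * √(n : ℝ) := by
  have h0 : (0 : ℤ) ∈ Finset.Icc (-(n : ℤ)) n := by simp
  rw [← Finset.add_sum_erase _ _ h0]
  have h1 : ∑ x ∈ (Finset.Icc (-(n : ℤ)) n).erase 0, 1 / √(1 + |(x : ℝ)|) ≤
      ∑ x ∈ nzInts n, 1 / √|(x : ℝ)| := by
    refine Finset.sum_le_sum fun x hx => ?_
    have hx0 : x ≠ 0 := Finset.ne_of_mem_erase hx
    have : 0 < |(x : ℝ)| := by positivity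
    gcongr
    linarith
  have h2 := sum_nzInts_one_div_sqrt_le n
  have h3 : 1 ≤ √(n : ℝ) := Real.one_le_sqrt.mpr (by exact_mod_cast hn)
  simp only [Int.cast_zero, abs_zero, add_zero, Real.sqrt_one, div_one]
  linarith

theorem sum_nzInts_one_div_le (ε : ℝ) (hε : 0 < ε) :
    ∃ C : ℝ, 1 ≤ C ∧ ∀ N : ℕ, 1 ≤ N → ∑ x ∈ nzInts N, 1 / |(x : ℝ)| ≤ C * (N : ℝ) ^ ε := by
  refine ⟨2 * (1 + 1 / ε), ?_, fun N hN => ?_⟩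
  · have : 0 < 1 / ε := by positivity
    linarith
  have h := sum_nzInts_le (fun n => 1 / (n : ℝ)) (fun n => by positivity) N
  simp only [Nat.cast_natAbs, Int.cast_abs] at h
  have h1 : ∑ k ∈ Finset.Icc 1 N, 1 / (k : ℝ) ≤ 1 + Real.log N := by
    have := harmonic_le_one_add_log N
    rw [harmonic_eq_sum_Icc] at this
    push_cast at this
    simpa [one_div] using this
  have h2 : Real.log N ≤ (N : ℝ) ^ ε / ε := Real.log_le_rpow_div (by positivity) hε
  have h3 : (1 : ℝ) ≤ (N : ℝ) ^ ε := Real.one_le_rpow (by exact_mod_cast hN) hε.le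
  calc _ ≤ 2 * ((N : ℝ) ^ ε + (N : ℝ) ^ ε / ε) := by linarith
    _ = _ := by ring

theorem card_int_divisors_le (m : ℤ) (hm : m ≠ 0) (S : Finset ℤ) (hS : ∀ z ∈ S, z ∣ m) :
    S.card ≤ 2 * m.natAbs.divisors.card := by
  have hsub : S ⊆ (m.natAbs.divisors).image (fun k : ℕ => (k : ℤ)) ∪
      (m.natAbs.divisors).image (fun k : ℕ => -(k : ℤ)) := by
    intro x hx
    have hd : x.natAbs ∈ m.natAbs.divisors :=
      Nat.mem_divisors.mpr ⟨Int.natAbs_dvd_natAbs.mpr (hS x hx), by simpa using hm⟩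
    simp only [Finset.mem_union, Finset.mem_image]
    rcases le_or_gt 0 x with h | h
    · exact Or.inl ⟨x.natAbs, hd, by omega⟩
    · exact Or.inr ⟨x.natAbs, hd, by omega⟩
  calc S.card ≤ _ := Finset.card_le_card hsub
    _ ≤ _ := Finset.card_union_le _ _
    _ ≤ m.natAbs.divisors.card + m.natAbs.divisors.card :=
        add_le_add Finset.card_image_le Finset.card_image_le
    _ = _ := by ring

theorem sum_mul_le (ε : ℝ) (hε : 0 < ε) :
    ∃ C : ℝ, 1 ≤ C ∧ ∀ N : ℕ, 1 ≤ N → ∀ f : ℤ → ℝ, (∀ n, 0 ≤ f n) →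
      ∑ z ∈ nzInts N, ∑ w ∈ nzInts N, f (z * w) ≤ C * (N : ℝ) ^ ε * ∑ m ∈ nzInts (N ^ 2), f m := by
  obtain ⟨C, hC, hdiv⟩ := card_divisors_le_rpow (ε / 2) (by positivity)
  refine ⟨2 * C, by linarith, fun N hN f hf => ?_⟩
  rw [← Finset.sum_product']
  have hmaps : ∀ x ∈ nzInts N ×ˢ nzInts N, x.1 * x.2 ∈ nzInts (N ^ 2) := by
    intro x hx
    simp only [Finset.mem_product, mem_nzInts] at hx ⊢
    refine ⟨mul_ne_zero hx.1.1 hx.2.1, ?_⟩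
    rw [Int.natAbs_mul, sq]
    exact Nat.mul_le_mul hx.1.2 hx.2.2
  rw [← Finset.sum_fiberwise_of_maps_to hmaps, Finset.mul_sum]
  refine Finset.sum_le_sum fun m hm => ?_
  have hm' := mem_nzInts.mp hm
  rw [Finset.sum_congr rfl (g := fun _ => f m)
    (fun x hx => by rw [(Finset.mem_filter.mp hx).2])]
  rw [Finset.sum_const, nsmul_eq_mul]
  refine mul_le_mul_of_nonneg_right ?_ (hf m)
  set S := (nzInts N ×ˢ nzInts N).filter fun x => x.1 * x.2 = m
  have hinj : Set.InjOn Prod.fst (S : Set (ℤ × ℤ)) := by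
    rintro ⟨a, b⟩ ha ⟨c, d⟩ hc h
    simp only [S, Finset.coe_filter, Set.mem_ofPred_eq] at ha hc h
    subst h
    have ha0 : a ≠ 0 := by rintro rfl; exact hm'.1 (by simpa using ha.2.symm)
    have := mul_left_cancel₀ ha0 (ha.2.trans hc.2.symm)
    simp [this]
  have hcard : S.card ≤ 2 * m.natAbs.divisors.card := by
    rw [← Finset.card_image_of_injOn hinj]
    refine card_int_divisors_le m hm'.1 _ fun z hz => ?_
    obtain ⟨x, hx, rfl⟩ := Finset.mem_image.mp hz
    exact ⟨x.2, (Finset.mem_filter.mp hx).2.symm⟩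
  have h1 : (S.card : ℝ) ≤ 2 * (m.natAbs.divisors.card : ℝ) := by exact_mod_cast hcard
  have h2 := hdiv m.natAbs (by simpa using hm'.1)
  have h3 : (m.natAbs : ℝ) ^ (ε / 2) ≤ (N : ℝ) ^ ε := by
    calc (m.natAbs : ℝ) ^ (ε / 2) ≤ ((N : ℝ) ^ 2) ^ (ε / 2) := by
          gcongr
          exact_mod_cast hm'.2
      _ = _ := by
          rw [← Real.rpow_natCast, ← Real.rpow_mul (by positivity)]
          congr 1
          push_cast; ring
  nlinarith

theorem sum_mul_four_le (ε : ℝ) (hε : 0 < ε) :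
    ∃ C : ℝ, 1 ≤ C ∧ ∀ N : ℕ, 1 ≤ N → ∀ f : ℤ → ℝ, (∀ n, 0 ≤ f n) →
      ∑ x ∈ nzInts N, ∑ y ∈ nzInts N, ∑ z ∈ nzInts N, ∑ w ∈ nzInts N, f (x * y * (z * w)) ≤
        C * (N : ℝ) ^ ε * ∑ m ∈ nzInts (N ^ 4), f m := by
  obtain ⟨C, hC, h⟩ := sum_mul_le (ε / 4) (by positivity)
  have hCC : 1 ≤ C * C * C :=
    one_le_mul_of_one_le_of_one_le (one_le_mul_of_one_le_of_one_le (by linarith) (by linarith))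
      (by linarith)
  refine ⟨C * C * C, by linarith, fun N hN f hf => ?_⟩
  have hNp : (0 : ℝ) < N := by exact_mod_cast hN
  set B : ℝ := C * (N : ℝ) ^ (ε / 4) with hB
  have hB0 : 0 ≤ B := by positivity
  have hpow : ((N ^ 2 : ℕ) : ℝ) ^ (ε / 4) = (N : ℝ) ^ (ε / 4) * (N : ℝ) ^ (ε / 4) := by
    push_cast
    rw [sq, Real.mul_rpow hNp.le hNp.le]
  calc ∑ x ∈ nzInts N, ∑ y ∈ nzInts N, ∑ z ∈ nzInts N, ∑ w ∈ nzInts N, f (x * y * (z * w))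
      ≤ ∑ x ∈ nzInts N, ∑ y ∈ nzInts N, B * ∑ m ∈ nzInts (N ^ 2), f (x * y * m) :=
        Finset.sum_le_sum fun x _ => Finset.sum_le_sum fun y _ =>
          h N hN (fun m => f (x * y * m)) fun _ => hf _
    _ = B * ∑ x ∈ nzInts N, ∑ y ∈ nzInts N, ∑ m ∈ nzInts (N ^ 2), f (x * y * m) := by
        simp only [Finset.mul_sum]
    _ ≤ B * (B * ∑ m' ∈ nzInts (N ^ 2), ∑ m ∈ nzInts (N ^ 2), f (m' * m)) := by
        refine mul_le_mul_of_nonneg_left ?_ hB0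
        exact h N hN (fun m' => ∑ m ∈ nzInts (N ^ 2), f (m' * m))
          fun _ => Finset.sum_nonneg fun _ _ => hf _
    _ ≤ B * (B * (C * ((N ^ 2 : ℕ) : ℝ) ^ (ε / 4) * ∑ m ∈ nzInts ((N ^ 2) ^ 2), f m)) := by
        gcongr
        exact h (N ^ 2) (Nat.one_le_pow _ _ hN) f hf
    _ = _ := by
        rw [hpow, ← pow_mul]
        have : (N : ℝ) ^ ε = (N : ℝ) ^ (ε / 4) * (N : ℝ) ^ (ε / 4) *
            ((N : ℝ) ^ (ε / 4) * (N : ℝ) ^ (ε / 4)) := by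
          rw [← Real.rpow_add hNp, ← Real.rpow_add hNp]
          congr 1; ring
        rw [this, hB]
        ring

/-- Quadruples of nonzero integers of absolute value at most `N`. -/
noncomputable def nzQuads (N : ℕ) : Finset ((ℤ × ℤ) × (ℤ × ℤ)) :=
  (nzInts N ×ˢ nzInts N) ×ˢ (nzInts N ×ˢ nzInts N)

theorem mem_nzQuads {N : ℕ} {q : (ℤ × ℤ) × (ℤ × ℤ)} : q ∈ nzQuads N ↔
    (q.1.1 ∈ nzInts N ∧ q.1.2 ∈ nzInts N) ∧ (q.2.1 ∈ nzInts N ∧ q.2.2 ∈ nzInts N) := by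
  simp [nzQuads, Finset.mem_product]

theorem sum_nzQuads (N : ℕ) (F : (ℤ × ℤ) × (ℤ × ℤ) → ℝ) :
    ∑ q ∈ nzQuads N, F q = ∑ x ∈ nzInts N, ∑ y ∈ nzInts N, ∑ z ∈ nzInts N, ∑ w ∈ nzInts N,
      F ((x, y), (z, w)) := by
  simp only [nzQuads, Finset.sum_product]

theorem abs_cast_of_mem_nzInts {N : ℕ} {x : ℤ} (hx : x ∈ nzInts N) :
    1 ≤ |(x : ℝ)| ∧ |(x : ℝ)| ≤ N := by
  have h := mem_nzInts.mp hx
  have h1 : 1 ≤ |x| := Int.one_le_abs h.1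
  have h2 : |x| ≤ N := by rw [Int.abs_eq_natAbs]; exact_mod_cast h.2
  constructor
  · exact_mod_cast h1
  · exact_mod_cast h2

theorem mul_mem_nzInts {N K : ℕ} {x y : ℤ} (hx : x ∈ nzInts N) (hy : y ∈ nzInts K) :
    x * y ∈ nzInts (N * K) := by
  rw [mem_nzInts] at *
  refine ⟨mul_ne_zero hx.1 hy.1, ?_⟩
  rw [Int.natAbs_mul]
  exact Nat.mul_le_mul hx.2 hy.2

theorem sum_one_div_abs_sub_le (K : ℕ) (n : ℤ) (hn : n ∈ nzInts K) :
    ∑ m ∈ nzInts K, (if n ≠ m then 1 / |((n - m : ℤ) : ℝ)| else 0) ≤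
      ∑ a ∈ nzInts (2 * K), 1 / |(a : ℝ)| := by
  rw [← Finset.sum_filter]
  rw [← Finset.sum_image (f := fun a : ℤ => 1 / |(a : ℝ)|) (g := fun m => n - m)
    (by intro a _ b _ h; simpa using h)]
  refine Finset.sum_le_sum_of_subset_of_nonneg ?_ fun _ _ _ => by positivity
  intro a ha
  obtain ⟨m, hm, rfl⟩ := Finset.mem_image.mp ha
  rw [Finset.mem_filter, mem_nzInts] at hm
  rw [mem_nzInts] at hn ⊢
  omega

theorem sum_if_eq_le (K : ℕ) (n : ℤ) (c : ℝ) (hc : 0 ≤ c) :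
    ∑ m ∈ nzInts K, (if n = m then c else 0) ≤ c := by
  rw [Finset.sum_ite_eq]
  split_ifs <;> linarith

theorem sum_one_div_two_pow_le (ε : ℝ) (hε : 0 < ε) (j : ℕ) (hj : 0 < j) :
    ∃ C : ℝ, 1 ≤ C ∧ ∀ N : ℕ, 1 ≤ N →
      ∑ a ∈ nzInts (2 * N ^ j), 1 / |(a : ℝ)| ≤ C * (N : ℝ) ^ ε := by
  have hj0 : (0 : ℝ) < j := by exact_mod_cast hj
  obtain ⟨C, hC, h⟩ := sum_nzInts_one_div_le (ε / j) (by positivity)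
  have h2 : (1 : ℝ) ≤ 2 ^ (ε / j) := Real.one_le_rpow (by norm_num) (by positivity)
  refine ⟨C * 2 ^ (ε / j), by nlinarith, fun N hN => ?_⟩
  refine (h _ (by have := Nat.one_le_pow j N hN; omega)).trans (le_of_eq ?_)
  push_cast
  rw [Real.mul_rpow (by norm_num) (by positivity), ← Real.rpow_natCast (N : ℝ) j,
    ← Real.rpow_mul (by positivity)]
  rw [mul_div_cancel₀ ε hj0.ne']
  ring

theorem sum_quads_ne_le (ε : ℝ) (hε : 0 < ε) :
    ∃ C : ℝ, 1 ≤ C ∧ ∀ N : ℕ, 1 ≤ N → ∀ n : ℤ, n ∈ nzInts (N ^ 4) →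
      ∑ q ∈ nzQuads N, (if n ≠ q.1.1 * q.1.2 * (q.2.1 * q.2.2) then
        1 / |((n - q.1.1 * q.1.2 * (q.2.1 * q.2.2) : ℤ) : ℝ)| else 0) ≤ C * (N : ℝ) ^ ε := by
  obtain ⟨C, hC, h⟩ := sum_mul_four_le (ε / 2) (by positivity)
  obtain ⟨C', hC', h'⟩ := sum_one_div_two_pow_le (ε / 2) (by positivity) 4 (by norm_num)
  refine ⟨C * C', by nlinarith, fun N hN n hn => ?_⟩
  have hNp : (0 : ℝ) < N := by exact_mod_cast hN
  rw [sum_nzQuads]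
  refine (h N hN (fun m => if n ≠ m then 1 / |((n - m : ℤ) : ℝ)| else 0)
    (fun m => by split_ifs <;> positivity)).trans ?_
  calc _ ≤ C * (N : ℝ) ^ (ε / 2) * (C' * (N : ℝ) ^ (ε / 2)) := by
        gcongr
        exact (sum_one_div_abs_sub_le _ n hn).trans (h' N hN)
    _ = C * C' * ((N : ℝ) ^ (ε / 2) * (N : ℝ) ^ (ε / 2)) := by ring
    _ = _ := by rw [← Real.rpow_add hNp, add_halves]

theorem sum_quads_eq_le (ε : ℝ) (hε : 0 < ε) :
    ∃ C : ℝ, 1 ≤ C ∧ ∀ N : ℕ, 1 ≤ N →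
      ∑ p ∈ nzQuads N, ∑ q ∈ nzQuads N,
        (if p.1.1 * p.1.2 * (p.2.1 * p.2.2) = q.1.1 * q.1.2 * (q.2.1 * q.2.2) then
        1 / √|((p.1.1 * p.1.2 * (p.2.1 * p.2.2) : ℤ) : ℝ)| else 0) ≤
          C * (N : ℝ) ^ ε * (N : ℝ) ^ 2 := by
  obtain ⟨C, hC, h⟩ := sum_mul_four_le ε hε
  refine ⟨C * 256, by linarith, fun N hN => ?_⟩
  have hNp : (0 : ℝ) < N := by exact_mod_cast hN
  have h1 : ∀ p ∈ nzQuads N, ∑ q ∈ nzQuads N,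
        (if p.1.1 * p.1.2 * (p.2.1 * p.2.2) = q.1.1 * q.1.2 * (q.2.1 * q.2.2) then
        1 / √|((p.1.1 * p.1.2 * (p.2.1 * p.2.2) : ℤ) : ℝ)| else 0) ≤
      C * (N : ℝ) ^ ε * (1 / √|((p.1.1 * p.1.2 * (p.2.1 * p.2.2) : ℤ) : ℝ)|) := by
    intro p _
    set n := p.1.1 * p.1.2 * (p.2.1 * p.2.2)
    rw [sum_nzQuads]
    refine (h N hN (fun m => if n = m then 1 / √|(n : ℝ)| else 0)
      (fun m => by split_ifs <;> positivity)).trans ?_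
    gcongr
    exact sum_if_eq_le _ n _ (by positivity)
  refine (Finset.sum_le_sum h1).trans ?_
  rw [← Finset.mul_sum]
  have h2 : ∑ p ∈ nzQuads N, 1 / √|((p.1.1 * p.1.2 * (p.2.1 * p.2.2) : ℤ) : ℝ)| =
      (∑ x ∈ nzInts N, 1 / √|(x : ℝ)|) ^ 4 := by
    rw [sum_nzQuads]
    simp only [Int.cast_mul, abs_mul, Real.sqrt_mul (abs_nonneg _),
      Real.sqrt_mul (mul_nonneg (abs_nonneg _) (abs_nonneg _)), one_div, mul_inv,
      ← Finset.mul_sum, ← Finset.sum_mul]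
    ring
  rw [h2]
  calc _ ≤ C * (N : ℝ) ^ ε * (4 * √(N : ℝ)) ^ 4 := by
        gcongr
        exact sum_nzInts_one_div_sqrt_le N
    _ = C * 256 * (N : ℝ) ^ ε * (√(N : ℝ) ^ 2) ^ 2 := by ring
    _ = _ := by rw [Real.sq_sqrt hNp.le]

theorem sum_quads_det_le (ε : ℝ) (hε : 0 < ε) :
    ∃ C : ℝ, 1 ≤ C ∧ ∀ N : ℕ, 1 ≤ N → ∀ F : ℤ → ℤ → ℝ, (∀ n m, 0 ≤ F n m) →
      ∑ q ∈ nzQuads N, F (q.1.1 * q.1.2) (q.2.1 * q.2.2) ≤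
        C * (N : ℝ) ^ ε * ∑ x ∈ nzInts N, ∑ y ∈ nzInts N, ∑ m ∈ nzInts (N ^ 2), F (x * y) m := by
  obtain ⟨C, hC, h⟩ := sum_mul_le ε hε
  refine ⟨C, hC, fun N hN F hF => ?_⟩
  rw [sum_nzQuads]
  simp only [Finset.mul_sum (nzInts N)]
  refine Finset.sum_le_sum fun x _ => Finset.sum_le_sum fun y _ => ?_
  exact h N hN (F (x * y)) (hF _)

theorem sum_quads_det_ne_le (ε : ℝ) (hε : 0 < ε) :
    ∃ C : ℝ, 1 ≤ C ∧ ∀ N : ℕ, 1 ≤ N →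
      ∑ q ∈ nzQuads N, (if q.1.1 * q.1.2 ≠ q.2.1 * q.2.2 then
        1 / |((q.1.1 * q.1.2 - q.2.1 * q.2.2 : ℤ) : ℝ)| else 0) ≤
          C * (N : ℝ) ^ ε * (N : ℝ) ^ 2 := by
  obtain ⟨C, hC, h⟩ := sum_quads_det_le (ε / 2) (by positivity)
  obtain ⟨C', hC', h'⟩ := sum_one_div_two_pow_le (ε / 2) (by positivity) 2 (by norm_num)
  refine ⟨C * (4 * C'), by nlinarith, fun N hN => ?_⟩
  have hNp : (0 : ℝ) < N := by exact_mod_cast hN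
  refine (h N hN (fun n m => if n ≠ m then 1 / |((n - m : ℤ) : ℝ)| else 0)
    (fun n m => by split_ifs <;> positivity)).trans ?_
  calc _ ≤ C * (N : ℝ) ^ (ε / 2) * ∑ x ∈ nzInts N, ∑ y ∈ nzInts N, (C' * (N : ℝ) ^ (ε / 2)) := by
        refine mul_le_mul_of_nonneg_left ?_ (by positivity)
        refine Finset.sum_le_sum fun x hx => Finset.sum_le_sum fun y hy => ?_
        refine (sum_one_div_abs_sub_le _ (x * y) ?_).trans (h' N hN)
        rw [sq]
        exact mul_mem_nzInts hx hy
    _ = C * (4 * C') * ((N : ℝ) ^ (ε / 2) * (N : ℝ) ^ (ε / 2)) * (N : ℝ) ^ 2 := by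
        simp only [Finset.sum_const, card_nzInts, nsmul_eq_mul]
        push_cast
        ring
    _ = _ := by rw [← Real.rpow_add hNp, add_halves]

theorem sum_quads_det_eq_le (ε : ℝ) (hε : 0 < ε) :
    ∃ C : ℝ, 1 ≤ C ∧ ∀ N : ℕ, 1 ≤ N →
      ∑ q ∈ nzQuads N, (if q.1.1 * q.1.2 = q.2.1 * q.2.2 then
        1 / √|((q.1.1 * q.1.2 : ℤ) : ℝ)| else 0) ≤ C * (N : ℝ) ^ ε * N := by
  obtain ⟨C, hC, h⟩ := sum_quads_det_le ε hε
  refine ⟨C * 16, by linarith, fun N hN => ?_⟩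
  have hNp : (0 : ℝ) < N := by exact_mod_cast hN
  refine (h N hN (fun n m => if n = m then 1 / √|(n : ℝ)| else 0)
    (fun n m => by split_ifs <;> positivity)).trans ?_
  calc _ ≤ C * (N : ℝ) ^ ε * ∑ x ∈ nzInts N, ∑ y ∈ nzInts N, 1 / √|((x * y : ℤ) : ℝ)| := by
        gcongr
        exact sum_if_eq_le _ _ _ (by positivity)
    _ = C * (N : ℝ) ^ ε * (∑ x ∈ nzInts N, 1 / √|(x : ℝ)|) ^ 2 := by
        simp only [Int.cast_mul, abs_mul, Real.sqrt_mul (abs_nonneg _), one_div, mul_inv,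
          ← Finset.mul_sum, ← Finset.sum_mul]
        ring
    _ ≤ C * (N : ℝ) ^ ε * (4 * √(N : ℝ)) ^ 2 := by
        gcongr
        exact sum_nzInts_one_div_sqrt_le N
    _ = _ := by
        rw [mul_pow, Real.sq_sqrt hNp.le]; ring

theorem sum_quads_det_window_le (ε : ℝ) (hε : 0 < ε) :
    ∃ C : ℝ, 1 ≤ C ∧ ∀ N : ℕ, 1 ≤ N → ∀ Y : ℝ, 1 ≤ Y →
      ∑ q ∈ nzQuads N, (if |((q.1.1 * q.1.2 - q.2.1 * q.2.2 : ℤ) : ℝ)| ≤ Y then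
        1 / √(1 + |((q.1.1 * q.1.2 - q.2.1 * q.2.2 : ℤ) : ℝ)|) else 0) ≤
          C * (N : ℝ) ^ ε * (N : ℝ) ^ 2 * √Y := by
  obtain ⟨C, hC, h⟩ := sum_quads_det_le ε hε
  refine ⟨C * 20, by linarith, fun N hN Y hY => ?_⟩
  have hNp : (0 : ℝ) < N := by exact_mod_cast hN
  have hwin : ∀ n : ℤ, ∑ m ∈ nzInts (N ^ 2), (if |((n - m : ℤ) : ℝ)| ≤ Y then
      1 / √(1 + |((n - m : ℤ) : ℝ)|) else 0) ≤ 5 * √Y := by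
    intro n
    rw [← Finset.sum_filter]
    rw [← Finset.sum_image (f := fun a : ℤ => 1 / √(1 + |(a : ℝ)|)) (g := fun m => n - m)
      (by intro a _ b _ h; simpa using h)]
    have hfl : 1 ≤ ⌊Y⌋₊ := Nat.le_floor (by simpa using hY)
    calc _ ≤ ∑ a ∈ Finset.Icc (-(⌊Y⌋₊ : ℤ)) ⌊Y⌋₊, 1 / √(1 + |(a : ℝ)|) := by
          refine Finset.sum_le_sum_of_subset_of_nonneg ?_ fun _ _ _ => by positivity
          intro a ha
          obtain ⟨m, hm, rfl⟩ := Finset.mem_image.mp ha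
          have hm2 := (Finset.mem_filter.mp hm).2
          have : (n - m).natAbs ≤ ⌊Y⌋₊ := Nat.le_floor (by
            rw [Nat.cast_natAbs]; simpa using hm2)
          rw [Finset.mem_Icc]
          omega
      _ ≤ 5 * √(⌊Y⌋₊ : ℝ) := sum_Icc_one_div_sqrt_one_add_le _ hfl
      _ ≤ _ := by
          gcongr
          exact Nat.floor_le (by linarith)
  refine (h N hN (fun n m => if |((n - m : ℤ) : ℝ)| ≤ Y then
      1 / √(1 + |((n - m : ℤ) : ℝ)|) else 0)
    (fun n m => by split_ifs <;> positivity)).trans ?_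
  calc _ ≤ C * (N : ℝ) ^ ε * ∑ x ∈ nzInts N, ∑ y ∈ nzInts N, (5 * √Y) := by
        gcongr
        exact hwin _
    _ = _ := by
        simp only [Finset.sum_const, card_nzInts, nsmul_eq_mul]
        push_cast
        ring

/-- The linear map of `ℝ × ℝ` with matrix `!![a, b; c, d]`. -/
noncomputable def linMap (a b c d : ℝ) : ℝ × ℝ →ₗ[ℝ] ℝ × ℝ :=
  Matrix.toLin (Module.Basis.finTwoProd ℝ) (Module.Basis.finTwoProd ℝ) !![a, b; c, d]

theorem linMap_apply (a b c d : ℝ) (x : ℝ × ℝ) :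
    linMap a b c d x = (a * x.1 + b * x.2, c * x.1 + d * x.2) := by
  rw [linMap, Matrix.toLin_finTwoProd_apply]

theorem det_linMap (a b c d : ℝ) : LinearMap.det (linMap a b c d) = a * d - b * c := by
  rw [linMap, LinearMap.det_toLin, Matrix.det_fin_two_of]

theorem map_linMap {a b c d : ℝ} (h : a * d - b * c ≠ 0) :
    Measure.map (linMap a b c d) (volume : Measure (ℝ × ℝ)) =
      ENNReal.ofReal (|a * d - b * c|⁻¹) • volume := by
  have hd : LinearMap.det (linMap a b c d) ≠ 0 := by rwa [det_linMap]
  rw [Measure.map_linearMap_addHaar_eq_smul_addHaar _ hd, det_linMap, abs_inv]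

theorem continuous_linMap (a b c d : ℝ) : Continuous (linMap a b c d) :=
  (linMap a b c d).continuous_of_finiteDimensional

theorem integral_comp_linMap {a b c d : ℝ} (h : a * d - b * c ≠ 0) (f : ℝ × ℝ → ℝ) :
    ∫ x : ℝ × ℝ, f (a * x.1 + b * x.2, c * x.1 + d * x.2) =
      |a * d - b * c|⁻¹ * ∫ x, f x := by
  have hd : LinearMap.det (linMap a b c d) ≠ 0 := by rwa [det_linMap]
  have he : MeasurableEmbedding (linMap a b c d) :=
    (LinearEquiv.ofIsUnitDet (f := linMap a b c d)
      (v := Module.Basis.finTwoProd ℝ) (v' := Module.Basis.finTwoProd ℝ) (by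
        rw [LinearMap.det_toMatrix]
        exact hd.isUnit)).toContinuousLinearEquiv.toHomeomorph.measurableEmbedding
  have := he.integral_map (μ := volume) f
  rw [map_linMap h, integral_smul_measure, ENNReal.toReal_ofReal (by positivity)] at this
  simp only [linMap_apply] at this
  rw [← this, smul_eq_mul]

theorem volume_two_slabs_le {A C A' C' : ℝ} (h : A * C' - C * A' ≠ 0) (b b' δ : ℝ) :
    volume {α : ℝ × ℝ | |A * α.1 + C * α.2 + b| ≤ δ ∧ |A' * α.1 + C' * α.2 + b'| ≤ δ} ≤
      ENNReal.ofReal (4 * δ ^ 2 / |A * C' - C * A'|) := by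
  have h1 : {α : ℝ × ℝ | |A * α.1 + C * α.2 + b| ≤ δ ∧ |A' * α.1 + C' * α.2 + b'| ≤ δ} =
      linMap A C A' C' ⁻¹' (Set.Icc (-δ - b) (δ - b) ×ˢ Set.Icc (-δ - b') (δ - b')) := by
    ext α
    simp only [Set.mem_ofPred_eq, Set.mem_preimage, linMap_apply, Set.mem_prod, Set.mem_Icc,
      abs_le]
    constructor <;> rintro ⟨⟨h1, h2⟩, h3, h4⟩ <;> refine ⟨⟨?_, ?_⟩, ?_, ?_⟩ <;> linarith
  rw [h1, ← Measure.map_apply (continuous_linMap _ _ _ _).measurable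
    (measurableSet_Icc.prod measurableSet_Icc), map_linMap h, Measure.smul_apply,
    Measure.volume_eq_prod, Measure.prod_prod, Real.volume_Icc, Real.volume_Icc]
  rcases le_or_gt 0 δ with hδ | hδ
  · rw [smul_eq_mul, ← ENNReal.ofReal_mul (by linarith), ← ENNReal.ofReal_mul (by positivity)]
    refine ENNReal.ofReal_le_ofReal (le_of_eq ?_)
    field_simp
    ring
  · rw [ENNReal.ofReal_of_nonpos (p := δ - b - (-δ - b)) (by linarith)]
    simp

/-- A strip of width `δ` inside a square of half-side `P`. -/
def strip (P ξ ζ b δ : ℝ) : Set (ℝ × ℝ) :=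
  {v | |v.1| ≤ P ∧ |v.2| ≤ P ∧ |ξ * v.1 + ζ * v.2 + b| ≤ δ}

theorem measurableSet_strip (P ξ ζ b δ : ℝ) : MeasurableSet (strip P ξ ζ b δ) := by
  unfold strip
  simp only [Set.ofPred_and]
  exact (measurableSet_le (by fun_prop) measurable_const).inter
    ((measurableSet_le (by fun_prop) measurable_const).inter
      (measurableSet_le (by fun_prop) measurable_const))

theorem volume_setOf_abs_le {ξ b δ : ℝ} (hξ : ξ ≠ 0) :
    volume {x : ℝ | |ξ * x + b| ≤ δ} ≤ ENNReal.ofReal (2 * δ / |ξ|) := by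
  have hp : 0 < |ξ| := abs_pos.mpr hξ
  have : {x : ℝ | |ξ * x + b| ≤ δ} ⊆ Set.Icc (-b / ξ - δ / |ξ|) (-b / ξ + δ / |ξ|) := by
    intro x hx
    have hx' : |ξ * x + b| ≤ δ := hx
    have h2 : ξ * x + b = ξ * (x - -b / ξ) := by field_simp; ring
    rw [h2, abs_mul] at hx'
    have h3 : |x - -b / ξ| ≤ δ / |ξ| := by rw [le_div_iff₀ hp]; linarith
    rw [abs_le] at h3
    constructor <;> linarith
  refine (measure_mono this).trans ?_
  rw [Real.volume_Icc]
  exact ENNReal.ofReal_le_ofReal (le_of_eq (by ring))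

theorem volume_strip_le_left {P ξ ζ b δ : ℝ} (hδ : 0 ≤ δ) (hξ : ξ ≠ 0) :
    volume (strip P ξ ζ b δ) ≤ ENNReal.ofReal (4 * P * δ / |ξ|) := by
  rw [Measure.volume_eq_prod, Measure.prod_apply_symm (measurableSet_strip _ _ _ _ _)]
  calc _ ≤ ∫⁻ y : ℝ, (Set.Icc (-P) P).indicator (fun _ => ENNReal.ofReal (2 * δ / |ξ|)) y := by
        refine lintegral_mono fun y => ?_
        by_cases hy : |y| ≤ P
        · rw [Set.indicator_of_mem (by rwa [Set.mem_Icc, ← abs_le])]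
          refine (measure_mono ?_).trans (volume_setOf_abs_le (b := ζ * y + b) hξ)
          intro x hx
          have hx' := hx.2.2
          simp only [Set.mem_ofPred_eq]
          rwa [← add_assoc]
        · have : (fun x => (x, y)) ⁻¹' strip P ξ ζ b δ = ∅ := by
            ext x
            simp only [Set.mem_preimage, Set.mem_empty_iff_false, iff_false]
            exact fun hx => hy hx.2.1
          rw [this]
          simp
    _ = _ := by
        rw [lintegral_indicator measurableSet_Icc, setLIntegral_const, Real.volume_Icc,
          ← ENNReal.ofReal_mul (by positivity)]
        congr 1
        ring

theorem volume_strip_le_right {P ξ ζ b δ : ℝ} (hδ : 0 ≤ δ) (hζ : ζ ≠ 0) :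
    volume (strip P ξ ζ b δ) ≤ ENNReal.ofReal (4 * P * δ / |ζ|) := by
  have h : strip P ξ ζ b δ = Prod.swap ⁻¹' strip P ζ ξ b δ := by
    ext v
    simp only [strip, Set.mem_preimage, Set.mem_ofPred_eq, Prod.fst_swap, Prod.snd_swap]
    rw [add_comm (ζ * v.2)]
    tauto
  rw [h, Measure.volume_eq_prod, (Measure.measurePreserving_swap).measure_preimage
    (measurableSet_strip _ _ _ _ _).nullMeasurableSet]
  exact volume_strip_le_left hδ hζ

theorem volume_strip_le {P ξ ζ b δ : ℝ} (hδ : 0 ≤ δ) (h : 0 < max |ξ| |ζ|) :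
    volume (strip P ξ ζ b δ) ≤ ENNReal.ofReal (4 * P * δ / max |ξ| |ζ|) := by
  rcases max_cases |ξ| |ζ| with ⟨h1, _⟩ | ⟨h1, _⟩
  · rw [h1] at h ⊢
    exact volume_strip_le_left hδ (abs_pos.mp h)
  · rw [h1] at h ⊢
    exact volume_strip_le_right hδ (abs_pos.mp h)

/-- The quadratic form with real arguments. -/
def qr (α v : ℝ × ℝ) : ℝ := α.1 * v.1 ^ 2 + v.1 * v.2 + α.2 * v.2 ^ 2

/-- The symmetric bilinear form polarizing `qr`. -/
noncomputable def bf (α g h : ℝ × ℝ) : ℝ :=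
  α.1 * (g.1 * h.1) + α.2 * (g.2 * h.2) + (g.1 * h.2 + g.2 * h.1) / 2

/-- The determinant of a pair of plane vectors. -/
def wedge (g h : ℝ × ℝ) : ℝ := g.1 * h.2 - g.2 * h.1

/-- The determinant of the linear system in `α` given by `bf α g h` and `bf α g' h'`. -/
def pairDet (g h g' h' : ℝ × ℝ) : ℝ := g.1 * h.1 * (g'.2 * h'.2) - g.2 * h.2 * (g'.1 * h'.1)

/-- A box of parameters on which the forms are uniformly positive definite. -/
def box (R : ℝ) : Set (ℝ × ℝ) := Set.Icc (3 / 4) R ×ˢ Set.Icc (3 / 4) R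

theorem mem_box {R : ℝ} {α : ℝ × ℝ} :
    α ∈ box R ↔ (3 / 4 ≤ α.1 ∧ α.1 ≤ R) ∧ 3 / 4 ≤ α.2 ∧ α.2 ≤ R := by
  simp only [box, Set.mem_prod, Set.mem_Icc]

theorem measurableSet_box (R : ℝ) : MeasurableSet (box R) :=
  measurableSet_Icc.prod measurableSet_Icc

theorem qr_sub_qr (α v w : ℝ × ℝ) : qr α v - qr α w = bf α (v - w) (v + w) := by
  simp only [qr, bf, Prod.fst_sub, Prod.snd_sub, Prod.fst_add, Prod.snd_add]
  ring

theorem bf_comm (α g h : ℝ × ℝ) : bf α g h = bf α h g := by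
  simp only [bf]; ring

theorem le_qr {R : ℝ} {α : ℝ × ℝ} (hα : α ∈ box R) (v : ℝ × ℝ) :
    (v.1 ^ 2 + v.2 ^ 2) / 4 ≤ qr α v := by
  rw [mem_box] at hα
  simp only [qr]
  nlinarith [mul_nonneg (sub_nonneg.mpr hα.1.1) (sq_nonneg v.1),
    mul_nonneg (sub_nonneg.mpr hα.2.1) (sq_nonneg v.2), sq_nonneg (v.1 + v.2)]

/-- Coordinates of absolute value between `l` and `P`. -/
def inAnnulus (l P : ℝ) (v : ℝ × ℝ) : Prop :=
  (l ≤ |v.1| ∧ |v.1| ≤ P) ∧ l ≤ |v.2| ∧ |v.2| ≤ P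

/-- Twice the gradient of `h ↦ bf α g h`. -/
def grad (α g : ℝ × ℝ) : ℝ × ℝ := (2 * α.1 * g.1 + g.2, g.1 + 2 * α.2 * g.2)

theorem abs_le_grad {R : ℝ} {α : ℝ × ℝ} (hα : α ∈ box R) (g : ℝ × ℝ) :
    (|g.1| + |g.2|) / 4 ≤ max |(grad α g).1| |(grad α g).2| := by
  set m := max |(grad α g).1| |(grad α g).2|
  have h0 := le_qr hα g
  have h1 : 2 * qr α g = (grad α g).1 * g.1 + (grad α g).2 * g.2 := by
    simp only [qr, grad]; ring
  have h2 : (grad α g).1 * g.1 ≤ m * |g.1| :=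
    (le_abs_self _).trans (by
      rw [abs_mul]; exact mul_le_mul_of_nonneg_right (le_max_left _ _) (abs_nonneg _))
  have h3 : (grad α g).2 * g.2 ≤ m * |g.2| :=
    (le_abs_self _).trans (by
      rw [abs_mul]; exact mul_le_mul_of_nonneg_right (le_max_right _ _) (abs_nonneg _))
  have h4 : (|g.1| + |g.2|) ^ 2 ≤ 4 * (m * (|g.1| + |g.2|)) := by
    nlinarith [sq_abs g.1, sq_abs g.2, sq_nonneg (|g.1| - |g.2|)]
  rcases (add_nonneg (abs_nonneg g.1) (abs_nonneg g.2)).eq_or_lt with h | h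
  · rw [← h, zero_div]
    exact (abs_nonneg _).trans (le_max_left _ _)
  · by_contra hc
    push Not at hc
    nlinarith

theorem abs_grad_le {R P : ℝ} {α g : ℝ × ℝ} (hR : 1 ≤ R) (hα : α ∈ box R)
    (h1 : |g.1| ≤ P) (h2 : |g.2| ≤ P) :
    |(grad α g).1| ≤ 3 * R * P ∧ |(grad α g).2| ≤ 3 * R * P := by
  rw [mem_box] at hα
  have hP : 0 ≤ P := (abs_nonneg _).trans h1
  have ha : |α.1| ≤ R := abs_le.mpr ⟨by linarith, hα.1.2⟩
  have hb : |α.2| ≤ R := abs_le.mpr ⟨by linarith, hα.2.2⟩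
  have e1 : |α.1 * g.1| ≤ R * P := by rw [abs_mul]; gcongr
  have e2 : |α.2 * g.2| ≤ R * P := by rw [abs_mul]; gcongr
  have e3 : P ≤ R * P := by nlinarith
  simp only [grad]
  rw [abs_le] at *
  rw [abs_le]
  constructor <;> constructor <;> nlinarith

theorem det_identity (α g h g' h' : ℝ × ℝ) :
    (grad α g).2 * (grad α g').2 * pairDet g h g' h' =
      -2 * (h.1 * h'.1) * (wedge g g' * bf α g g') +
        2 * bf α g' h' * (g.1 * h.1 * g'.2 * (grad α g).2) -
        2 * bf α g h * (g.2 * g'.1 * h'.1 * (grad α g').2) := by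
  simp only [grad, pairDet, wedge, bf]
  ring

theorem wedge_mul_bf_le {R l P δ : ℝ} {α g h g' h' : ℝ × ℝ} (hR : 1 ≤ R) (hα : α ∈ box R)
    (hl : 0 ≤ l) (hg : inAnnulus l P g) (hh : inAnnulus l P h) (hg' : inAnnulus l P g')
    (hh' : inAnnulus l P h') (hL : |bf α g h| ≤ δ) (hL' : |bf α g' h'| ≤ δ) :
    2 * l ^ 2 * (|wedge g g'| * |bf α g g'|) ≤
      9 * R ^ 2 * P ^ 2 * |pairDet g h g' h'| + 12 * R * δ * P ^ 4 := by
  have hid := det_identity α g h g' h'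
  have hP : 0 ≤ P := (abs_nonneg _).trans hg.1.2
  have hδ : 0 ≤ δ := (abs_nonneg _).trans hL
  obtain ⟨-, z1⟩ := abs_grad_le hR hα hg.1.2 hg.2.2
  obtain ⟨-, z2⟩ := abs_grad_le hR hα hg'.1.2 hg'.2.2
  have e0 : |h.1 * h'.1| ≥ l ^ 2 := by
    rw [abs_mul, sq]; exact mul_le_mul hh.1.1 hh'.1.1 hl (abs_nonneg _)
  have e1 : |(grad α g).2 * (grad α g').2 * pairDet g h g' h'| ≤
      (3 * R * P) * (3 * R * P) * |pairDet g h g' h'| := by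
    rw [abs_mul, abs_mul]; gcongr
  have e2 : |bf α g' h' * (g.1 * h.1 * g'.2 * (grad α g).2)| ≤ δ * (P * P * P * (3 * R * P)) := by
    simp only [abs_mul]
    gcongr
    exacts [hg.1.2, hh.1.2, hg'.2.2]
  have e3 : |bf α g h * (g.2 * g'.1 * h'.1 * (grad α g').2)| ≤ δ * (P * P * P * (3 * R * P)) := by
    simp only [abs_mul]
    gcongr
    exacts [hg.2.2, hg'.1.2, hh'.1.2]
  have e4 : l ^ 2 * (|wedge g g'| * |bf α g g'|) ≤ |(h.1 * h'.1) * (wedge g g' * bf α g g')| := by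
    rw [abs_mul (h.1 * h'.1), abs_mul (wedge g g')]
    exact mul_le_mul_of_nonneg_right e0 (by positivity)
  set a := (h.1 * h'.1) * (wedge g g' * bf α g g')
  set b := bf α g' h' * (g.1 * h.1 * g'.2 * (grad α g).2)
  set c := bf α g h * (g.2 * g'.1 * h'.1 * (grad α g').2)
  set d := (grad α g).2 * (grad α g').2 * pairDet g h g' h'
  have e5 : 2 * a = -d + 2 * b - 2 * c := by linarith
  clear_value a b c d
  have e6 : 2 * |a| ≤ |d| + 2 * |b| + 2 * |c| := by
    have : 2 * |a| = |2 * a| := by rw [abs_mul, abs_two]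
    rw [this, e5]
    calc _ ≤ |-d + 2 * b| + |2 * c| := abs_sub _ _
      _ ≤ |-d| + |2 * b| + |2 * c| := by gcongr; exact abs_add_le _ _
      _ = _ := by rw [abs_neg, abs_mul, abs_mul, abs_two]
  nlinarith

theorem bf_identity (α g' h' : ℝ × ℝ) :
    qr α g' * qr α h' - bf α g' h' ^ 2 = (α.1 * α.2 - 1 / 4) * wedge g' h' ^ 2 := by
  simp only [qr, bf, wedge]; ring

theorem le_wedge {R l P δ : ℝ} {α g h : ℝ × ℝ} (hR : 1 ≤ R) (hα : α ∈ box R)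
    (hl : 2 ≤ l) (hg : inAnnulus l P g) (hh : inAnnulus l P h) (hδ : δ ≤ 1)
    (hL : |bf α g h| ≤ δ) : l ^ 2 / (3 * R) ≤ |wedge g h| := by
  have hid := bf_identity α g h
  have hsq : ∀ v, inAnnulus l P v → l ^ 2 / 2 ≤ qr α v := by
    intro v hv
    have h0 := le_qr hα v
    have h1 : l ^ 2 ≤ v.1 ^ 2 := by rw [← sq_abs v.1]; exact pow_le_pow_left₀ (by linarith) hv.1.1 2
    have h2 : l ^ 2 ≤ v.2 ^ 2 := by rw [← sq_abs v.2]; exact pow_le_pow_left₀ (by linarith) hv.2.1 2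
    linarith
  have h1 := mul_le_mul (hsq g hg) (hsq h hh) (by positivity)
    ((by positivity : 0 ≤ l ^ 2 / 2).trans (hsq g hg))
  have h2 : bf α g h ^ 2 ≤ 1 := by
    rw [← sq_abs]; exact pow_le_one₀ (abs_nonneg _) (hL.trans hδ)
  have h3 : 16 ≤ l ^ 4 := by
    calc (16 : ℝ) = 2 ^ 4 := by norm_num
      _ ≤ l ^ 4 := by gcongr
  rw [mem_box] at hα
  have h4 : (α.1 * α.2 - 1 / 4) ≤ R ^ 2 := by nlinarith
  have h5 : l ^ 4 / 8 ≤ R ^ 2 * wedge g h ^ 2 := by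
    have := mul_le_mul_of_nonneg_right h4 (sq_nonneg (wedge g h))
    nlinarith
  refine abs_le_of_sq_le_sq' (a := l ^ 2 / (3 * R)) ?_ (abs_nonneg _) |>.2
  rw [sq_abs, div_pow, div_le_iff₀ (by positivity)]
  nlinarith

theorem le_max_bf {R l P δ : ℝ} {α g g' h' : ℝ × ℝ} (hR : 1 ≤ R) (hα : α ∈ box R)
    (hl : 2 ≤ l) (hg : inAnnulus l P g) (hg' : inAnnulus l P g') (hh' : inAnnulus l P h')
    (hδ : δ ≤ 1) (hL' : |bf α g' h'| ≤ δ) :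
    l ^ 3 / (24 * R * P) ≤ |bf α g g'| ∨ l ^ 3 / (24 * R * P) ≤ |bf α g h'| := by
  by_contra! hc
  obtain ⟨c1, c2⟩ := hc
  have hP : 2 ≤ P := hl.trans (hg.1.1.trans hg.1.2)
  have hw := le_wedge hR hα hl hg' hh' hδ hL'
  have hgr := abs_le_grad hα g
  have key : ∀ (u x y : ℝ), |x| ≤ P → |y| ≤ P → l / 2 ≤ |u| →
      wedge g' h' * u = 2 * (bf α g h' * x - bf α g g' * y) → False := by
    intro u x y hx hy hu he
    have k1 : l ^ 2 / (3 * R) * (l / 2) ≤ |wedge g' h' * u| := by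
      rw [abs_mul]; exact mul_le_mul hw hu (by linarith) (abs_nonneg _)
    have k2 : |bf α g h' * x - bf α g g' * y| ≤ |bf α g h'| * P + |bf α g g'| * P := by
      refine (abs_sub _ _).trans ?_
      rw [abs_mul, abs_mul]; gcongr
    rw [he, abs_mul, abs_two] at k1
    have k3 : |bf α g h'| * P + |bf α g g'| * P < 2 * (l ^ 3 / (24 * R * P) * P) := by
      nlinarith
    have k4 : 2 * (2 * (l ^ 3 / (24 * R * P) * P)) = l ^ 2 / (3 * R) * (l / 2) := by
      field_simp; norm_num
    linarith
  have hgl : l / 2 ≤ (|g.1| + |g.2|) / 4 := by linarith [hg.1.1, hg.2.1]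
  rcases le_max_iff.mp (hgl.trans hgr) with h | h
  · exact key (grad α g).1 (-g'.2) (-h'.2) (by rw [abs_neg]; exact hg'.2.2)
      (by rw [abs_neg]; exact hh'.2.2) h (by simp only [grad, bf, wedge]; ring)
  · exact key (grad α g).2 g'.1 h'.1 hg'.1.2 hh'.1.2 h (by simp only [grad, bf, wedge]; ring)

theorem wedge_le_or {R l P δ : ℝ} {α g h g' h' : ℝ × ℝ} (hR : 1 ≤ R) (hα : α ∈ box R)
    (hl : 2 ≤ l) (hg : inAnnulus l P g) (hh : inAnnulus l P h) (hg' : inAnnulus l P g')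
    (hh' : inAnnulus l P h') (hδ : δ ≤ 1) (hL : |bf α g h| ≤ δ) (hL' : |bf α g' h'| ≤ δ) :
    (|wedge g g'| ≤ 144 * R ^ 3 * (P ^ 3 * |pairDet g h g' h'| + P ^ 5 * δ) / l ^ 5 ∧
      |wedge h h'| ≤ 144 * R ^ 3 * (P ^ 3 * |pairDet g h g' h'| + P ^ 5 * δ) / l ^ 5) ∨
    (|wedge g h'| ≤ 144 * R ^ 3 * (P ^ 3 * |pairDet g h g' h'| + P ^ 5 * δ) / l ^ 5 ∧
      |wedge h g'| ≤ 144 * R ^ 3 * (P ^ 3 * |pairDet g h g' h'| + P ^ 5 * δ) / l ^ 5) := by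
  have hP : 2 ≤ P := hl.trans (hg.1.1.trans hg.1.2)
  have hl0 : 0 ≤ l := by linarith
  have hδ0 : 0 ≤ δ := (abs_nonneg _).trans hL
  have hLs : |bf α h g| ≤ δ := by rwa [bf_comm]
  have hLs' : |bf α h' g'| ≤ δ := by rwa [bf_comm]
  have hd1 : pairDet h g g' h' = pairDet g h g' h' := by simp only [pairDet]; ring
  have hd2 : pairDet g h h' g' = pairDet g h g' h' := by simp only [pairDet]; ring
  have hd3 : pairDet h g h' g' = pairDet g h g' h' := by simp only [pairDet]; ring
  have fin : ∀ w b : ℝ, l ^ 3 / (24 * R * P) ≤ |b| →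
      2 * l ^ 2 * (|w| * |b|) ≤ 9 * R ^ 2 * P ^ 2 * |pairDet g h g' h'| + 12 * R * δ * P ^ 4 →
      |w| ≤ 144 * R ^ 3 * (P ^ 3 * |pairDet g h g' h'| + P ^ 5 * δ) / l ^ 5 := by
    intro w b hb hw
    set D := |pairDet g h g' h'|
    have hD : 0 ≤ D := abs_nonneg _
    have h1 : 2 * l ^ 2 * (|w| * (l ^ 3 / (24 * R * P))) ≤
        9 * R ^ 2 * P ^ 2 * D + 12 * R * δ * P ^ 4 :=
      le_trans (by gcongr) hw
    have h2 : 2 * l ^ 2 * (|w| * (l ^ 3 / (24 * R * P))) = |w| * l ^ 5 / (12 * R * P) := by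
      field_simp; ring
    rw [h2, div_le_iff₀ (by positivity)] at h1
    rw [le_div_iff₀ (by positivity)]
    have h3 : R ^ 2 ≤ R ^ 3 := by nlinarith [sq_nonneg R]
    have h4 : R ^ 2 * (P ^ 5 * δ) ≤ R ^ 3 * (P ^ 5 * δ) := by gcongr
    have h5 : 0 ≤ R ^ 3 * (P ^ 3 * D) := by positivity
    nlinarith
  have b1 := le_max_bf hR hα hl hg hg' hh' hδ hL'
  have b2 := le_max_bf hR hα hl hh hg' hh' hδ hL'
  have b3 := le_max_bf hR hα hl hg' hg hh hδ hL
  have b4 := le_max_bf hR hα hl hh' hg hh hδ hL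
  rw [bf_comm α g' g, bf_comm α g' h] at b3
  rw [bf_comm α h' g, bf_comm α h' h] at b4
  have k1 := wedge_mul_bf_le hR hα hl0 hg hh hg' hh' hL hL'
  have k2 := wedge_mul_bf_le hR hα hl0 hh hg hh' hg' hLs hLs'
  have k3 := wedge_mul_bf_le hR hα hl0 hg hh hh' hg' hL hLs'
  have k4 := wedge_mul_bf_le hR hα hl0 hh hg hg' hh' hLs hL'
  rw [hd3] at k2
  rw [hd2] at k3
  rw [hd1] at k4
  by_cases c : l ^ 3 / (24 * R * P) ≤ |bf α g g'| ∧ l ^ 3 / (24 * R * P) ≤ |bf α h h'|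
  · exact Or.inl ⟨fin _ _ c.1 k1, fin _ _ c.2 k2⟩
  · have c' : l ^ 3 / (24 * R * P) ≤ |bf α g h'| ∧ l ^ 3 / (24 * R * P) ≤ |bf α h g'| := by
      tauto
    exact Or.inr ⟨fin _ _ c'.1 k3, fin _ _ c'.2 k4⟩

/-- Parameters in the box for which `g` and `h` are `δ`-nearly orthogonal. -/
def cell (R δ : ℝ) (g h : ℝ × ℝ) : Set (ℝ × ℝ) := {α | α ∈ box R ∧ |bf α g h| ≤ δ}

theorem measurableSet_cell (R δ : ℝ) (g h : ℝ × ℝ) : MeasurableSet (cell R δ g h) := by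
  unfold cell
  rw [Set.ofPred_and]
  refine (measurableSet_box R).inter (measurableSet_le ?_ measurable_const)
  unfold bf
  fun_prop

theorem volume_box_lt_top (R : ℝ) : volume (box R) < ⊤ :=
  (isCompact_Icc.prod isCompact_Icc).measure_lt_top

theorem cell_subset_box (R δ : ℝ) (g h : ℝ × ℝ) : cell R δ g h ⊆ box R := fun _ h => h.1

theorem cell_ne_top (R δ : ℝ) (g h : ℝ × ℝ) : volume (cell R δ g h) ≠ ⊤ :=
  ((measure_mono (cell_subset_box R δ g h)).trans_lt (volume_box_lt_top R)).ne

theorem cell_subset_strip (R δ : ℝ) (g h : ℝ × ℝ) :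
    cell R δ g h ⊆ strip R (g.1 * h.1) (g.2 * h.2) ((g.1 * h.2 + g.2 * h.1) / 2) δ := by
  intro α hα
  have hb := mem_box.mp hα.1
  refine ⟨abs_le.mpr ⟨by linarith, hb.1.2⟩, abs_le.mpr ⟨by linarith, hb.2.2⟩, ?_⟩
  have := hα.2
  simp only [bf] at this
  rwa [mul_comm (g.1 * h.1), mul_comm (g.2 * h.2)]

theorem cell_le_left {R δ : ℝ} {g h : ℝ × ℝ} (hR : 0 ≤ R) (hδ : 0 ≤ δ) (hg : g.1 * h.1 ≠ 0) :
    volume.real (cell R δ g h) ≤ 4 * R * δ / |g.1 * h.1| :=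
  ENNReal.toReal_le_of_le_ofReal (by positivity)
    ((measure_mono (cell_subset_strip R δ g h)).trans (volume_strip_le_left hδ hg))

theorem cell_le_right {R δ : ℝ} {g h : ℝ × ℝ} (hR : 0 ≤ R) (hδ : 0 ≤ δ) (hg : g.2 * h.2 ≠ 0) :
    volume.real (cell R δ g h) ≤ 4 * R * δ / |g.2 * h.2| :=
  ENNReal.toReal_le_of_le_ofReal (by positivity)
    ((measure_mono (cell_subset_strip R δ g h)).trans (volume_strip_le_right hδ hg))

theorem cell_inter_cell_le {R δ : ℝ} {g h g' h' : ℝ × ℝ}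
    (hd : pairDet g h g' h' ≠ 0) :
    volume.real (cell R δ g h ∩ cell R δ g' h') ≤ 4 * δ ^ 2 / |pairDet g h g' h'| := by
  refine ENNReal.toReal_le_of_le_ofReal (by positivity) ?_
  have hd' : g.1 * h.1 * (g'.2 * h'.2) - g.2 * h.2 * (g'.1 * h'.1) ≠ 0 := hd
  refine (measure_mono ?_).trans (volume_two_slabs_le hd' ((g.1 * h.2 + g.2 * h.1) / 2)
    ((g'.1 * h'.2 + g'.2 * h'.1) / 2) δ)
  rintro α ⟨h1, h2⟩
  exact ⟨(cell_subset_strip _ _ _ _ h1).2.2, (cell_subset_strip _ _ _ _ h2).2.2⟩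

/-- The first vector encoded by a quadruple. -/
def gI (G : (ℤ × ℤ) × (ℤ × ℤ)) : ℝ × ℝ := (G.1.1, G.2.1)

/-- The second vector encoded by a quadruple. -/
def hI (G : (ℤ × ℤ) × (ℤ × ℤ)) : ℝ × ℝ := (G.1.2, G.2.2)

/-- The measure of the set of parameters for which two encoded pairs are both nearly orthogonal. -/
noncomputable def pairMeas (R δ : ℝ) (G G' : (ℤ × ℤ) × (ℤ × ℤ)) : ℝ :=
  volume.real (cell R δ (gI G) (hI G) ∩ cell R δ (gI G') (hI G'))

/-- The product of the four entries of a quadruple. -/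
def prd (X : (ℤ × ℤ) × (ℤ × ℤ)) : ℤ := X.1.1 * X.1.2 * (X.2.1 * X.2.2)

theorem pairDet_cast (G G' : (ℤ × ℤ) × (ℤ × ℤ)) :
    pairDet (gI G) (hI G) (gI G') (hI G') = ((prd (G.1, G'.2) - prd (G'.1, G.2) : ℤ) : ℝ) := by
  simp only [pairDet, gI, hI, prd]
  push_cast
  ring

theorem pairMeas_nonneg (R δ : ℝ) (G G' : (ℤ × ℤ) × (ℤ × ℤ)) : 0 ≤ pairMeas R δ G G' :=
  measureReal_nonneg

theorem ne_zero_of_mem_nzInts {N : ℕ} {x : ℤ} (h : x ∈ nzInts N) : x ≠ 0 := (mem_nzInts.mp h).1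

theorem pairMeas_le_of_ne {R δ : ℝ} {G G' : (ℤ × ℤ) × (ℤ × ℤ)}
    (h : prd (G.1, G'.2) ≠ prd (G'.1, G.2)) :
    pairMeas R δ G G' ≤ 4 * δ ^ 2 * (1 / |((prd (G.1, G'.2) - prd (G'.1, G.2) : ℤ) : ℝ)|) := by
  have := cell_inter_cell_le (R := R) (δ := δ) (g := gI G) (h := hI G) (g' := gI G') (h' := hI G')
    (by rw [pairDet_cast]; exact_mod_cast sub_ne_zero.mpr h)
  rw [pairDet_cast] at this
  rw [mul_one_div]
  exact this

theorem pairMeas_le_left {R δ : ℝ} (G G' : (ℤ × ℤ) × (ℤ × ℤ)) :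
    pairMeas R δ G G' ≤ volume.real (cell R δ (gI G) (hI G)) :=
  measureReal_mono Set.inter_subset_left (cell_ne_top _ _ _ _)

theorem pairMeas_le_right {R δ : ℝ} (G G' : (ℤ × ℤ) × (ℤ × ℤ)) :
    pairMeas R δ G G' ≤ volume.real (cell R δ (gI G') (hI G')) :=
  measureReal_mono Set.inter_subset_right (cell_ne_top _ _ _ _)

theorem le_div_sqrt_mul {x c a b : ℝ} (hc : 0 ≤ c) (ha : 0 < a) (hb : 0 < b)
    (h1 : x ≤ c / a) (h2 : x ≤ c / b) : x ≤ c * (1 / √(a * b)) := by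
  rcases le_or_gt x 0 with hx | hx
  · exact hx.trans (by positivity)
  rw [mul_one_div, le_div_iff₀ (by positivity)]
  rw [le_div_iff₀ ha] at h1
  rw [le_div_iff₀ hb] at h2
  refine (abs_le_of_sq_le_sq' ?_ hc).2
  rw [mul_pow, Real.sq_sqrt (by positivity)]
  calc x ^ 2 * (a * b) = (x * a) * (x * b) := by ring
    _ ≤ c * c := by gcongr
    _ = c ^ 2 := by ring

theorem pairMeas_le_sqrt {R δ : ℝ} {N : ℕ} {G G' : (ℤ × ℤ) × (ℤ × ℤ)} (hR : 0 ≤ R) (hδ : 0 ≤ δ)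
    (hG : G ∈ nzQuads N) (hG' : G' ∈ nzQuads N) :
    pairMeas R δ G G' ≤ 4 * R * δ * (1 / √|((prd (G.1, G'.2) : ℤ) : ℝ)|) := by
  rw [mem_nzQuads] at hG hG'
  have a1 : (gI G).1 * (hI G).1 ≠ 0 := by
    simp only [gI, hI]
    exact_mod_cast mul_ne_zero (ne_zero_of_mem_nzInts hG.1.1) (ne_zero_of_mem_nzInts hG.1.2)
  have a2 : (gI G').2 * (hI G').2 ≠ 0 := by
    simp only [gI, hI]
    exact_mod_cast mul_ne_zero (ne_zero_of_mem_nzInts hG'.2.1) (ne_zero_of_mem_nzInts hG'.2.2)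
  have h1 := (pairMeas_le_left G G').trans (cell_le_left hR hδ a1)
  have h2 := (pairMeas_le_right G G').trans (cell_le_right hR hδ a2)
  have := le_div_sqrt_mul (by positivity) (abs_pos.mpr a1) (abs_pos.mpr a2) h1 h2
  rw [← abs_mul] at this
  have e : ((prd (G.1, G'.2) : ℤ) : ℝ) = (gI G).1 * (hI G).1 * ((gI G').2 * (hI G').2) := by
    simp only [gI, hI, prd]
    push_cast
    ring
  rwa [e]

theorem sum_nzQuads_swap (N : ℕ)
    (F : (ℤ × ℤ) × (ℤ × ℤ) → (ℤ × ℤ) × (ℤ × ℤ) → ℝ) :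
    ∑ G ∈ nzQuads N, ∑ G' ∈ nzQuads N, F G G' =
      ∑ X ∈ nzQuads N, ∑ Y ∈ nzQuads N, F (X.1, Y.2) (Y.1, X.2) := by
  rw [← Finset.sum_product', ← Finset.sum_product']
  refine Finset.sum_nbij' (fun z => ((z.1.1, z.2.2), (z.2.1, z.1.2)))
    (fun z => ((z.1.1, z.2.2), (z.2.1, z.1.2))) ?_ ?_ ?_ ?_ ?_
  · intro z; simp only [Finset.mem_product, mem_nzQuads]; tauto
  · intro z; simp only [Finset.mem_product, mem_nzQuads]; tauto
  · intro z _; rfl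
  · intro z _; rfl
  · intro z _; rfl

theorem sum_pairMeas_det_zero_le (R ε : ℝ) (hR : 0 ≤ R) (hε : 0 < ε) :
    ∃ C : ℝ, 0 ≤ C ∧ ∀ N : ℕ, 1 ≤ N → ∀ δ : ℝ, 0 ≤ δ →
      ∑ G ∈ nzQuads N, ∑ G' ∈ nzQuads N,
        (if prd (G.1, G'.2) = prd (G'.1, G.2) then pairMeas R δ G G' else 0) ≤
          C * (N : ℝ) ^ ε * (N : ℝ) ^ 2 * δ := by
  obtain ⟨C, hC, h⟩ := sum_quads_eq_le ε hε
  refine ⟨4 * R * C, by positivity, fun N hN δ hδ => ?_⟩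
  calc _ ≤ ∑ G ∈ nzQuads N, ∑ G' ∈ nzQuads N, 4 * R * δ *
        (if prd (G.1, G'.2) = prd (G'.1, G.2) then
          1 / √|((prd (G.1, G'.2) : ℤ) : ℝ)| else 0) := by
        refine Finset.sum_le_sum fun G hG => Finset.sum_le_sum fun G' hG' => ?_
        split_ifs
        · exact pairMeas_le_sqrt hR hδ hG hG'
        · simp
    _ = 4 * R * δ * ∑ X ∈ nzQuads N, ∑ Y ∈ nzQuads N,
        (if prd X = prd Y then 1 / √|((prd X : ℤ) : ℝ)| else 0) := by
        rw [sum_nzQuads_swap]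
        simp only [Finset.mul_sum]
    _ ≤ 4 * R * δ * (C * (N : ℝ) ^ ε * (N : ℝ) ^ 2) := by
        gcongr
        exact h N hN
    _ = _ := by ring

/-- Some entry has absolute value at most `L`. -/
def smallQuad (L : ℕ) (X : (ℤ × ℤ) × (ℤ × ℤ)) : Prop :=
  (X.1.1.natAbs ≤ L ∨ X.1.2.natAbs ≤ L) ∨ X.2.1.natAbs ≤ L ∨ X.2.2.natAbs ≤ L

theorem card_smallQuad_le (N L : ℕ) :
    (((nzQuads N).filter (smallQuad L)).card : ℝ) ≤ 64 * L * (N : ℝ) ^ 3 := by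
  have h : (nzQuads N).filter (smallQuad L) ⊆
      (((nzInts L ×ˢ nzInts N) ×ˢ (nzInts N ×ˢ nzInts N)) ∪
        ((nzInts N ×ˢ nzInts L) ×ˢ (nzInts N ×ˢ nzInts N))) ∪
      (((nzInts N ×ˢ nzInts N) ×ˢ (nzInts L ×ˢ nzInts N)) ∪
        ((nzInts N ×ˢ nzInts N) ×ˢ (nzInts N ×ˢ nzInts L))) := by
    intro X hX
    rw [Finset.mem_filter, mem_nzQuads] at hX
    obtain ⟨⟨⟨a, b⟩, c, d⟩, h⟩ := hX
    have hm : ∀ {x : ℤ}, x ∈ nzInts N → x.natAbs ≤ L → x ∈ nzInts L := fun hx h =>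
      mem_nzInts.mpr ⟨ne_zero_of_mem_nzInts hx, h⟩
    simp only [Finset.mem_union, Finset.mem_product]
    rcases h with (h | h) | h | h
    · exact Or.inl (Or.inl ⟨⟨hm a h, b⟩, c, d⟩)
    · exact Or.inl (Or.inr ⟨⟨a, hm b h⟩, c, d⟩)
    · exact Or.inr (Or.inl ⟨⟨a, b⟩, hm c h, d⟩)
    · exact Or.inr (Or.inr ⟨⟨a, b⟩, c, hm d h⟩)
  have h2 := (Finset.card_le_card h).trans ((Finset.card_union_le _ _).trans
    (add_le_add (Finset.card_union_le _ _) (Finset.card_union_le _ _)))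
  simp only [Finset.card_product, card_nzInts] at h2
  have h3 : (2 * L * (2 * N) * (2 * N * (2 * N)) + 2 * N * (2 * L) * (2 * N * (2 * N)) +
    (2 * N * (2 * N) * (2 * L * (2 * N)) + 2 * N * (2 * N) * (2 * N * (2 * L)))) =
      64 * L * N ^ 3 := by ring
  rw [h3] at h2
  exact_mod_cast h2

theorem prd_mem_nzInts {N : ℕ} {X : (ℤ × ℤ) × (ℤ × ℤ)} (h : X ∈ nzQuads N) :
    prd X ∈ nzInts (N ^ 4) := by
  rw [mem_nzQuads] at h
  have := mul_mem_nzInts (mul_mem_nzInts h.1.1 h.1.2) (mul_mem_nzInts h.2.1 h.2.2)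
  rw [show N ^ 4 = N * N * (N * N) by ring]
  exact this

theorem sum_pairMeas_small_le (R ε : ℝ) (hε : 0 < ε) :
    ∃ C : ℝ, 0 ≤ C ∧ ∀ N : ℕ, 1 ≤ N → ∀ L : ℕ, ∀ δ : ℝ, 0 ≤ δ →
      ∑ G ∈ nzQuads N, ∑ G' ∈ nzQuads N,
        (if smallQuad L G ∧ prd (G.1, G'.2) ≠ prd (G'.1, G.2) then pairMeas R δ G G' else 0) ≤
          C * (N : ℝ) ^ ε * (N : ℝ) ^ 3 * L * δ ^ 2 := by
  obtain ⟨C, hC, h⟩ := sum_quads_ne_le ε hε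
  refine ⟨4 * (2 * 64 * C), by positivity, fun N hN L δ hδ => ?_⟩
  set K : (ℤ × ℤ) × (ℤ × ℤ) → (ℤ × ℤ) × (ℤ × ℤ) → ℝ := fun X Y =>
    if prd X ≠ prd Y then 1 / |((prd X - prd Y : ℤ) : ℝ)| else 0 with hK
  have hK0 : ∀ X Y, 0 ≤ K X Y := fun X Y => by simp only [hK]; split_ifs <;> positivity
  have hKs : ∀ X Y, K X Y = K Y X := fun X Y => by
    simp only [hK, ne_comm (a := prd X)]
    push_cast
    rw [abs_sub_comm]
  have hKle : ∀ X ∈ nzQuads N, ∑ Y ∈ nzQuads N, K X Y ≤ C * (N : ℝ) ^ ε := fun X hX =>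
    h N hN (prd X) (prd_mem_nzInts hX)
  have hone : ∑ X ∈ nzQuads N, ∑ Y ∈ nzQuads N, (if smallQuad L X then K X Y else 0) ≤
      64 * L * (N : ℝ) ^ 3 * (C * (N : ℝ) ^ ε) := by
    calc _ ≤ ∑ X ∈ nzQuads N, (if smallQuad L X then C * (N : ℝ) ^ ε else 0) := by
          refine Finset.sum_le_sum fun X hX => ?_
          split_ifs
          · exact hKle X hX
          · simp
      _ = (((nzQuads N).filter (smallQuad L)).card : ℝ) * (C * (N : ℝ) ^ ε) := by
          rw [← Finset.sum_filter, Finset.sum_const, nsmul_eq_mul]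
      _ ≤ _ := by
          gcongr
          exact card_smallQuad_le N L
  calc _ ≤ ∑ G ∈ nzQuads N, ∑ G' ∈ nzQuads N, 4 * δ ^ 2 *
        ((if smallQuad L (G.1, G'.2) then K (G.1, G'.2) (G'.1, G.2) else 0) +
          (if smallQuad L (G'.1, G.2) then K (G.1, G'.2) (G'.1, G.2) else 0)) := by
        refine Finset.sum_le_sum fun G hG => Finset.sum_le_sum fun G' hG' => ?_
        have k0 := hK0 (G.1, G'.2) (G'.1, G.2)
        by_cases c : smallQuad L G ∧ prd (G.1, G'.2) ≠ prd (G'.1, G.2)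
        · rw [if_pos c]
          refine (pairMeas_le_of_ne c.2).trans ?_
          refine mul_le_mul_of_nonneg_left ?_ (by positivity)
          have e : K (G.1, G'.2) (G'.1, G.2) =
              1 / |((prd (G.1, G'.2) - prd (G'.1, G.2) : ℤ) : ℝ)| := by
            simp only [hK]; rw [if_pos c.2]
          rw [← e]
          have hs : smallQuad L (G.1, G'.2) ∨ smallQuad L (G'.1, G.2) := by
            rcases c.1 with h | h
            · exact Or.inl (Or.inl h)
            · exact Or.inr (Or.inr h)
          rcases hs with hs | hs
          · rw [if_pos hs]; split_ifs <;> linarith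
          · rw [if_pos hs]; split_ifs <;> linarith
        · rw [if_neg c]
          refine mul_nonneg (by positivity) ?_
          split_ifs <;> linarith
    _ = 4 * δ ^ 2 * (∑ X ∈ nzQuads N, ∑ Y ∈ nzQuads N, (if smallQuad L X then K X Y else 0) +
          ∑ X ∈ nzQuads N, ∑ Y ∈ nzQuads N, (if smallQuad L X then K X Y else 0)) := by
        rw [sum_nzQuads_swap]
        simp only [← Finset.mul_sum, Finset.sum_add_distrib]
        congr 2
        rw [Finset.sum_comm]
        refine Finset.sum_congr rfl fun X _ => Finset.sum_congr rfl fun Y _ => ?_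
        rw [hKs]
    _ ≤ 4 * δ ^ 2 * (64 * L * (N : ℝ) ^ 3 * (C * (N : ℝ) ^ ε) +
          64 * L * (N : ℝ) ^ 3 * (C * (N : ℝ) ^ ε)) := by gcongr
    _ = _ := by ring

theorem sum_nzQuads_parallel (N : ℕ) (f : ℤ → ℝ) :
    ∑ G ∈ nzQuads N, ∑ G' ∈ nzQuads N,
      f (G.1.1 * G'.2.1 - G.2.1 * G'.1.1) * f (G.1.2 * G'.2.2 - G.2.2 * G'.1.2) =
      (∑ X ∈ nzQuads N, f (X.1.1 * X.1.2 - X.2.1 * X.2.2)) ^ 2 := by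
  rw [sq, Finset.sum_mul_sum, ← Finset.sum_product', ← Finset.sum_product']
  refine Finset.sum_nbij'
    (fun z => (((z.1.1.1, z.2.2.1), (z.1.2.1, z.2.1.1)),
      ((z.1.1.2, z.2.2.2), (z.1.2.2, z.2.1.2))))
    (fun z => (((z.1.1.1, z.2.1.1), (z.1.2.1, z.2.2.1)),
      ((z.1.2.2, z.2.2.2), (z.1.1.2, z.2.1.2)))) ?_ ?_ ?_ ?_ ?_
  · rintro z hz
    simp only [Finset.mem_product, mem_nzQuads] at hz ⊢
    obtain ⟨⟨⟨a, b⟩, c, d⟩, ⟨a', b'⟩, c', d'⟩ := hz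
    exact ⟨⟨⟨a, c'⟩, c, a'⟩, ⟨b, d'⟩, d, b'⟩
  · rintro z hz
    simp only [Finset.mem_product, mem_nzQuads] at hz ⊢
    obtain ⟨⟨⟨a, c'⟩, c, a'⟩, ⟨b, d'⟩, d, b'⟩ := hz
    exact ⟨⟨⟨a, b⟩, c, d⟩, ⟨a', b'⟩, c', d'⟩
  · intro z _; rfl
  · intro z _; rfl
  · intro z _; rfl

theorem sum_nzQuads_crossed (N : ℕ) (f : ℤ → ℝ) :
    ∑ G ∈ nzQuads N, ∑ G' ∈ nzQuads N,
      f (G.1.1 * G'.2.2 - G.2.1 * G'.1.2) * f (G.1.2 * G'.2.1 - G.2.2 * G'.1.1) =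
      (∑ X ∈ nzQuads N, f (X.1.1 * X.1.2 - X.2.1 * X.2.2)) ^ 2 := by
  rw [← sum_nzQuads_parallel]
  refine Finset.sum_congr rfl fun G _ => ?_
  refine Finset.sum_nbij' (fun z => (z.1.swap, z.2.swap)) (fun z => (z.1.swap, z.2.swap))
    ?_ ?_ ?_ ?_ ?_
  · rintro z hz
    simp only [mem_nzQuads, Prod.fst_swap, Prod.snd_swap] at hz ⊢
    exact ⟨hz.1.symm, hz.2.symm⟩
  · rintro z hz
    simp only [mem_nzQuads, Prod.fst_swap, Prod.snd_swap] at hz ⊢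
    exact ⟨hz.1.symm, hz.2.symm⟩
  · intro z _; rfl
  · intro z _; rfl
  · intro z _; rfl

/-- The weight `(1 + |n|)^{-1/2}` restricted to the window `|n| ≤ Y`. -/
noncomputable def winWeight (Y : ℝ) (n : ℤ) : ℝ :=
  if |(n : ℝ)| ≤ Y then 1 / √(1 + |(n : ℝ)|) else 0

theorem winWeight_nonneg (Y : ℝ) (n : ℤ) : 0 ≤ winWeight Y n := by
  unfold winWeight; split_ifs <;> positivity

theorem le_winWeight_mul {Y c v X : ℝ} {a b : ℤ} (hc : 0 ≤ c) (hab : a ≠ 0 ∨ b ≠ 0)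
    (hXY : X ≤ Y) (ha : |(a : ℝ)| ≤ X) (hb : |(b : ℝ)| ≤ X)
    (hv : ∀ m : ℝ, 1 ≤ m → m ≤ X → v ≤ c / m) :
    v ≤ 2 * c * (winWeight Y a * winWeight Y b) := by
  have h1 : 1 ≤ max |(a : ℝ)| |(b : ℝ)| := by
    rcases hab with h | h
    · exact le_max_of_le_left (by exact_mod_cast Int.one_le_abs h)
    · exact le_max_of_le_right (by exact_mod_cast Int.one_le_abs h)
  refine (hv _ h1 (max_le ha hb)).trans ?_
  unfold winWeight
  rw [if_pos (ha.trans hXY), if_pos (hb.trans hXY)]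
  set m := max |(a : ℝ)| |(b : ℝ)|
  have ha' : 1 + |(a : ℝ)| ≤ 2 * m := by have := le_max_left |(a : ℝ)| |(b : ℝ)|; linarith
  have hb' : 1 + |(b : ℝ)| ≤ 2 * m := by have := le_max_right |(a : ℝ)| |(b : ℝ)|; linarith
  have h2 : √(1 + |(a : ℝ)|) * √(1 + |(b : ℝ)|) ≤ 2 * m := by
    calc _ ≤ √(2 * m) * √(2 * m) := by gcongr
      _ = 2 * m := Real.mul_self_sqrt (by linarith)
  have h3 : 0 < √(1 + |(a : ℝ)|) * √(1 + |(b : ℝ)|) := by positivity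
  rw [div_mul_div_comm, one_mul, mul_one_div]
  calc c / m = 2 * c / (2 * m) := by field_simp
    _ ≤ _ := by gcongr

theorem annulus_gI {N : ℕ} {l : ℝ} {G : (ℤ × ℤ) × (ℤ × ℤ)} (hG : G ∈ nzQuads N)
    (h1 : l ≤ |(G.1.1 : ℝ)|) (h2 : l ≤ |(G.2.1 : ℝ)|) : inAnnulus l N (gI G) := by
  rw [mem_nzQuads] at hG
  exact ⟨⟨h1, (abs_cast_of_mem_nzInts hG.1.1).2⟩, h2, (abs_cast_of_mem_nzInts hG.2.1).2⟩

theorem annulus_hI {N : ℕ} {l : ℝ} {G : (ℤ × ℤ) × (ℤ × ℤ)} (hG : G ∈ nzQuads N)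
    (h1 : l ≤ |(G.1.2 : ℝ)|) (h2 : l ≤ |(G.2.2 : ℝ)|) : inAnnulus l N (hI G) := by
  rw [mem_nzQuads] at hG
  exact ⟨⟨h1, (abs_cast_of_mem_nzInts hG.1.2).2⟩, h2, (abs_cast_of_mem_nzInts hG.2.2).2⟩

/-- All entries have absolute value at least `l`. -/
def largeQuad (l : ℝ) (G : (ℤ × ℤ) × (ℤ × ℤ)) : Prop :=
  (l ≤ |(G.1.1 : ℝ)| ∧ l ≤ |(G.1.2 : ℝ)|) ∧ l ≤ |(G.2.1 : ℝ)| ∧ l ≤ |(G.2.2 : ℝ)|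

theorem pairMeas_le_of_large {R l δ E Y : ℝ} {N : ℕ} {G G' : (ℤ × ℤ) × (ℤ × ℤ)} (hR : 1 ≤ R)
    (hl : 2 ≤ l) (hδ : 0 < δ) (hδ1 : δ ≤ 1) (hG : G ∈ nzQuads N) (hG' : G' ∈ nzQuads N)
    (hGl : largeQuad l G) (hGl' : largeQuad l G') (hne : prd (G.1, G'.2) ≠ prd (G'.1, G.2))
    (hE : |((prd (G.1, G'.2) - prd (G'.1, G.2) : ℤ) : ℝ)| ≤ E)
    (hY : 144 * R ^ 3 * ((N : ℝ) ^ 3 * E + (N : ℝ) ^ 5 * δ) / l ^ 5 ≤ Y) :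
    pairMeas R δ G G' ≤ 2 * (1152 * R ^ 4 * (N : ℝ) ^ 5 * δ ^ 2 / l ^ 7) *
      (winWeight Y (G.1.1 * G'.2.1 - G.2.1 * G'.1.1) *
          winWeight Y (G.1.2 * G'.2.2 - G.2.2 * G'.1.2) +
        winWeight Y (G.1.1 * G'.2.2 - G.2.1 * G'.1.2) *
          winWeight Y (G.1.2 * G'.2.1 - G.2.2 * G'.1.1)) := by
  have hpos : ∀ a b : ℤ, 0 ≤ winWeight Y a * winWeight Y b := fun a b =>
    mul_nonneg (winWeight_nonneg _ _) (winWeight_nonneg _ _)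
  set c := 1152 * R ^ 4 * (N : ℝ) ^ 5 * δ ^ 2 / l ^ 7 with hc
  have hc0 : 0 ≤ c := by positivity
  rcases Set.eq_empty_or_nonempty
    (cell R δ (gI G) (hI G) ∩ cell R δ (gI G') (hI G')) with he | ⟨α, hα, hα'⟩
  · unfold pairMeas
    rw [he, measureReal_empty]
    have := hpos (G.1.1 * G'.2.1 - G.2.1 * G'.1.1) (G.1.2 * G'.2.2 - G.2.2 * G'.1.2)
    have := hpos (G.1.1 * G'.2.2 - G.2.1 * G'.1.2) (G.1.2 * G'.2.1 - G.2.2 * G'.1.1)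
    positivity
  have hN : l ≤ N := hGl.1.1.trans (abs_cast_of_mem_nzInts (mem_nzQuads.mp hG).1.1).2
  have key := wedge_le_or hR hα.1 hl (annulus_gI hG hGl.1.1 hGl.2.1) (annulus_hI hG hGl.1.2 hGl.2.2)
    (annulus_gI hG' hGl'.1.1 hGl'.2.1) (annulus_hI hG' hGl'.1.2 hGl'.2.2) hδ1 hα.2 hα'.2
  rw [pairDet_cast] at key
  have hm1 := pairMeas_le_of_ne (R := R) (δ := δ) hne
  have hm2 : pairMeas R δ G G' ≤ 4 * R * δ / l ^ 2 := by
    have a1 : l ^ 2 ≤ |(gI G).1 * (hI G).1| := by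
      rw [abs_mul, sq]; exact mul_le_mul hGl.1.1 hGl.1.2 (by linarith) (abs_nonneg _)
    refine (pairMeas_le_left G G').trans ((cell_le_left (by linarith) hδ.le
      (abs_pos.mp (lt_of_lt_of_le (by positivity) a1))).trans ?_)
    gcongr
  set D := |((prd (G.1, G'.2) - prd (G'.1, G.2) : ℤ) : ℝ)| with hD
  have hD0 : 1 ≤ D := by
    rw [hD]; exact_mod_cast Int.one_le_abs (sub_ne_zero.mpr hne)
  set X := 144 * R ^ 3 * ((N : ℝ) ^ 3 * D + (N : ℝ) ^ 5 * δ) / l ^ 5 with hX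
  have hXY : X ≤ Y := le_trans (by rw [hX]; gcongr) hY
  have hv : ∀ m : ℝ, 1 ≤ m → m ≤ X → pairMeas R δ G G' ≤ c / m := by
    intro m hm hmX
    have hm0 : 0 < m := by linarith
    have hN0 : (0 : ℝ) < N := by linarith
    rw [hX, le_div_iff₀ (by positivity)] at hmX
    rcases le_or_gt ((N : ℝ) ^ 2 * δ) D with h | h
    · refine hm1.trans ?_
      rw [hc, div_div, mul_one_div, div_le_div_iff₀ (by linarith) (by positivity)]
      have h1 : m * l ^ 5 ≤ 288 * R ^ 3 * (N : ℝ) ^ 3 * D := by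
        have : (N : ℝ) ^ 3 * ((N : ℝ) ^ 2 * δ) ≤ (N : ℝ) ^ 3 * D := by gcongr
        have h5 : R ^ 3 * ((N : ℝ) ^ 3 * ((N : ℝ) ^ 2 * δ)) ≤ R ^ 3 * ((N : ℝ) ^ 3 * D) := by gcongr
        nlinarith
      calc 4 * δ ^ 2 * (l ^ 7 * m) = 4 * δ ^ 2 * l ^ 2 * (m * l ^ 5) := by ring
        _ ≤ 4 * δ ^ 2 * (N : ℝ) ^ 2 * (288 * R ^ 3 * (N : ℝ) ^ 3 * D) := by gcongr
        _ = 1152 * R ^ 3 * (N : ℝ) ^ 5 * δ ^ 2 * D := by ring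
        _ ≤ 1152 * R ^ 4 * (N : ℝ) ^ 5 * δ ^ 2 * D := by gcongr; linarith
    · refine hm2.trans ?_
      rw [hc, div_div, div_le_div_iff₀ (by positivity) (by positivity)]
      have h1 : m * l ^ 5 ≤ 288 * R ^ 3 * (N : ℝ) ^ 5 * δ := by
        have : (N : ℝ) ^ 3 * D ≤ (N : ℝ) ^ 3 * ((N : ℝ) ^ 2 * δ) := by gcongr
        have h5 : R ^ 3 * ((N : ℝ) ^ 3 * D) ≤ R ^ 3 * ((N : ℝ) ^ 3 * ((N : ℝ) ^ 2 * δ)) := by gcongr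
        nlinarith
      calc 4 * R * δ * (l ^ 7 * m) = 4 * R * δ * l ^ 2 * (m * l ^ 5) := by ring
        _ ≤ 4 * R * δ * l ^ 2 * (288 * R ^ 3 * (N : ℝ) ^ 5 * δ) := by gcongr
        _ = _ := by ring
  rw [mul_add]
  rcases key with ⟨k1, k2⟩ | ⟨k1, k2⟩
  · refine le_add_of_le_of_nonneg
      (le_winWeight_mul hc0 ?_ hXY (le_trans (le_of_eq ?_) k1) (le_trans (le_of_eq ?_) k2) hv)
      (mul_nonneg (by positivity) (hpos _ _))
    · by_contra! h
      apply hne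
      simp only [prd]
      linear_combination (G.1.2 * G'.2.2) * h.1 + (G.2.1 * G'.1.1) * h.2
    · simp only [wedge, gI]; push_cast; ring_nf
    · simp only [wedge, hI]; push_cast; ring_nf
  · refine le_add_of_nonneg_of_le (mul_nonneg (by positivity) (hpos _ _))
      (le_winWeight_mul hc0 ?_ hXY (le_trans (le_of_eq ?_) k1) (le_trans (le_of_eq ?_) k2) hv)
    · by_contra! h
      apply hne
      simp only [prd]
      linear_combination (G.1.2 * G'.2.1) * h.1 + (G.2.1 * G'.1.2) * h.2
    · simp only [wedge, gI, hI]; push_cast; ring_nf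
    · simp only [wedge, gI, hI]; push_cast; ring_nf

theorem sum_pairMeas_large_le (R ε : ℝ) (hR : 1 ≤ R) (hε : 0 < ε) :
    ∃ C : ℝ, 0 ≤ C ∧ ∀ N : ℕ, 1 ≤ N → ∀ l δ E Y : ℝ, 2 ≤ l → 0 < δ → δ ≤ 1 → 1 ≤ Y →
      144 * R ^ 3 * ((N : ℝ) ^ 3 * E + (N : ℝ) ^ 5 * δ) / l ^ 5 ≤ Y →
      ∑ G ∈ nzQuads N, ∑ G' ∈ nzQuads N,
        (if (largeQuad l G ∧ largeQuad l G') ∧ prd (G.1, G'.2) ≠ prd (G'.1, G.2) ∧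
            |((prd (G.1, G'.2) - prd (G'.1, G.2) : ℤ) : ℝ)| ≤ E then pairMeas R δ G G' else 0) ≤
          C * (N : ℝ) ^ ε * (N : ℝ) ^ 9 * δ ^ 2 / l ^ 7 * Y := by
  obtain ⟨C, hC, h⟩ := sum_quads_det_window_le (ε / 2) (by positivity)
  refine ⟨4 * 1152 * R ^ 4 * C ^ 2, by positivity, fun N hN l δ E Y hl hδ hδ1 hY1 hY => ?_⟩
  have hN0 : (0 : ℝ) < N := by exact_mod_cast hN
  have hS : ∑ X ∈ nzQuads N, winWeight Y (X.1.1 * X.1.2 - X.2.1 * X.2.2) ≤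
      C * (N : ℝ) ^ (ε / 2) * (N : ℝ) ^ 2 * √Y := h N hN Y hY1
  have hS0 : 0 ≤ ∑ X ∈ nzQuads N, winWeight Y (X.1.1 * X.1.2 - X.2.1 * X.2.2) :=
    Finset.sum_nonneg fun _ _ => winWeight_nonneg _ _
  set c := 2 * (1152 * R ^ 4 * (N : ℝ) ^ 5 * δ ^ 2 / l ^ 7) with hc
  calc _ ≤ ∑ G ∈ nzQuads N, ∑ G' ∈ nzQuads N, c *
      (winWeight Y (G.1.1 * G'.2.1 - G.2.1 * G'.1.1) *
          winWeight Y (G.1.2 * G'.2.2 - G.2.2 * G'.1.2) +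
        winWeight Y (G.1.1 * G'.2.2 - G.2.1 * G'.1.2) *
          winWeight Y (G.1.2 * G'.2.1 - G.2.2 * G'.1.1)) := by
        refine Finset.sum_le_sum fun G hG => Finset.sum_le_sum fun G' hG' => ?_
        split_ifs with hif
        · exact pairMeas_le_of_large hR hl hδ hδ1 hG hG' hif.1.1 hif.1.2 hif.2.1 hif.2.2 hY
        · refine mul_nonneg (by positivity) (add_nonneg ?_ ?_) <;>
            exact mul_nonneg (winWeight_nonneg _ _) (winWeight_nonneg _ _)
    _ = c * (2 * (∑ X ∈ nzQuads N, winWeight Y (X.1.1 * X.1.2 - X.2.1 * X.2.2)) ^ 2) := by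
        simp only [← Finset.mul_sum, Finset.sum_add_distrib]
        rw [sum_nzQuads_parallel N (winWeight Y), sum_nzQuads_crossed N (winWeight Y)]
        ring
    _ ≤ c * (2 * (C * (N : ℝ) ^ (ε / 2) * (N : ℝ) ^ 2 * √Y) ^ 2) := by gcongr
    _ = 4 * 1152 * R ^ 4 * C ^ 2 * ((N : ℝ) ^ (ε / 2) * (N : ℝ) ^ (ε / 2)) * (N : ℝ) ^ 9 *
          δ ^ 2 / l ^ 7 * (√Y ^ 2) := by rw [hc]; ring
    _ = _ := by rw [← Real.rpow_add hN0, add_halves, Real.sq_sqrt (by linarith)]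

/-- Triples of nonzero integers of absolute value at most `N`. -/
noncomputable def nzTriples (N : ℕ) : Finset (ℤ × (ℤ × ℤ)) :=
  nzInts N ×ˢ (nzInts N ×ˢ nzInts N)

/-- Parameters `β` for which `g (2 β h + k)` is small, where `t = (g, h, k)`. -/
def slot (R δ : ℝ) (t : ℤ × (ℤ × ℤ)) : Set ℝ :=
  {β | (3 / 4 ≤ β ∧ β ≤ R) ∧ |(t.1 : ℝ)| * |2 * β * t.2.1 + t.2.2| ≤ 2 * δ}

theorem slot_subset_Icc (R δ : ℝ) (t : ℤ × (ℤ × ℤ)) : slot R δ t ⊆ Set.Icc (3 / 4) R :=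
  fun _ h => h.1

theorem slot_ne_top (R δ : ℝ) (t : ℤ × (ℤ × ℤ)) : volume (slot R δ t) ≠ ⊤ :=
  ((measure_mono (slot_subset_Icc R δ t)).trans_lt isCompact_Icc.measure_lt_top).ne

theorem slot_le {R δ : ℝ} {t : ℤ × (ℤ × ℤ)} (hδ : 0 ≤ δ) (h1 : t.1 ≠ 0) (h2 : t.2.1 ≠ 0) :
    volume.real (slot R δ t) ≤ 2 * δ / (|(t.1 : ℝ)| * |(t.2.1 : ℝ)|) := by
  have e1 : 0 < |(t.1 : ℝ)| := by simpa using h1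
  have e2 : (2 * t.2.1 : ℝ) ≠ 0 := by simpa using h2
  refine ENNReal.toReal_le_of_le_ofReal (by positivity)
    ((measure_mono (t := {β : ℝ | |2 * t.2.1 * β + t.2.2| ≤ 2 * δ / |(t.1 : ℝ)|}) ?_).trans
      ((volume_setOf_abs_le e2).trans (ENNReal.ofReal_le_ofReal (le_of_eq ?_))))
  · rintro β ⟨-, hβ⟩
    rw [Set.mem_ofPred_eq, le_div_iff₀ e1, mul_comm]
    have e : (2 * t.2.1 * β + t.2.2 : ℝ) = 2 * β * t.2.1 + t.2.2 := by ring
    rw [e]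
    exact hβ
  · rw [abs_mul, abs_two]
    have : 0 < |(t.2.1 : ℝ)| := by simpa using h2
    field_simp

/-- The length of the intersection of two slots. -/
noncomputable def slotMeas (R δ : ℝ) (t t' : ℤ × (ℤ × ℤ)) : ℝ :=
  volume.real (slot R δ t ∩ slot R δ t')

theorem slotMeas_le_left (R δ : ℝ) (t t' : ℤ × (ℤ × ℤ)) :
    slotMeas R δ t t' ≤ volume.real (slot R δ t) :=
  measureReal_mono Set.inter_subset_left (slot_ne_top _ _ _)

theorem slotMeas_le_right (R δ : ℝ) (t t' : ℤ × (ℤ × ℤ)) :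
    slotMeas R δ t t' ≤ volume.real (slot R δ t') :=
  measureReal_mono Set.inter_subset_right (slot_ne_top _ _ _)

theorem slotMeas_le_of_ne {R δ : ℝ} {t t' : ℤ × (ℤ × ℤ)} (hδ : 0 ≤ δ)
    (h1 : t.1 ≠ 0) (h2 : t.2.1 ≠ 0) (h1' : t'.1 ≠ 0) (h2' : t'.2.1 ≠ 0)
    (hd : t.2.2 * t'.2.1 ≠ t'.2.2 * t.2.1) :
    slotMeas R δ t t' ≤ 8 * δ ^ 2 * (1 / |(t.1 : ℝ)| * (1 / |(t'.1 : ℝ)|)) *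
      (1 / |((t.2.2 * t'.2.1 - t'.2.2 * t.2.1 : ℤ) : ℝ)|) := by
  rcases Set.eq_empty_or_nonempty (slot R δ t ∩ slot R δ t') with he | ⟨β, hβ, hβ'⟩
  · unfold slotMeas
    rw [he, measureReal_empty]
    positivity
  have m1 := (slotMeas_le_left R δ t t').trans (slot_le hδ h1 h2)
  have m2 := (slotMeas_le_right R δ t t').trans (slot_le hδ h1' h2')
  have m0 : 0 ≤ slotMeas R δ t t' := measureReal_nonneg
  have k1 := hβ.2
  have k2 := hβ'.2
  have hD : ((t.2.2 * t'.2.1 - t'.2.2 * t.2.1 : ℤ) : ℝ) =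
      t'.2.1 * (2 * β * t.2.1 + t.2.2) - t.2.1 * (2 * β * t'.2.1 + t'.2.2) := by
    push_cast; ring
  have hDp : 0 < |((t.2.2 * t'.2.1 - t'.2.2 * t.2.1 : ℤ) : ℝ)| :=
    abs_pos.mpr (by exact_mod_cast sub_ne_zero.mpr hd)
  have hDle : |((t.2.2 * t'.2.1 - t'.2.2 * t.2.1 : ℤ) : ℝ)| ≤
      |(t'.2.1 : ℝ)| * |2 * β * t.2.1 + t.2.2| + |(t.2.1 : ℝ)| * |2 * β * t'.2.1 + t'.2.2| := by
    rw [hD, ← abs_mul, ← abs_mul]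
    exact abs_sub _ _
  set D := |((t.2.2 * t'.2.1 - t'.2.2 * t.2.1 : ℤ) : ℝ)|
  have g0 : 0 < |(t.1 : ℝ)| := by simpa using h1
  have g0' : 0 < |(t'.1 : ℝ)| := by simpa using h1'
  have p0 : 0 < |(t.2.1 : ℝ)| := by simpa using h2
  have p0' : 0 < |(t'.2.1 : ℝ)| := by simpa using h2'
  set g := |(t.1 : ℝ)|
  set g' := |(t'.1 : ℝ)|
  set h := |(t.2.1 : ℝ)|
  set h' := |(t'.2.1 : ℝ)|
  set x := |2 * β * t.2.1 + t.2.2|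
  set x' := |2 * β * t'.2.1 + t'.2.2|
  set m := slotMeas R δ t t'
  clear_value D g g' h h' x x' m
  rw [le_div_iff₀ (by positivity)] at m1 m2
  have e : 8 * δ ^ 2 * (1 / g * (1 / g')) * (1 / D) = 8 * δ ^ 2 / (g * g' * D) := by
    field_simp
  rw [e, le_div_iff₀ (by positivity)]
  have q1 : g * g' * D ≤ 2 * δ * (g' * h' + g * h) := by
    calc g * g' * D ≤ g * g' * (h' * x + h * x') := by gcongr
      _ = g' * h' * (g * x) + g * h * (g' * x') := by ring
      _ ≤ g' * h' * (2 * δ) + g * h * (2 * δ) := by gcongr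
      _ = _ := by ring
  calc m * (g * g' * D) ≤ m * (2 * δ * (g' * h' + g * h)) := by gcongr
    _ = 2 * δ * (m * (g' * h') + m * (g * h)) := by ring
    _ ≤ 2 * δ * (2 * δ + 2 * δ) := by gcongr
    _ = _ := by ring

theorem slotMeas_le_of_eq {R δ : ℝ} {t t' : ℤ × (ℤ × ℤ)} (hR : 1 ≤ R) (hδ : 0 ≤ δ)
    (hδ1 : 2 * δ ≤ 1) (h1 : t.1 ≠ 0) (h2 : t.2.1 ≠ 0) (h3 : t.2.2 ≠ 0) (h1' : t'.1 ≠ 0)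
    (h2' : t'.2.1 ≠ 0) :
    slotMeas R δ t t' ≤ 6 * R * δ * (1 / √|(t.1 : ℝ)| * (1 / √|(t'.1 : ℝ)|)) *
      (1 / √|((t.2.2 * t'.2.1 : ℤ) : ℝ)|) := by
  rcases Set.eq_empty_or_nonempty (slot R δ t ∩ slot R δ t') with he | ⟨β, hβ, hβ'⟩
  · unfold slotMeas
    rw [he, measureReal_empty]
    positivity
  have m1 := (slotMeas_le_left R δ t t').trans (slot_le hδ h1 h2)
  have m2 := (slotMeas_le_right R δ t t').trans (slot_le hδ h1' h2')
  have g0 : 1 ≤ |(t.1 : ℝ)| := by exact_mod_cast Int.one_le_abs h1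
  have g0' : 1 ≤ |(t'.1 : ℝ)| := by exact_mod_cast Int.one_le_abs h1'
  have p0 : 1 ≤ |(t.2.1 : ℝ)| := by exact_mod_cast Int.one_le_abs h2
  have p0' : 1 ≤ |(t'.2.1 : ℝ)| := by exact_mod_cast Int.one_le_abs h2'
  have r0 : 1 ≤ |(t.2.2 : ℝ)| := by exact_mod_cast Int.one_le_abs h3
  have hk : |(t.2.2 : ℝ)| ≤ 9 * R ^ 2 * |(t.2.1 : ℝ)| := by
    have e : (t.2.2 : ℝ) = (2 * β * t.2.1 + t.2.2) - 2 * β * t.2.1 := by ring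
    have e2 : |(t.2.2 : ℝ)| ≤ |2 * β * t.2.1 + t.2.2| + |2 * β * t.2.1| := by
      conv_lhs => rw [e]
      exact abs_sub _ _
    have e3 : |2 * β * t.2.1| ≤ 2 * R * |(t.2.1 : ℝ)| := by
      rw [abs_mul, abs_mul, abs_two, abs_of_nonneg (by linarith [hβ.1.1])]
      gcongr
      exact hβ.1.2
    have e4 : |2 * β * t.2.1 + t.2.2| ≤ 1 := by
      have := hβ.2
      nlinarith [abs_nonneg (2 * β * t.2.1 + t.2.2 : ℝ)]
    nlinarith [mul_le_mul hR hR zero_le_one (by linarith),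
      mul_le_mul_of_nonneg_right hR (by linarith : 0 ≤ |(t.2.1 : ℝ)|)]
  push_cast
  rw [abs_mul]
  set g := |(t.1 : ℝ)|
  set g' := |(t'.1 : ℝ)|
  set h := |(t.2.1 : ℝ)|
  set h' := |(t'.2.1 : ℝ)|
  set k := |(t.2.2 : ℝ)|
  have := le_div_sqrt_mul (by positivity) (by positivity) (by positivity) m1 m2
  refine this.trans ?_
  have e1 : √(k * h') ≤ 3 * R * √(h * h') := by
    calc √(k * h') ≤ √(9 * R ^ 2 * h * h') := by gcongr
      _ = √((3 * R) ^ 2 * (h * h')) := by ring_nf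
      _ = 3 * R * √(h * h') := by rw [Real.sqrt_mul (by positivity), Real.sqrt_sq (by positivity)]
  have e2 : √(g * h * (g' * h')) = √g * √g' * √(h * h') := by
    rw [← Real.sqrt_mul (by positivity), ← Real.sqrt_mul (by positivity)]
    ring_nf
  rw [e2]
  have s1 : 0 < √g := by positivity
  have s2 : 0 < √g' := by positivity
  have s3 : 0 < √(k * h') := by positivity
  have s4 : 0 < √(h * h') := by positivity
  calc 2 * δ * (1 / (√g * √g' * √(h * h')))
      = 2 * δ * (1 / √g * (1 / √g')) * (1 / √(h * h')) := by field_simp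
    _ ≤ 2 * δ * (1 / √g * (1 / √g')) * (3 * R * (1 / √(k * h'))) := by
        gcongr
        rw [mul_one_div, div_le_div_iff₀ s4 s3]
        linarith
    _ = _ := by ring

theorem mem_nzTriples {N : ℕ} {t : ℤ × (ℤ × ℤ)} :
    t ∈ nzTriples N ↔ t.1 ∈ nzInts N ∧ t.2.1 ∈ nzInts N ∧ t.2.2 ∈ nzInts N := by
  simp only [nzTriples, Finset.mem_product]

theorem sum_nzTriples_swap (N : ℕ) (a : ℤ → ℝ) (f : (ℤ × ℤ) × (ℤ × ℤ) → ℝ) :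
    ∑ t ∈ nzTriples N, ∑ t' ∈ nzTriples N,
      a t.1 * a t'.1 * f ((t.2.2, t'.2.1), (t'.2.2, t.2.1)) =
      (∑ g ∈ nzInts N, a g) ^ 2 * ∑ X ∈ nzQuads N, f X := by
  rw [sq, Finset.sum_mul_sum, ← Finset.sum_product', ← Finset.sum_product', Finset.sum_mul_sum,
    ← Finset.sum_product']
  refine Finset.sum_nbij'
    (fun z => ((z.1.1, z.2.1), ((z.1.2.2, z.2.2.1), (z.2.2.2, z.1.2.1))))
    (fun z => ((z.1.1, (z.2.2.2, z.2.1.1)), (z.1.2, (z.2.1.2, z.2.2.1)))) ?_ ?_ ?_ ?_ ?_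
  · rintro z hz
    simp only [Finset.mem_product, mem_nzTriples, mem_nzQuads] at hz ⊢
    obtain ⟨⟨a, b, c⟩, a', b', c'⟩ := hz
    exact ⟨⟨a, a'⟩, ⟨c, b'⟩, c', b⟩
  · rintro z hz
    simp only [Finset.mem_product, mem_nzTriples, mem_nzQuads] at hz ⊢
    obtain ⟨⟨a, a'⟩, ⟨c, b'⟩, c', b⟩ := hz
    exact ⟨⟨a, b, c⟩, a', b', c'⟩
  · intro z _; rfl
  · intro z _; rfl
  · intro z _; rfl

theorem sum_slotMeas_le (R ε : ℝ) (hR : 1 ≤ R) (hε : 0 < ε) :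
    ∃ C : ℝ, 0 ≤ C ∧ ∀ N : ℕ, 1 ≤ N → ∀ δ : ℝ, 0 ≤ δ → 2 * δ ≤ 1 →
      ∑ t ∈ nzTriples N, ∑ t' ∈ nzTriples N, slotMeas R δ t t' ≤
        C * (N : ℝ) ^ ε * (N : ℝ) ^ 2 * δ := by
  obtain ⟨C₁, hC₁, H₁⟩ := sum_quads_det_ne_le (ε / 3) (by positivity)
  obtain ⟨C₂, hC₂, H₂⟩ := sum_quads_det_eq_le ε hε
  obtain ⟨C₃, hC₃, H₃⟩ := sum_nzInts_one_div_le (ε / 3) (by positivity)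
  refine ⟨8 * C₃ ^ 2 * C₁ + 96 * R * C₂, by positivity, fun N hN δ hδ hδ1 => ?_⟩
  have hN0 : (0 : ℝ) < N := by exact_mod_cast hN
  set f₁ : (ℤ × ℤ) × (ℤ × ℤ) → ℝ := fun q => if q.1.1 * q.1.2 ≠ q.2.1 * q.2.2 then
        1 / |((q.1.1 * q.1.2 - q.2.1 * q.2.2 : ℤ) : ℝ)| else 0 with hf₁
  set f₂ : (ℤ × ℤ) × (ℤ × ℤ) → ℝ := fun q => if q.1.1 * q.1.2 = q.2.1 * q.2.2 then
        1 / √|((q.1.1 * q.1.2 : ℤ) : ℝ)| else 0 with hf₂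
  have hf₁0 : ∀ q, 0 ≤ f₁ q := fun q => by simp only [hf₁]; split_ifs <;> positivity
  have hf₂0 : ∀ q, 0 ≤ f₂ q := fun q => by simp only [hf₂]; split_ifs <;> positivity
  have b₁ := H₁ N hN
  have b₂ := H₂ N hN
  have b₃ := H₃ N hN
  have b₄ := sum_nzInts_one_div_sqrt_le N
  calc _ ≤ ∑ t ∈ nzTriples N, ∑ t' ∈ nzTriples N,
        (8 * δ ^ 2 * (1 / |(t.1 : ℝ)| * (1 / |(t'.1 : ℝ)|) *
            f₁ ((t.2.2, t'.2.1), (t'.2.2, t.2.1))) +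
          6 * R * δ * (1 / √|(t.1 : ℝ)| * (1 / √|(t'.1 : ℝ)|) *
            f₂ ((t.2.2, t'.2.1), (t'.2.2, t.2.1)))) := by
        refine Finset.sum_le_sum fun t ht => Finset.sum_le_sum fun t' ht' => ?_
        rw [mem_nzTriples] at ht ht'
        have p₁ := hf₁0 ((t.2.2, t'.2.1), (t'.2.2, t.2.1))
        have p₂ := hf₂0 ((t.2.2, t'.2.1), (t'.2.2, t.2.1))
        by_cases hd : t.2.2 * t'.2.1 = t'.2.2 * t.2.1
        · refine le_add_of_nonneg_of_le (by positivity) ?_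
          have := slotMeas_le_of_eq (R := R) hR hδ hδ1 (ne_zero_of_mem_nzInts ht.1)
            (ne_zero_of_mem_nzInts ht.2.1) (ne_zero_of_mem_nzInts ht.2.2)
            (ne_zero_of_mem_nzInts ht'.1) (ne_zero_of_mem_nzInts ht'.2.1)
          simp only [hf₂]
          rw [if_pos hd, ← mul_assoc (6 * R * δ)]
          exact this
        · refine le_add_of_le_of_nonneg ?_ (by positivity)
          have := slotMeas_le_of_ne (R := R) hδ (ne_zero_of_mem_nzInts ht.1)
            (ne_zero_of_mem_nzInts ht.2.1)
            (ne_zero_of_mem_nzInts ht'.1) (ne_zero_of_mem_nzInts ht'.2.1) hd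
          simp only [hf₁]
          rw [if_pos hd, ← mul_assoc (8 * δ ^ 2)]
          exact this
    _ = 8 * δ ^ 2 * ((∑ g ∈ nzInts N, 1 / |(g : ℝ)|) ^ 2 * ∑ X ∈ nzQuads N, f₁ X) +
        6 * R * δ * ((∑ g ∈ nzInts N, 1 / √|(g : ℝ)|) ^ 2 * ∑ X ∈ nzQuads N, f₂ X) := by
        simp only [Finset.sum_add_distrib, ← Finset.mul_sum]
        rw [sum_nzTriples_swap N (fun g => 1 / |(g : ℝ)|) f₁,
          sum_nzTriples_swap N (fun g => 1 / √|(g : ℝ)|) f₂]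
    _ ≤ 8 * δ ^ 2 * ((C₃ * (N : ℝ) ^ (ε / 3)) ^ 2 * (C₁ * (N : ℝ) ^ (ε / 3) * (N : ℝ) ^ 2)) +
        6 * R * δ * ((4 * √(N : ℝ)) ^ 2 * (C₂ * (N : ℝ) ^ ε * N)) := by
        have := Finset.sum_nonneg (s := nzInts N) (f := fun g : ℤ => 1 / |(g : ℝ)|)
          fun _ _ => by positivity
        gcongr
    _ = 8 * C₃ ^ 2 * C₁ * ((N : ℝ) ^ (ε / 3) * (N : ℝ) ^ (ε / 3) * (N : ℝ) ^ (ε / 3)) *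
          (N : ℝ) ^ 2 * (δ * δ) + 96 * R * C₂ * (N : ℝ) ^ ε * N * δ * (√(N : ℝ) ^ 2) := by ring
    _ = 8 * C₃ ^ 2 * C₁ * (N : ℝ) ^ ε *
          (N : ℝ) ^ 2 * (δ * δ) + 96 * R * C₂ * (N : ℝ) ^ ε * N * δ * N := by
        rw [← Real.rpow_add hN0, ← Real.rpow_add hN0, Real.sq_sqrt hN0.le,
          show ε / 3 + ε / 3 + ε / 3 = ε by ring]
    _ ≤ 8 * C₃ ^ 2 * C₁ * (N : ℝ) ^ ε *
          (N : ℝ) ^ 2 * (δ * 1) + 96 * R * C₂ * (N : ℝ) ^ ε * N * δ * N := by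
        gcongr
        linarith
    _ = _ := by ring

/-- The difference of the values of `qr α` at two points of the plane. -/
def lag (α : ℝ × ℝ) (x : (ℝ × ℝ) × (ℝ × ℝ)) : ℝ := qr α x.1 - qr α x.2

theorem lag_eq_bf (α : ℝ × ℝ) (x : (ℝ × ℝ) × (ℝ × ℝ)) :
    lag α x = bf α (x.1 - x.2) (x.1 + x.2) := qr_sub_qr α x.1 x.2

theorem continuous_lag :
    Continuous fun z : (ℝ × ℝ) × ((ℝ × ℝ) × (ℝ × ℝ)) => lag z.1 z.2 := by
  unfold lag qr
  fun_prop

/-- Pairs of points with difference in `A`, second point of size at most `P`, and small `lag`. -/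
def slab (α : ℝ × ℝ) (δ P : ℝ) (A : Set (ℝ × ℝ)) : Set ((ℝ × ℝ) × (ℝ × ℝ)) :=
  {x | x.1 - x.2 ∈ A ∧ (|x.2.1| ≤ P ∧ |x.2.2| ≤ P) ∧ |lag α x| ≤ δ}

theorem measurableSet_slab (α : ℝ × ℝ) (δ P : ℝ) {A : Set (ℝ × ℝ)} (hA : MeasurableSet A) :
    MeasurableSet (slab α δ P A) := by
  have hc : Continuous fun x : (ℝ × ℝ) × (ℝ × ℝ) => lag α x :=
    continuous_lag.comp (Continuous.prodMk_right α)
  refine ((measurable_fst.sub measurable_snd) hA).inter (MeasurableSet.inter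
    (MeasurableSet.inter ?_ ?_) ?_)
  · exact measurableSet_le (g := fun _ => P)
      (measurable_norm.comp (measurable_fst.comp measurable_snd)) measurable_const
  · exact measurableSet_le (g := fun _ => P)
      (measurable_norm.comp (measurable_snd.comp measurable_snd)) measurable_const
  · exact measurableSet_le (hc.abs.measurable) measurable_const

theorem slab_fiber_subset (α : ℝ × ℝ) (δ P : ℝ) (A : Set (ℝ × ℝ)) (g : ℝ × ℝ) :
    {v : ℝ × ℝ | (v + g, v) ∈ slab α δ P A} ⊆
      strip P (grad α g).1 (grad α g).2 (((grad α g).1 * g.1 + (grad α g).2 * g.2) / 2) δ := by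
  rintro v ⟨-, ⟨h1, h2⟩, h3⟩
  refine ⟨h1, h2, ?_⟩
  have : lag α (v + g, v) = (grad α g).1 * v.1 + (grad α g).2 * v.2 +
      ((grad α g).1 * g.1 + (grad α g).2 * g.2) / 2 := by
    simp only [lag, qr, grad, Prod.fst_add, Prod.snd_add]
    ring
  rwa [this] at h3

theorem volume_slab_le {R δ P : ℝ} {α : ℝ × ℝ} {A : Set (ℝ × ℝ)} (hα : α ∈ box R) (hδ : 0 ≤ δ)
    (hP : 0 ≤ P) (hA : MeasurableSet A) :
    volume (slab α δ P A) ≤ ∫⁻ g in A, ENNReal.ofReal (16 * P * δ / (|g.1| + |g.2|)) := by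
  have hmp : MeasurePreserving (fun z : (ℝ × ℝ) × (ℝ × ℝ) => (z.1 + z.2, z.1))
      (volume.prod volume) (volume.prod volume) :=
    Measure.measurePreserving_swap.comp (measurePreserving_prod_add volume volume)
  have hS := measurableSet_slab α δ P hA
  rw [Measure.volume_eq_prod, ← hmp.measure_preimage hS.nullMeasurableSet,
    Measure.prod_apply_symm (hmp.measurable hS), ← lintegral_indicator hA]
  have hne : ∀ᵐ g : ℝ × ℝ, g ≠ 0 := by
    rw [ae_iff]
    simp
  refine lintegral_mono_ae (hne.mono fun g hg => ?_)
  by_cases hgA : g ∈ A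
  · rw [Set.indicator_of_mem hgA]
    have hpos : 0 < |g.1| + |g.2| := by
      rcases eq_or_ne g.1 0 with h1 | h1
      · have h2 : g.2 ≠ 0 := fun h2 => hg (Prod.ext h1 h2)
        have := abs_pos.mpr h2
        positivity
      · have := abs_pos.mpr h1
        positivity
    have hm := abs_le_grad hα g
    refine (measure_mono (slab_fiber_subset α δ P A g)).trans
      ((volume_strip_le hδ (by linarith)).trans (ENNReal.ofReal_le_ofReal ?_))
    calc 4 * P * δ / max |(grad α g).1| |(grad α g).2|
        ≤ 4 * P * δ / ((|g.1| + |g.2|) / 4) := by gcongr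
      _ = _ := by field_simp; ring
  · rw [Set.indicator_of_notMem hgA]
    refine le_of_eq (measure_mono_null (t := ∅) ?_ measure_empty)
    rintro v ⟨h, -⟩
    simp only [add_sub_cancel_left] at h
    exact hgA h

theorem volume_slab_le_of_far {R δ P l : ℝ} {α : ℝ × ℝ} {A : Set (ℝ × ℝ)} (hα : α ∈ box R)
    (hδ : 0 ≤ δ) (hP : 0 ≤ P) (hl : 0 < l) (hA : MeasurableSet A) (h : ∀ g ∈ A, l ≤ |g.1|) :
    volume (slab α δ P A) ≤ ENNReal.ofReal (16 * P * δ / l) * volume A := by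
  refine (volume_slab_le hα hδ hP hA).trans ?_
  rw [← setLIntegral_const]
  refine setLIntegral_mono' hA fun g hg => ENNReal.ofReal_le_ofReal ?_
  gcongr
  linarith [h g hg, abs_nonneg g.2]

theorem lintegral_one_div_sqrt_le (s : ℝ) :
    ∫⁻ x in Set.Icc (-s) s, ENNReal.ofReal (1 / √|x|) ≤ ENNReal.ofReal (4 * √s) := by
  rcases le_or_gt s 0 with hs | hs
  · rcases hs.lt_or_eq with h | rfl
    · rw [Set.Icc_eq_empty (by linarith)]
      simp
    · simp
  have key : ∫⁻ x in Set.Ioc 0 s, ENNReal.ofReal (1 / √|x|) = ENNReal.ofReal (2 * √s) := by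
    have hi : IntervalIntegrable (fun x : ℝ => x ^ (-(1 / 2) : ℝ)) volume 0 s :=
      intervalIntegral.intervalIntegrable_rpow' (by norm_num)
    have hv : ∫ x in (0 : ℝ)..s, x ^ (-(1 / 2) : ℝ) = 2 * √s := by
      rw [integral_rpow (Or.inl (by norm_num)), Real.sqrt_eq_rpow]
      rw [show (-(1 / 2) + 1 : ℝ) = 1 / 2 by norm_num, Real.zero_rpow (by norm_num)]
      ring
    rw [← hv, intervalIntegral.integral_of_le hs.le, ofReal_integral_eq_lintegral_ofReal hi.1]
    · refine setLIntegral_congr_fun measurableSet_Ioc fun x hx => ?_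
      rw [abs_of_pos hx.1, Real.rpow_neg hx.1.le, ← Real.sqrt_eq_rpow, one_div]
    · refine (ae_restrict_mem measurableSet_Ioc).mono fun x hx => ?_
      exact Real.rpow_nonneg hx.1.le _
  have hneg : ∫⁻ x in Set.Ico (-s) 0, ENNReal.ofReal (1 / √|x|) =
      ∫⁻ x in Set.Ioc 0 s, ENNReal.ofReal (1 / √|x|) := by
    have := (Measure.measurePreserving_neg (volume : Measure ℝ)).setLIntegral_comp_preimage
      (s := Set.Ico (-s) 0) (f := fun x => ENNReal.ofReal (1 / √|x|)) measurableSet_Ico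
      (by fun_prop)
    simpa using this.symm
  have hu : Set.Icc (-s) s ⊆ Set.Ico (-s) 0 ∪ ({0} ∪ Set.Ioc 0 s) := by
    rintro x ⟨h1, h2⟩
    rcases lt_trichotomy x 0 with h | h | h
    · exact Or.inl ⟨h1, h⟩
    · exact Or.inr (Or.inl h)
    · exact Or.inr (Or.inr ⟨h, h2⟩)
  calc _ ≤ _ := lintegral_mono_set hu
    _ ≤ _ := (lintegral_union_le _ _ _).trans (add_le_add le_rfl (lintegral_union_le _ _ _))
    _ = ENNReal.ofReal (4 * √s) := by
      rw [hneg, key]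
      simp only [Measure.restrict_singleton, Real.volume_singleton, zero_smul,
        lintegral_zero_measure, zero_add]
      rw [← ENNReal.ofReal_add (by positivity) (by positivity)]
      ring_nf

theorem volume_slab_le_of_thin {R δ P : ℝ} {α : ℝ × ℝ} (hα : α ∈ box R) (hδ : 0 ≤ δ)
    (hP : 0 ≤ P) (s r : ℝ) :
    volume (slab α δ P (Set.Icc (-s) s ×ˢ Set.Icc (-r) r)) ≤
      ENNReal.ofReal (256 * P * δ * √s * √r) := by
  refine (volume_slab_le hα hδ hP (measurableSet_Icc.prod measurableSet_Icc)).trans ?_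
  have h1 : ∀ᵐ g : ℝ × ℝ, g.1 ≠ 0 :=
    Measure.quasiMeasurePreserving_fst.ae (p := fun x : ℝ => x ≠ 0) (by rw [ae_iff]; simp)
  have h2 : ∀ᵐ g : ℝ × ℝ, g.2 ≠ 0 :=
    Measure.quasiMeasurePreserving_snd.ae (p := fun x : ℝ => x ≠ 0) (by rw [ae_iff]; simp)
  have hle : ∀ᵐ g : ℝ × ℝ, ENNReal.ofReal (16 * P * δ / (|g.1| + |g.2|)) ≤
      ENNReal.ofReal (16 * P * δ) *
        (ENNReal.ofReal (1 / √|g.1|) * ENNReal.ofReal (1 / √|g.2|)) := by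
    filter_upwards [h1, h2] with g hg1 hg2
    rw [← ENNReal.ofReal_mul (by positivity), ← ENNReal.ofReal_mul (by positivity)]
    refine ENNReal.ofReal_le_ofReal ?_
    have e1 : 0 < √|g.1| := Real.sqrt_pos.mpr (abs_pos.mpr hg1)
    have e2 : 0 < √|g.2| := Real.sqrt_pos.mpr (abs_pos.mpr hg2)
    have e3 := Real.sq_sqrt (abs_nonneg g.1)
    have e4 := Real.sq_sqrt (abs_nonneg g.2)
    rw [one_div_mul_one_div, mul_one_div]
    gcongr
    nlinarith [sq_nonneg (√|g.1| - √|g.2|), mul_pos e1 e2]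
  calc _ ≤ _ := lintegral_mono_ae (ae_restrict_of_ae hle)
    _ = ENNReal.ofReal (16 * P * δ) * ((∫⁻ x in Set.Icc (-s) s, ENNReal.ofReal (1 / √|x|)) *
        ∫⁻ x in Set.Icc (-r) r, ENNReal.ofReal (1 / √|x|)) := by
      rw [lintegral_const_mul _ (by fun_prop), Measure.volume_eq_prod, ← Measure.prod_restrict,
        lintegral_prod_mul (f := fun x : ℝ => ENNReal.ofReal (1 / √|x|))
          (g := fun x : ℝ => ENNReal.ofReal (1 / √|x|)) (by fun_prop) (by fun_prop)]
    _ ≤ ENNReal.ofReal (16 * P * δ) * (ENNReal.ofReal (4 * √s) * ENNReal.ofReal (4 * √r)) := by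
      gcongr
      · exact lintegral_one_div_sqrt_le s
      · exact lintegral_one_div_sqrt_le r
    _ = _ := by
      rw [← ENNReal.ofReal_mul (by positivity), ← ENNReal.ofReal_mul (by positivity)]
      ring_nf

theorem norm_pair_le_iff {P : ℝ} {x : (ℝ × ℝ) × (ℝ × ℝ)} :
    ‖x‖ ≤ P ↔ (|x.1.1| ≤ P ∧ |x.1.2| ≤ P) ∧ |x.2.1| ≤ P ∧ |x.2.2| ≤ P := by
  simp only [Prod.norm_def, sup_le_iff, Real.norm_eq_abs]

theorem abs_sub_add_le_of_norm_le {P : ℝ} {x : (ℝ × ℝ) × (ℝ × ℝ)} (hx : ‖x‖ ≤ P) :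
    (|(x.1 - x.2).1| ≤ 2 * P ∧ |(x.1 - x.2).2| ≤ 2 * P) ∧
      |(x.1 + x.2).1| ≤ 2 * P ∧ |(x.1 + x.2).2| ≤ 2 * P := by
  obtain ⟨⟨h1, h2⟩, h3, h4⟩ := norm_pair_le_iff.mp hx
  simp only [Prod.fst_sub, Prod.snd_sub, Prod.fst_add, Prod.snd_add]
  exact ⟨⟨(abs_sub _ _).trans (by linarith), (abs_sub _ _).trans (by linarith)⟩,
    (abs_add_le _ _).trans (by linarith), (abs_add_le _ _).trans (by linarith)⟩

/-- Pairs of points of bounded size with small `lag` whose sum or difference has a small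
coordinate. -/
def thinSet (α : ℝ × ℝ) (δ P s : ℝ) : Set ((ℝ × ℝ) × (ℝ × ℝ)) :=
  {x | ‖x‖ ≤ P ∧ |lag α x| ≤ δ ∧ ((|(x.1 - x.2).1| ≤ s ∨ |(x.1 - x.2).2| ≤ s) ∨
    (|(x.1 + x.2).1| ≤ s ∨ |(x.1 + x.2).2| ≤ s))}

theorem measurePreserving_neg_snd :
    MeasurePreserving (fun x : (ℝ × ℝ) × (ℝ × ℝ) => (x.1, -x.2)) volume volume :=
  (MeasurePreserving.id volume).prod (Measure.measurePreserving_neg volume)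

theorem lag_neg_snd (α : ℝ × ℝ) (x : (ℝ × ℝ) × (ℝ × ℝ)) : lag α (x.1, -x.2) = lag α x := by
  simp only [lag, qr, Prod.fst_neg, Prod.snd_neg]
  ring

theorem volume_thinSet_le {R δ P s : ℝ} {α : ℝ × ℝ} (hα : α ∈ box R) (hδ : 0 ≤ δ) (hP : 0 ≤ P) :
    volume (thinSet α δ P s) ≤ ENNReal.ofReal (2048 * P * δ * √s * √P) := by
  set S₁ := slab α δ P (Set.Icc (-s) s ×ˢ Set.Icc (-(2 * P)) (2 * P))
  set S₂ := slab α δ P (Set.Icc (-(2 * P)) (2 * P) ×ˢ Set.Icc (-s) s)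
  have m₁ : MeasurableSet S₁ :=
    measurableSet_slab _ _ _ (measurableSet_Icc.prod measurableSet_Icc)
  have m₂ : MeasurableSet S₂ :=
    measurableSet_slab _ _ _ (measurableSet_Icc.prod measurableSet_Icc)
  set f := fun x : (ℝ × ℝ) × (ℝ × ℝ) => (x.1, -x.2)
  have hsub : thinSet α δ P s ⊆ (S₁ ∪ S₂) ∪ f ⁻¹' (S₁ ∪ S₂) := by
    rintro x ⟨hx, hL, h⟩
    obtain ⟨⟨b1, b2⟩, b3, b4⟩ := abs_sub_add_le_of_norm_le hx
    have c := (norm_pair_le_iff.mp hx).2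
    rcases h with h | h
    · left
      rcases h with h | h
      · exact Or.inl ⟨⟨abs_le.mp h, abs_le.mp b2⟩, c, hL⟩
      · exact Or.inr ⟨⟨abs_le.mp b1, abs_le.mp h⟩, c, hL⟩
    · right
      have e : (f x).1 - (f x).2 = x.1 + x.2 := sub_neg_eq_add _ _
      have c' : |(f x).2.1| ≤ P ∧ |(f x).2.2| ≤ P := by simpa [f] using c
      have hL' : |lag α (f x)| ≤ δ := by rwa [lag_neg_snd]
      rcases h with h | h
      · refine Or.inl ⟨?_, c', hL'⟩
        rw [e]
        exact ⟨abs_le.mp h, abs_le.mp b4⟩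
      · refine Or.inr ⟨?_, c', hL'⟩
        rw [e]
        exact ⟨abs_le.mp b3, abs_le.mp h⟩
  have h2 : √(2 * P) ≤ 2 * √P := by
    rw [Real.sqrt_mul zero_le_two]
    gcongr
    rw [Real.sqrt_le_left zero_le_two]
    norm_num
  have hv : volume (S₁ ∪ S₂) ≤ ENNReal.ofReal (1024 * P * δ * √s * √P) := by
    refine (measure_union_le _ _).trans ((add_le_add (volume_slab_le_of_thin hα hδ hP _ _)
      (volume_slab_le_of_thin hα hδ hP _ _)).trans ?_)
    rw [← ENNReal.ofReal_add (by positivity) (by positivity)]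
    refine ENNReal.ofReal_le_ofReal ?_
    calc _ = 512 * P * δ * √s * √(2 * P) := by ring
      _ ≤ 512 * P * δ * √s * (2 * √P) := by gcongr
      _ = _ := by ring
  refine (measure_mono hsub).trans ((measure_union_le _ _).trans ?_)
  rw [measurePreserving_neg_snd.measure_preimage (m₁.union m₂).nullMeasurableSet]
  refine (add_le_add hv hv).trans ?_
  rw [← ENNReal.ofReal_add (by positivity) (by positivity)]
  exact ENNReal.ofReal_le_ofReal (le_of_eq (by ring))

/-- Pairs of points of bounded size with small `lag` all of whose sum and difference coordinates
are large. -/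
def thickSet (α : ℝ × ℝ) (δ P l : ℝ) : Set ((ℝ × ℝ) × (ℝ × ℝ)) :=
  {x | ‖x‖ ≤ P ∧ |lag α x| ≤ δ ∧ inAnnulus l (2 * P) (x.1 - x.2) ∧
    inAnnulus l (2 * P) (x.1 + x.2)}

theorem volume_thickSet_le {R δ P l : ℝ} {α : ℝ × ℝ} (hα : α ∈ box R) (hδ : 0 ≤ δ) (hP : 0 ≤ P)
    (hl : 0 < l) : volume (thickSet α δ P l) ≤ ENNReal.ofReal (256 * P ^ 3 * δ / l) := by
  set A : Set (ℝ × ℝ) := (Set.Icc (-(2 * P)) (2 * P) ×ˢ Set.Icc (-(2 * P)) (2 * P)) ∩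
    {g | l ≤ |g.1|}
  have hA : MeasurableSet A := (measurableSet_Icc.prod measurableSet_Icc).inter
    (measurableSet_le measurable_const (measurable_norm.comp measurable_fst))
  have hsub : thickSet α δ P l ⊆ slab α δ P A := by
    rintro x ⟨hx, hL, h, -⟩
    exact ⟨⟨⟨abs_le.mp h.1.2, abs_le.mp h.2.2⟩, h.1.1⟩, (norm_pair_le_iff.mp hx).2, hL⟩
  refine (measure_mono hsub).trans
    ((volume_slab_le_of_far hα hδ hP hl hA fun g hg => hg.2).trans ?_)
  have hvA : volume A ≤ ENNReal.ofReal (16 * P ^ 2) := by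
    refine (measure_mono Set.inter_subset_left).trans (le_of_eq ?_)
    rw [Measure.volume_eq_prod, Measure.prod_prod, Real.volume_Icc,
      ← ENNReal.ofReal_mul (by linarith)]
    ring_nf
  refine (mul_le_mul_right hvA _).trans (le_of_eq ?_)
  rw [← ENNReal.ofReal_mul (by positivity)]
  ring_nf

theorem volume_thickSet_det_le {R δ P l E Y : ℝ} {α g' h' : ℝ × ℝ} (hR : 1 ≤ R) (hα : α ∈ box R)
    (hl : 2 ≤ l) (hδ0 : 0 ≤ δ) (hδ : δ ≤ 1) (hP : 0 ≤ P) (hg' : inAnnulus l (2 * P) g')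
    (hh' : inAnnulus l (2 * P) h') (hL' : |bf α g' h'| ≤ δ)
    (hY : 144 * R ^ 3 * ((2 * P) ^ 3 * E + (2 * P) ^ 5 * δ) / l ^ 5 ≤ Y) :
    volume (thickSet α δ P l ∩ {x | |pairDet (x.1 - x.2) (x.1 + x.2) g' h'| ≤ E}) ≤
      ENNReal.ofReal (256 * P ^ 2 * δ * Y / l ^ 2) := by
  have hl0 : 0 < l := by linarith
  rcases lt_or_ge Y 0 with hY0 | hY0
  · refine (measure_mono_null (t := ∅) ?_ measure_empty).le.trans zero_le
    rintro x ⟨⟨-, -, -, -⟩, hE⟩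
    have hE0 : 0 ≤ E := (abs_nonneg _).trans hE
    have : 0 ≤ 144 * R ^ 3 * ((2 * P) ^ 3 * E + (2 * P) ^ 5 * δ) / l ^ 5 := by positivity
    exact absurd (this.trans hY) (by linarith)
  set A : ℝ × ℝ → Set (ℝ × ℝ) := fun k => strip (2 * P) k.2 (-k.1) 0 Y ∩ {g | l ≤ |g.1|}
  have hA : ∀ k, MeasurableSet (A k) := fun k => (measurableSet_strip _ _ _ _ _).inter
    (measurableSet_le measurable_const (measurable_norm.comp measurable_fst))
  have hsub : thickSet α δ P l ∩ {x | |pairDet (x.1 - x.2) (x.1 + x.2) g' h'| ≤ E} ⊆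
      slab α δ P (A g') ∪ slab α δ P (A h') := by
    rintro x ⟨⟨hx, hL, hg, hh⟩, hE⟩
    have hX : 144 * R ^ 3 * ((2 * P) ^ 3 * |pairDet (x.1 - x.2) (x.1 + x.2) g' h'| +
        (2 * P) ^ 5 * δ) / l ^ 5 ≤ Y := by
      refine le_trans ?_ hY
      gcongr
      exact hE
    have c := (norm_pair_le_iff.mp hx).2
    have hst : ∀ k : ℝ × ℝ, |wedge (x.1 - x.2) k| ≤ Y → x.1 - x.2 ∈ A k := by
      intro k hk
      refine ⟨⟨hg.1.2, hg.2.2, ?_⟩, hg.1.1⟩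
      convert hk using 2
      simp only [wedge]
      ring
    have hL2 := hL
    rw [lag_eq_bf] at hL2
    rcases wedge_le_or hR hα hl hg hh hg' hh' hδ hL2 hL' with h | h
    · exact Or.inl ⟨hst _ (h.1.trans hX), c, hL⟩
    · exact Or.inr ⟨hst _ (h.1.trans hX), c, hL⟩
  have hv : ∀ k, inAnnulus l (2 * P) k → volume (slab α δ P (A k)) ≤
      ENNReal.ofReal (128 * P ^ 2 * δ * Y / l ^ 2) := by
    intro k hk
    have hk2 : 0 < |k.2| := hl0.trans_le hk.2.1
    refine (volume_slab_le_of_far hα hδ0 hP hl0 (hA k) fun g hg => hg.2).trans ?_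
    have hvA : volume (A k) ≤ ENNReal.ofReal (8 * P * Y / l) := by
      refine (measure_mono Set.inter_subset_left).trans
        ((volume_strip_le_left hY0 (abs_pos.mp hk2)).trans (ENNReal.ofReal_le_ofReal ?_))
      calc 4 * (2 * P) * Y / |k.2| ≤ 4 * (2 * P) * Y / l := by
            gcongr
            exact hk.2.1
        _ = _ := by ring
    refine (mul_le_mul_right hvA _).trans (le_of_eq ?_)
    rw [← ENNReal.ofReal_mul (by positivity)]
    congr 1
    field_simp
    ring
  refine (measure_mono hsub).trans ((measure_union_le _ _).trans
    ((add_le_add (hv g' hg') (hv h' hh')).trans (le_of_eq ?_)))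
  rw [← ENNReal.ofReal_add (by positivity) (by positivity)]
  ring_nf

/-- An integer point viewed as a real one. -/
def pt (p : (ℤ × ℤ) × (ℤ × ℤ)) : (ℝ × ℝ) × (ℝ × ℝ) := ((p.1.1, p.1.2), (p.2.1, p.2.2))

/-- Integer points with coordinates of absolute value at most `N`. -/
noncomputable def latticeBox (N : ℕ) : Finset ((ℤ × ℤ) × (ℤ × ℤ)) :=
  (Finset.Icc (-(N : ℤ)) N ×ˢ Finset.Icc (-(N : ℤ)) N) ×ˢ
    (Finset.Icc (-(N : ℤ)) N ×ˢ Finset.Icc (-(N : ℤ)) N)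

theorem mem_latticeBox {N : ℕ} {p : (ℤ × ℤ) × (ℤ × ℤ)} : p ∈ latticeBox N ↔
    ((-(N : ℤ) ≤ p.1.1 ∧ p.1.1 ≤ N) ∧ -(N : ℤ) ≤ p.1.2 ∧ p.1.2 ≤ N) ∧
      (-(N : ℤ) ≤ p.2.1 ∧ p.2.1 ≤ N) ∧ -(N : ℤ) ≤ p.2.2 ∧ p.2.2 ≤ N := by
  simp only [latticeBox, Finset.mem_product, Finset.mem_Icc]

theorem mem_latticeBox_iff_norm {N : ℕ} {p : (ℤ × ℤ) × (ℤ × ℤ)} :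
    p ∈ latticeBox N ↔ ‖pt p‖ ≤ N := by
  rw [mem_latticeBox, norm_pair_le_iff]
  simp only [pt, abs_le]
  norm_cast

/-- Difference and sum coordinates of an integer point. -/
def quad (p : (ℤ × ℤ) × (ℤ × ℤ)) : (ℤ × ℤ) × (ℤ × ℤ) :=
  ((p.1.1 - p.2.1, p.1.1 + p.2.1), (p.1.2 - p.2.2, p.1.2 + p.2.2))

theorem quad_injective : Function.Injective quad := by
  rintro ⟨⟨a, b⟩, c, d⟩ ⟨⟨a', b'⟩, c', d'⟩ h
  simp only [quad, Prod.mk.injEq] at h ⊢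
  omega

theorem gI_quad (p : (ℤ × ℤ) × (ℤ × ℤ)) : gI (quad p) = (pt p).1 - (pt p).2 := by
  ext <;> simp [gI, quad, pt]

theorem hI_quad (p : (ℤ × ℤ) × (ℤ × ℤ)) : hI (quad p) = (pt p).1 + (pt p).2 := by
  ext <;> simp [hI, quad, pt]

/-- Parameters for which `lag` is small at an integer point. -/
def pointCell (R δ : ℝ) (p : (ℤ × ℤ) × (ℤ × ℤ)) : Set (ℝ × ℝ) :=
  cell R δ (gI (quad p)) (hI (quad p))

theorem mem_pointCell {R δ : ℝ} {p : (ℤ × ℤ) × (ℤ × ℤ)} {α : ℝ × ℝ} :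
    α ∈ pointCell R δ p ↔ α ∈ box R ∧ |lag α (pt p)| ≤ δ := by
  rw [lag_eq_bf, ← gI_quad, ← hI_quad]
  rfl

/-- Integer points whose sum and difference coordinates are all nonzero. -/
noncomputable def goodPts (N : ℕ) : Finset ((ℤ × ℤ) × (ℤ × ℤ)) :=
  (latticeBox N).filter fun p => quad p ∈ nzQuads (2 * N)

theorem quad_mem_nzQuads {N : ℕ} {p : (ℤ × ℤ) × (ℤ × ℤ)} (hp : p ∈ latticeBox N)
    (h : ((quad p).1.1 ≠ 0 ∧ (quad p).1.2 ≠ 0) ∧ (quad p).2.1 ≠ 0 ∧ (quad p).2.2 ≠ 0) :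
    quad p ∈ nzQuads (2 * N) := by
  rw [mem_latticeBox] at hp
  simp only [mem_nzQuads, mem_nzInts]
  simp only [quad] at h ⊢
  omega

theorem sum_goodPts_le {N : ℕ} {s : Finset ((ℤ × ℤ) × (ℤ × ℤ))} (hs : s ⊆ goodPts N)
    {f : (ℤ × ℤ) × (ℤ × ℤ) → ℝ} (hf : ∀ G, 0 ≤ f G) :
    ∑ p ∈ s, f (quad p) ≤ ∑ G ∈ nzQuads (2 * N), f G := by
  rw [← Finset.sum_image (f := f) (g := quad) (quad_injective.injOn)]
  refine Finset.sum_le_sum_of_subset_of_nonneg ?_ fun G _ _ => hf G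
  intro G hG
  obtain ⟨p, hp, rfl⟩ := Finset.mem_image.mp hG
  exact (Finset.mem_filter.mp (hs hp)).2

theorem sum_sum_goodPts_le {N : ℕ} {s : Finset ((ℤ × ℤ) × (ℤ × ℤ))} (hs : s ⊆ goodPts N)
    {f : (ℤ × ℤ) × (ℤ × ℤ) → (ℤ × ℤ) × (ℤ × ℤ) → ℝ} (hf : ∀ G G', 0 ≤ f G G') :
    ∑ p ∈ s, ∑ p' ∈ s, f (quad p) (quad p') ≤
      ∑ G ∈ nzQuads (2 * N), ∑ G' ∈ nzQuads (2 * N), f G G' :=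
  (Finset.sum_le_sum fun p _ => sum_goodPts_le hs fun G => hf (quad p) G).trans
    (sum_goodPts_le (f := fun G => ∑ G' ∈ nzQuads (2 * N), f G G') hs
      fun G => Finset.sum_nonneg fun G' _ => hf G G')

/-- Good points some of whose sum and difference coordinates are small. -/
noncomputable def smallPts (N : ℕ) (l : ℝ) : Finset ((ℤ × ℤ) × (ℤ × ℤ)) :=
  (goodPts N).filter fun p => ¬ largeQuad l (quad p)

/-- Points all of whose sum and difference coordinates are large. -/
noncomputable def largePts (N : ℕ) (l : ℝ) : Finset ((ℤ × ℤ) × (ℤ × ℤ)) :=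
  (goodPts N).filter fun p => largeQuad l (quad p)

theorem smallQuad_of_not_largeQuad {l : ℝ} {G : (ℤ × ℤ) × (ℤ × ℤ)} (hl : 0 ≤ l)
    (h : ¬ largeQuad l G) : smallQuad ⌊l⌋₊ G := by
  have key : ∀ x : ℤ, ¬ l ≤ |(x : ℝ)| → x.natAbs ≤ ⌊l⌋₊ := by
    intro x hx
    rw [Nat.le_floor_iff hl, Nat.cast_natAbs, Int.cast_abs]
    exact (not_le.mp hx).le
  unfold smallQuad
  by_contra! hc
  apply h
  have key' : ∀ x : ℤ, ⌊l⌋₊ < x.natAbs → l ≤ |(x : ℝ)| := by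
    intro x hx
    by_contra hx'
    exact absurd (key x hx') (not_le.mpr hx)
  exact ⟨⟨key' _ hc.1.1, key' _ hc.1.2⟩, key' _ hc.2.1, key' _ hc.2.2⟩

theorem sum_smallPts_le (R ε : ℝ) (hR : 0 ≤ R) (hε : 0 < ε) :
    ∃ C : ℝ, 0 ≤ C ∧ ∀ N : ℕ, 1 ≤ N → ∀ l δ : ℝ, 0 ≤ l → 0 ≤ δ →
      ∑ p ∈ smallPts N l, ∑ p' ∈ smallPts N l, pairMeas R δ (quad p) (quad p') ≤
        C * (N : ℝ) ^ ε * ((N : ℝ) ^ 3 * l * δ ^ 2 + (N : ℝ) ^ 2 * δ) := by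
  obtain ⟨C₁, hC₁, H₁⟩ := sum_pairMeas_small_le R ε hε
  obtain ⟨C₂, hC₂, H₂⟩ := sum_pairMeas_det_zero_le R ε hR hε
  refine ⟨8 * 2 ^ ε * C₁ + 4 * 2 ^ ε * C₂, by positivity, fun N hN l δ hl hδ => ?_⟩
  have hsub : smallPts N l ⊆ goodPts N := Finset.filter_subset _ _
  have h1 := H₁ (2 * N) (by omega) ⌊l⌋₊ δ hδ
  have h2 := H₂ (2 * N) (by omega) δ hδ
  have hcast : ((2 * N : ℕ) : ℝ) ^ ε = 2 ^ ε * (N : ℝ) ^ ε := by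
    push_cast
    rw [Real.mul_rpow zero_le_two (by positivity)]
  rw [hcast] at h1 h2
  simp only [Nat.cast_mul, Nat.cast_ofNat] at h1 h2
  have h3 := Nat.floor_le hl
  have hp : 0 ≤ (2 : ℝ) ^ ε * C₂ * (N : ℝ) ^ ε * ((N : ℝ) ^ 3 * l * δ ^ 2) := by positivity
  have hq : 0 ≤ (2 : ℝ) ^ ε * C₁ * (N : ℝ) ^ ε * ((N : ℝ) ^ 2 * δ) := by positivity
  calc _ ≤ ∑ p ∈ smallPts N l, ∑ p' ∈ smallPts N l,
        ((if smallQuad ⌊l⌋₊ (quad p) ∧ prd ((quad p).1, (quad p').2) ≠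
            prd ((quad p').1, (quad p).2) then pairMeas R δ (quad p) (quad p') else 0) +
          (if prd ((quad p).1, (quad p').2) = prd ((quad p').1, (quad p).2) then
            pairMeas R δ (quad p) (quad p') else 0)) := by
        refine Finset.sum_le_sum fun p hp => Finset.sum_le_sum fun p' _ => ?_
        have := smallQuad_of_not_largeQuad hl (Finset.mem_filter.mp hp).2
        have := pairMeas_nonneg R δ (quad p) (quad p')
        split_ifs <;> grind
    _ ≤ _ := by
        simp only [Finset.sum_add_distrib]
        refine add_le_add
          ((sum_sum_goodPts_le hsub (f := fun G G' => if smallQuad ⌊l⌋₊ G ∧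
            prd (G.1, G'.2) ≠ prd (G'.1, G.2) then pairMeas R δ G G' else 0) ?_).trans h1)
          ((sum_sum_goodPts_le hsub (f := fun G G' => if
            prd (G.1, G'.2) = prd (G'.1, G.2) then pairMeas R δ G G' else 0) ?_).trans h2)
        · intro G G'
          have := pairMeas_nonneg R δ G G'
          split_ifs <;> simp [this]
        · intro G G'
          have := pairMeas_nonneg R δ G G'
          split_ifs <;> simp [this]
    _ ≤ C₁ * (2 ^ ε * (N : ℝ) ^ ε) * (2 * (N : ℝ)) ^ 3 * l * δ ^ 2 +
        C₂ * (2 ^ ε * (N : ℝ) ^ ε) * (2 * (N : ℝ)) ^ 2 * δ := by gcongr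
    _ ≤ _ := by nlinarith

/-- The determinant attached to two integer points is at most `E` in absolute value. -/
def degenerate (E : ℝ) (p p' : (ℤ × ℤ) × (ℤ × ℤ)) : Prop :=
  |pairDet (gI (quad p)) (hI (quad p)) (gI (quad p')) (hI (quad p'))| ≤ E

theorem sum_degenerate_le (R ε : ℝ) (hR : 1 ≤ R) (hε : 0 < ε) :
    ∃ C : ℝ, 0 ≤ C ∧ ∀ N : ℕ, 1 ≤ N → ∀ l δ E Y : ℝ, 2 ≤ l → 0 < δ → δ ≤ 1 → 1 ≤ Y →
      144 * R ^ 3 * ((2 * N : ℝ) ^ 3 * E + (2 * N : ℝ) ^ 5 * δ) / l ^ 5 ≤ Y →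
      ∑ p ∈ largePts N l, ∑ p' ∈ largePts N l,
        (if degenerate E p p' then pairMeas R δ (quad p) (quad p') else 0) ≤
        C * (N : ℝ) ^ ε * ((N : ℝ) ^ 9 * δ ^ 2 / l ^ 7 * Y + (N : ℝ) ^ 2 * δ) := by
  obtain ⟨C₁, hC₁, H₁⟩ := sum_pairMeas_large_le R ε hR hε
  obtain ⟨C₂, hC₂, H₂⟩ := sum_pairMeas_det_zero_le R ε (by linarith) hε
  refine ⟨2 ^ 9 * 2 ^ ε * C₁ + 4 * 2 ^ ε * C₂, by positivity,
    fun N hN l δ E Y hl hδ hδ1 hY1 hY => ?_⟩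
  have hsub : largePts N l ⊆ goodPts N := Finset.filter_subset _ _
  have h1 := H₁ (2 * N) (by omega) l δ E Y hl hδ hδ1 hY1 (by push_cast; exact hY)
  have h2 := H₂ (2 * N) (by omega) δ hδ.le
  have hcast : ((2 * N : ℕ) : ℝ) ^ ε = 2 ^ ε * (N : ℝ) ^ ε := by
    push_cast
    rw [Real.mul_rpow zero_le_two (by positivity)]
  rw [hcast] at h1 h2
  simp only [Nat.cast_mul, Nat.cast_ofNat] at h1 h2
  have hl0 : 0 < l := by linarith
  have hp : 0 ≤ (2 : ℝ) ^ ε * C₂ * (N : ℝ) ^ ε * ((N : ℝ) ^ 9 * δ ^ 2 / l ^ 7 * Y) := by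
    positivity
  have hq : 0 ≤ (2 : ℝ) ^ ε * C₁ * (N : ℝ) ^ ε * ((N : ℝ) ^ 2 * δ) := by positivity
  calc _ ≤ ∑ p ∈ largePts N l, ∑ p' ∈ largePts N l,
        ((if (largeQuad l (quad p) ∧ largeQuad l (quad p')) ∧ prd ((quad p).1, (quad p').2) ≠
            prd ((quad p').1, (quad p).2) ∧ |((prd ((quad p).1, (quad p').2) -
            prd ((quad p').1, (quad p).2) : ℤ) : ℝ)| ≤ E then
            pairMeas R δ (quad p) (quad p') else 0) +
          (if prd ((quad p).1, (quad p').2) = prd ((quad p').1, (quad p).2) then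
            pairMeas R δ (quad p) (quad p') else 0)) := by
        refine Finset.sum_le_sum fun p hp => Finset.sum_le_sum fun p' hp' => ?_
        have := (Finset.mem_filter.mp hp).2
        have := (Finset.mem_filter.mp hp').2
        have := pairMeas_nonneg R δ (quad p) (quad p')
        unfold degenerate
        rw [pairDet_cast]
        split_ifs <;> grind
    _ ≤ _ := by
        simp only [Finset.sum_add_distrib]
        refine add_le_add
          ((sum_sum_goodPts_le hsub (f := fun G G' => if (largeQuad l G ∧ largeQuad l G') ∧
            prd (G.1, G'.2) ≠ prd (G'.1, G.2) ∧ |((prd (G.1, G'.2) -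
            prd (G'.1, G.2) : ℤ) : ℝ)| ≤ E then pairMeas R δ G G' else 0) ?_).trans h1)
          ((sum_sum_goodPts_le hsub (f := fun G G' => if
            prd (G.1, G'.2) = prd (G'.1, G.2) then pairMeas R δ G G' else 0) ?_).trans h2)
        · intro G G'
          have := pairMeas_nonneg R δ G G'
          split_ifs <;> simp [this]
        · intro G G'
          have := pairMeas_nonneg R δ G G'
          split_ifs <;> simp [this]
    _ = C₁ * (2 ^ ε * (N : ℝ) ^ ε) * 2 ^ 9 * ((N : ℝ) ^ 9 * δ ^ 2 / l ^ 7 * Y) +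
        C₂ * (2 ^ ε * (N : ℝ) ^ ε) * 4 * ((N : ℝ) ^ 2 * δ) := by ring
    _ ≤ _ := by nlinarith

theorem integral_sq_sum_indicator {ι : Type*} (R : ℝ) (s : Finset ι) {S : ι → Set (ℝ × ℝ)}
    (hm : ∀ i, MeasurableSet (S i)) (hs : ∀ i, S i ⊆ box R) :
    (∫ α in box R, (∑ i ∈ s, (S i).indicator (1 : ℝ × ℝ → ℝ) α) ^ 2) =
      ∑ i ∈ s, ∑ j ∈ s, volume.real (S i ∩ S j) := by
  have hfin : ∀ i j, volume (S i ∩ S j) ≠ ⊤ := fun i j =>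
    ((measure_mono (Set.inter_subset_left.trans (hs i))).trans_lt (volume_box_lt_top R)).ne
  have hint : ∀ i j, Integrable ((S i ∩ S j).indicator (1 : ℝ × ℝ → ℝ))
      (volume.restrict (box R)) := fun i j =>
    ((integrable_indicator_iff ((hm i).inter (hm j))).mpr
      (integrableOn_const (hfin i j))).restrict
  have hsq : ∀ α, (∑ i ∈ s, (S i).indicator (1 : ℝ × ℝ → ℝ) α) ^ 2 =
      ∑ i ∈ s, ∑ j ∈ s, (S i ∩ S j).indicator (1 : ℝ × ℝ → ℝ) α := by
    intro α
    rw [sq, Finset.sum_mul_sum]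
    simp only [Set.inter_indicator_one, Pi.mul_apply]
  simp only [hsq]
  rw [integral_finsetSum _ fun i _ => integrable_finsetSum _ fun j _ => hint i j]
  refine Finset.sum_congr rfl fun i _ => ?_
  rw [integral_finsetSum _ fun j _ => hint i j]
  refine Finset.sum_congr rfl fun j _ => ?_
  rw [integral_indicator_one ((hm i).inter (hm j)),
    measureReal_restrict_apply ((hm i).inter (hm j)),
    Set.inter_eq_left.mpr (Set.inter_subset_left.trans (hs i))]

/-- Off-diagonal integer points some of whose sum and difference coordinates vanish. -/
noncomputable def badPts (N : ℕ) : Finset ((ℤ × ℤ) × (ℤ × ℤ)) :=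
  (latticeBox N).filter fun p => (p.1 ≠ p.2 ∧ p.1 ≠ -p.2) ∧ p ∉ goodPts N

theorem sum_indicator_eq_card {ι A : Type*} (s : Finset ι) (S : ι → Set A) (a : A) :
    ∑ i ∈ s, (S i).indicator (1 : A → ℝ) a = ((s.filter fun i => a ∈ S i).card : ℝ) := by
  rw [Finset.card_filter]
  push_cast
  exact Finset.sum_congr rfl fun i _ => by simp [Set.indicator_apply]

theorem one_le_abs_cast_mul {a b : ℤ} (ha : a ≠ 0) (hb : b ≠ 0) : 1 ≤ |(a : ℝ) * b| := by
  have : 1 ≤ |a * b| := Int.one_le_abs (mul_ne_zero ha hb)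
  exact_mod_cast this

/-- In a bad point with small `lag` exactly one sum or difference coordinate vanishes. -/
theorem bad_ne_zero {β δ : ℝ} {g h k : ℤ} (hβ : 3 / 4 ≤ β) (hδ : 2 * δ < 1)
    (hL : |(g : ℝ) * (2 * β * h + k)| ≤ 2 * δ) (hg : g ≠ 0) (hhk : h ≠ 0 ∨ k ≠ 0) :
    h ≠ 0 ∧ k ≠ 0 := by
  constructor
  · rintro rfl
    have hk : k ≠ 0 := by simpa using hhk
    have := one_le_abs_cast_mul hg hk
    simp only [Int.cast_zero, mul_zero, zero_add] at hL
    linarith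
  · rintro rfl
    have hh : h ≠ 0 := by simpa using hhk
    have h1 := one_le_abs_cast_mul hg hh
    have h2 : |(g : ℝ) * (2 * β * h + (0 : ℤ))| = 2 * β * |(g : ℝ) * h| := by
      rw [Int.cast_zero, add_zero, ← mul_assoc, mul_comm (g : ℝ), mul_assoc, abs_mul,
        abs_of_pos (by linarith)]
    rw [h2] at hL
    nlinarith

theorem two_mul_lag_pt (α : ℝ × ℝ) (p : (ℤ × ℤ) × (ℤ × ℤ)) :
    2 * lag α (pt p) =
      2 * α.1 * ((quad p).1.1 * (quad p).1.2) + 2 * α.2 * ((quad p).2.1 * (quad p).2.2) +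
        ((quad p).1.1 * (quad p).2.2 + (quad p).2.1 * (quad p).1.2) := by
  simp only [lag, qr, quad, pt]
  push_cast
  ring

set_option maxHeartbeats 1000000 in
theorem sum_bad_le {R δ : ℝ} {α : ℝ × ℝ} (N : ℕ) (hα : α ∈ box R) (hδ : 2 * δ < 1) :
    ∑ p ∈ badPts N, (pointCell R δ p).indicator (1 : ℝ × ℝ → ℝ) α ≤
      2 * ∑ t ∈ nzTriples (2 * N), (slot R δ t).indicator (1 : ℝ → ℝ) α.1 +
      2 * ∑ t ∈ nzTriples (2 * N), (slot R δ t).indicator (1 : ℝ → ℝ) α.2 := by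
  simp only [sum_indicator_eq_card]
  set F := (badPts N).filter fun p => α ∈ pointCell R δ p with hF
  set T : ℝ → Finset (ℤ × (ℤ × ℤ)) :=
    fun β => (nzTriples (2 * N)).filter fun t => β ∈ slot R δ t
  have hb := mem_box.mp hα
  have hmem : ∀ β : ℝ, (3 / 4 ≤ β ∧ β ≤ R) → ∀ g h k : ℤ,
      |(g : ℝ) * (2 * β * h + k)| ≤ 2 * δ → g ≠ 0 → (h ≠ 0 ∨ k ≠ 0) →
      g.natAbs ≤ 2 * N → h.natAbs ≤ 2 * N → k.natAbs ≤ 2 * N → (g, (h, k)) ∈ T β := by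
    intro β hβ g h k hL hg hhk b1 b2 b3
    have := bad_ne_zero hβ.1 hδ hL hg hhk
    refine Finset.mem_filter.mpr ⟨mem_nzTriples.mpr ⟨mem_nzInts.mpr ⟨hg, b1⟩,
      mem_nzInts.mpr ⟨this.1, b2⟩, mem_nzInts.mpr ⟨this.2, b3⟩⟩, hβ, ?_⟩
    rw [← abs_mul]
    exact hL
  have hprop : ∀ p ∈ F, (p.1 ≠ p.2 ∧ p.1 ≠ -p.2) ∧ |lag α (pt p)| ≤ δ ∧
      (((quad p).1.1.natAbs ≤ 2 * N ∧ (quad p).1.2.natAbs ≤ 2 * N) ∧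
        (quad p).2.1.natAbs ≤ 2 * N ∧ (quad p).2.2.natAbs ≤ 2 * N) := by
    intro p hp
    rw [hF, Finset.mem_filter, badPts, Finset.mem_filter, mem_pointCell] at hp
    refine ⟨hp.1.2.1, hp.2.2, ?_⟩
    have := mem_latticeBox.mp hp.1.1
    simp only [quad]
    omega
  have hcover : F ⊆ ((F.filter fun p => (quad p).1.1 = 0) ∪ (F.filter fun p => (quad p).1.2 = 0)) ∪
      ((F.filter fun p => (quad p).2.1 = 0) ∪ (F.filter fun p => (quad p).2.2 = 0)) := by
    intro p hp
    have h1 := hp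
    rw [hF, Finset.mem_filter, badPts, Finset.mem_filter] at h1
    have h2 : ¬ (((quad p).1.1 ≠ 0 ∧ (quad p).1.2 ≠ 0) ∧ (quad p).2.1 ≠ 0 ∧ (quad p).2.2 ≠ 0) :=
      fun h => h1.1.2.2 (Finset.mem_filter.mpr ⟨h1.1.1, quad_mem_nzQuads h1.1.1 h⟩)
    simp only [Finset.mem_union, Finset.mem_filter]
    by_contra hc
    simp only [hp, true_and, not_or] at hc
    exact h2 hc
  have hoff : ∀ p : (ℤ × ℤ) × (ℤ × ℤ), (p.1 ≠ p.2 ∧ p.1 ≠ -p.2) →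
      ((quad p).1.1 ≠ 0 ∨ (quad p).2.1 ≠ 0) ∧ ((quad p).1.2 ≠ 0 ∨ (quad p).2.2 ≠ 0) := by
    rintro ⟨⟨a, b⟩, c, d⟩ ⟨h1, h2⟩
    simp only [quad, ne_eq, Prod.neg_mk, Prod.mk.injEq] at h1 h2 ⊢
    omega
  have htwo : ∀ p ∈ F, |2 * lag α (pt p)| ≤ 2 * δ := by
    intro p hp
    rw [abs_mul, abs_two]
    linarith [(hprop p hp).2.1]
  have c₁ : (F.filter fun p => (quad p).1.1 = 0).card ≤ (T α.2).card := by
    refine Finset.card_le_card_of_injOn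
      (fun p => ((quad p).2.1, ((quad p).2.2, (quad p).1.2))) ?_ ?_
    · intro p hp
      obtain ⟨hp, h0⟩ := Finset.mem_filter.mp (Finset.mem_coe.mp hp)
      obtain ⟨ho, -, ⟨b1, b2⟩, b3, b4⟩ := hprop p hp
      have hL := htwo p hp
      rw [two_mul_lag_pt, h0] at hL
      have := hoff p ho
      rw [h0] at this
      refine hmem α.2 hb.2 _ _ _ ?_ (by simpa using this.1) this.2.symm b3 b4 b2
      convert hL using 2
      push_cast
      ring
    · intro p hp p' hp' he
      have h0 := (Finset.mem_filter.mp (Finset.mem_coe.mp hp)).2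
      have h0' := (Finset.mem_filter.mp (Finset.mem_coe.mp hp')).2
      simp only [Prod.mk.injEq] at he
      exact quad_injective (Prod.ext (Prod.ext (h0.trans h0'.symm) he.2.2)
        (Prod.ext he.1 he.2.1))
  have c₂ : (F.filter fun p => (quad p).1.2 = 0).card ≤ (T α.2).card := by
    refine Finset.card_le_card_of_injOn
      (fun p => ((quad p).2.2, ((quad p).2.1, (quad p).1.1))) ?_ ?_
    · intro p hp
      obtain ⟨hp, h0⟩ := Finset.mem_filter.mp (Finset.mem_coe.mp hp)
      obtain ⟨ho, -, ⟨b1, b2⟩, b3, b4⟩ := hprop p hp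
      have hL := htwo p hp
      rw [two_mul_lag_pt, h0] at hL
      have := hoff p ho
      rw [h0] at this
      refine hmem α.2 hb.2 _ _ _ ?_ (by simpa using this.2) this.1.symm b4 b3 b1
      convert hL using 2
      push_cast
      ring
    · intro p hp p' hp' he
      have h0 := (Finset.mem_filter.mp (Finset.mem_coe.mp hp)).2
      have h0' := (Finset.mem_filter.mp (Finset.mem_coe.mp hp')).2
      simp only [Prod.mk.injEq] at he
      exact quad_injective (Prod.ext (Prod.ext he.2.2 (h0.trans h0'.symm))
        (Prod.ext he.2.1 he.1))
  have c₃ : (F.filter fun p => (quad p).2.1 = 0).card ≤ (T α.1).card := by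
    refine Finset.card_le_card_of_injOn
      (fun p => ((quad p).1.1, ((quad p).1.2, (quad p).2.2))) ?_ ?_
    · intro p hp
      obtain ⟨hp, h0⟩ := Finset.mem_filter.mp (Finset.mem_coe.mp hp)
      obtain ⟨ho, -, ⟨b1, b2⟩, b3, b4⟩ := hprop p hp
      have hL := htwo p hp
      rw [two_mul_lag_pt, h0] at hL
      have := hoff p ho
      rw [h0] at this
      refine hmem α.1 hb.1 _ _ _ ?_ (by simpa using this.1) this.2 b1 b2 b4
      convert hL using 2
      push_cast
      ring
    · intro p hp p' hp' he
      have h0 := (Finset.mem_filter.mp (Finset.mem_coe.mp hp)).2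
      have h0' := (Finset.mem_filter.mp (Finset.mem_coe.mp hp')).2
      simp only [Prod.mk.injEq] at he
      exact quad_injective (Prod.ext (Prod.ext he.1 he.2.1)
        (Prod.ext (h0.trans h0'.symm) he.2.2))
  have c₄ : (F.filter fun p => (quad p).2.2 = 0).card ≤ (T α.1).card := by
    refine Finset.card_le_card_of_injOn
      (fun p => ((quad p).1.2, ((quad p).1.1, (quad p).2.1))) ?_ ?_
    · intro p hp
      obtain ⟨hp, h0⟩ := Finset.mem_filter.mp (Finset.mem_coe.mp hp)
      obtain ⟨ho, -, ⟨b1, b2⟩, b3, b4⟩ := hprop p hp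
      have hL := htwo p hp
      rw [two_mul_lag_pt, h0] at hL
      have := hoff p ho
      rw [h0] at this
      refine hmem α.1 hb.1 _ _ _ ?_ (by simpa using this.2) this.1 b2 b1 b3
      convert hL using 2
      push_cast
      ring
    · intro p hp p' hp' he
      have h0 := (Finset.mem_filter.mp (Finset.mem_coe.mp hp)).2
      have h0' := (Finset.mem_filter.mp (Finset.mem_coe.mp hp')).2
      simp only [Prod.mk.injEq] at he
      exact quad_injective (Prod.ext (Prod.ext he.2.1 he.1)
        (Prod.ext he.2.2 (h0.trans h0'.symm)))
  have hcard : F.card ≤ 2 * (T α.1).card + 2 * (T α.2).card := by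
    refine (Finset.card_le_card hcover).trans ?_
    have u1 := Finset.card_union_le ((F.filter fun p => (quad p).1.1 = 0) ∪
      (F.filter fun p => (quad p).1.2 = 0))
      ((F.filter fun p => (quad p).2.1 = 0) ∪ (F.filter fun p => (quad p).2.2 = 0))
    have u2 := Finset.card_union_le (F.filter fun p => (quad p).1.1 = 0)
      (F.filter fun p => (quad p).1.2 = 0)
    have u3 := Finset.card_union_le (F.filter fun p => (quad p).2.1 = 0)
      (F.filter fun p => (quad p).2.2 = 0)
    omega
  exact_mod_cast hcard

theorem measurableSet_slot (R δ : ℝ) (t : ℤ × (ℤ × ℤ)) : MeasurableSet (slot R δ t) := by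
  unfold slot
  rw [Set.ofPred_and]
  refine measurableSet_Icc.inter (measurableSet_le (Continuous.measurable ?_) measurable_const)
  fun_prop

theorem integral_bad_le (R ε : ℝ) (hR : 1 ≤ R) (hε : 0 < ε) :
    ∃ C : ℝ, 0 ≤ C ∧ ∀ N : ℕ, 1 ≤ N → ∀ δ : ℝ, 0 ≤ δ → 2 * δ < 1 →
      (∫ α in box R, (∑ p ∈ badPts N, (pointCell R δ p).indicator (1 : ℝ × ℝ → ℝ) α) ^ 2) ≤
        C * (N : ℝ) ^ ε * ((N : ℝ) ^ 2 * δ) := by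
  obtain ⟨C, hC, H⟩ := sum_slotMeas_le R ε hR hε
  refine ⟨64 * 2 ^ ε * R * C, by positivity, fun N hN δ hδ hδ1 => ?_⟩
  have h := H (2 * N) (by omega) δ hδ hδ1.le
  set I : Set ℝ := Set.Icc (3 / 4) R
  have hI : volume.real I ≤ R := by
    rw [Real.volume_real_Icc]
    exact max_le (by linarith) (by linarith)
  set S₁ : ℤ × (ℤ × ℤ) → Set (ℝ × ℝ) := fun t => slot R δ t ×ˢ I
  set S₂ : ℤ × (ℤ × ℤ) → Set (ℝ × ℝ) := fun t => I ×ˢ slot R δ t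
  have m₁ : ∀ t, MeasurableSet (S₁ t) := fun t => (measurableSet_slot R δ t).prod measurableSet_Icc
  have m₂ : ∀ t, MeasurableSet (S₂ t) := fun t => measurableSet_Icc.prod (measurableSet_slot R δ t)
  have b₁ : ∀ t, S₁ t ⊆ box R := fun t => Set.prod_mono (slot_subset_Icc R δ t) le_rfl
  have b₂ : ∀ t, S₂ t ⊆ box R := fun t => Set.prod_mono le_rfl (slot_subset_Icc R δ t)
  set n₁ : ℝ × ℝ → ℝ := fun α => ∑ t ∈ nzTriples (2 * N), (S₁ t).indicator (1 : ℝ × ℝ → ℝ) α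
  set n₂ : ℝ × ℝ → ℝ := fun α => ∑ t ∈ nzTriples (2 * N), (S₂ t).indicator (1 : ℝ × ℝ → ℝ) α
  have i₁ : (∫ α in box R, n₁ α ^ 2) ≤
      R * (C * ((2 * N : ℕ) : ℝ) ^ ε * ((2 * N : ℕ) : ℝ) ^ 2 * δ) := by
    refine le_trans (le_of_eq (integral_sq_sum_indicator R _ m₁ b₁)) (le_trans ?_
      (mul_le_mul_of_nonneg_left h (by linarith)))
    simp only [Finset.mul_sum]
    gcongr with t _ t' _
    simp only [S₁, Set.prod_inter_prod, Set.inter_self]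
    rw [Measure.volume_eq_prod, measureReal_prod_prod, mul_comm]
    exact mul_le_mul_of_nonneg_right hI measureReal_nonneg
  have i₂ : (∫ α in box R, n₂ α ^ 2) ≤
      R * (C * ((2 * N : ℕ) : ℝ) ^ ε * ((2 * N : ℕ) : ℝ) ^ 2 * δ) := by
    refine le_trans (le_of_eq (integral_sq_sum_indicator R _ m₂ b₂)) (le_trans ?_
      (mul_le_mul_of_nonneg_left h (by linarith)))
    simp only [Finset.mul_sum]
    gcongr with t _ t' _
    simp only [S₂, Set.prod_inter_prod, Set.inter_self]
    rw [Measure.volume_eq_prod, measureReal_prod_prod]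
    exact mul_le_mul_of_nonneg_right hI measureReal_nonneg
  have hmeas : ∀ S : ℤ × (ℤ × ℤ) → Set (ℝ × ℝ), (∀ t, MeasurableSet (S t)) →
      Integrable (fun α => (∑ t ∈ nzTriples (2 * N), (S t).indicator (1 : ℝ × ℝ → ℝ) α) ^ 2)
        (volume.restrict (box R)) := by
    intro S hS
    have : IsFiniteMeasure (volume.restrict (box R)) := ⟨by simpa using volume_box_lt_top R⟩
    refine Integrable.of_bound (C := ((nzTriples (2 * N)).card : ℝ) ^ 2) ?_ ?_
    · exact ((Finset.measurable_fun_sum _ fun t _ =>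
        (measurable_one.indicator (hS t))).pow_const 2).aestronglyMeasurable
    · refine ae_of_all _ fun α => ?_
      rw [sum_indicator_eq_card, Real.norm_eq_abs, abs_of_nonneg (by positivity)]
      gcongr
      exact Finset.filter_subset _ _
  calc (∫ α in box R, (∑ p ∈ badPts N, (pointCell R δ p).indicator (1 : ℝ × ℝ → ℝ) α) ^ 2)
      ≤ ∫ α in box R, (8 * n₁ α ^ 2 + 8 * n₂ α ^ 2) := by
        refine integral_mono_of_nonneg (ae_of_all _ fun α => sq_nonneg _)
          (((hmeas S₁ m₁).const_mul 8).add ((hmeas S₂ m₂).const_mul 8)) ?_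
        refine (ae_restrict_mem (measurableSet_box R)).mono fun α hα => ?_
        have h0 : 0 ≤ ∑ p ∈ badPts N, (pointCell R δ p).indicator (1 : ℝ × ℝ → ℝ) α :=
          Finset.sum_nonneg fun p _ => Set.indicator_nonneg (fun _ _ => zero_le_one) _
        have hle := sum_bad_le N hα hδ1
        have hb := mem_box.mp hα
        have e₁ : ∑ t ∈ nzTriples (2 * N), (slot R δ t).indicator (1 : ℝ → ℝ) α.1 = n₁ α := by
          refine Finset.sum_congr rfl fun t _ => ?_
          have : α.2 ∈ I := hb.2
          simp [Set.indicator_apply, S₁, this]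
        have e₂ : ∑ t ∈ nzTriples (2 * N), (slot R δ t).indicator (1 : ℝ → ℝ) α.2 = n₂ α := by
          refine Finset.sum_congr rfl fun t _ => ?_
          have : α.1 ∈ I := hb.1
          simp [Set.indicator_apply, S₂, this]
        rw [e₁, e₂] at hle
        nlinarith [sq_nonneg (n₁ α - n₂ α)]
    _ = 8 * (∫ α in box R, n₁ α ^ 2) + 8 * ∫ α in box R, n₂ α ^ 2 := by
        rw [integral_add ((hmeas S₁ m₁).const_mul 8) ((hmeas S₂ m₂).const_mul 8),
          integral_const_mul, integral_const_mul]
    _ ≤ 8 * (R * (C * ((2 * N : ℕ) : ℝ) ^ ε * ((2 * N : ℕ) : ℝ) ^ 2 * δ)) +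
        8 * (R * (C * ((2 * N : ℕ) : ℝ) ^ ε * ((2 * N : ℕ) : ℝ) ^ 2 * δ)) := by gcongr
    _ = _ := by
        rw [Nat.cast_mul, Nat.cast_ofNat, Real.mul_rpow zero_le_two (by positivity)]
        ring

/-- The unit cube with corner `p`. -/
def cubeAt (p : (ℤ × ℤ) × (ℤ × ℤ)) : Set ((ℝ × ℝ) × (ℝ × ℝ)) :=
  (Set.Ico (p.1.1 : ℝ) (p.1.1 + 1) ×ˢ Set.Ico (p.1.2 : ℝ) (p.1.2 + 1)) ×ˢ
    (Set.Ico (p.2.1 : ℝ) (p.2.1 + 1) ×ˢ Set.Ico (p.2.2 : ℝ) (p.2.2 + 1))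

theorem measurableSet_cubeAt (p : (ℤ × ℤ) × (ℤ × ℤ)) : MeasurableSet (cubeAt p) :=
  (measurableSet_Ico.prod measurableSet_Ico).prod (measurableSet_Ico.prod measurableSet_Ico)

theorem volume_cubeAt (p : (ℤ × ℤ) × (ℤ × ℤ)) : volume (cubeAt p) = 1 := by
  simp [cubeAt, Measure.volume_eq_prod, Measure.prod_prod]

/-- The integer point of the cube containing a real point. -/
noncomputable def floorPt (x : (ℝ × ℝ) × (ℝ × ℝ)) : (ℤ × ℤ) × (ℤ × ℤ) :=
  ((⌊x.1.1⌋, ⌊x.1.2⌋), (⌊x.2.1⌋, ⌊x.2.2⌋))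

theorem mem_cubeAt_iff {p : (ℤ × ℤ) × (ℤ × ℤ)} {x : (ℝ × ℝ) × (ℝ × ℝ)} :
    x ∈ cubeAt p ↔ floorPt x = p := by
  simp only [cubeAt, floorPt, Set.mem_prod, Set.mem_Ico, Prod.ext_iff, Int.floor_eq_iff]

theorem pairwise_disjoint_cubeAt : Pairwise (Function.onFun Disjoint cubeAt) := by
  intro p p' h
  refine Set.disjoint_left.mpr fun x hx hx' => h ?_
  rw [← mem_cubeAt_iff.mp hx, mem_cubeAt_iff.mp hx']

theorem norm_sub_pt_le {p : (ℤ × ℤ) × (ℤ × ℤ)} {x : (ℝ × ℝ) × (ℝ × ℝ)} (hx : x ∈ cubeAt p) :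
    ‖x - pt p‖ ≤ 1 := by
  simp only [cubeAt, Set.mem_prod, Set.mem_Ico] at hx
  rw [norm_pair_le_iff]
  simp only [pt, Prod.fst_sub, Prod.snd_sub, abs_le]
  refine ⟨⟨⟨?_, ?_⟩, ?_, ?_⟩, ⟨?_, ?_⟩, ?_, ?_⟩ <;> linarith [hx.1.1.1, hx.1.1.2, hx.1.2.1,
    hx.1.2.2, hx.2.1.1, hx.2.1.2, hx.2.2.1, hx.2.2.2]

theorem abs_prod_four_sub_le {A η a₁ a₂ a₃ a₄ b₁ b₂ b₃ b₄ : ℝ} (ha₂ : |a₂| ≤ A)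
    (ha₃ : |a₃| ≤ A) (ha₄ : |a₄| ≤ A) (hb₁ : |b₁| ≤ A) (hb₂ : |b₂| ≤ A) (hb₃ : |b₃| ≤ A)
    (h₁ : |a₁ - b₁| ≤ η) (h₂ : |a₂ - b₂| ≤ η) (h₃ : |a₃ - b₃| ≤ η) (h₄ : |a₄ - b₄| ≤ η) :
    |a₁ * a₂ * (a₃ * a₄) - b₁ * b₂ * (b₃ * b₄)| ≤ 4 * A ^ 3 * η := by
  have e : a₁ * a₂ * (a₃ * a₄) - b₁ * b₂ * (b₃ * b₄) =
      (a₁ - b₁) * (a₂ * a₃ * a₄) + (a₂ - b₂) * (b₁ * a₃ * a₄) + (a₃ - b₃) * (b₁ * b₂ * a₄) +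
        (a₄ - b₄) * (b₁ * b₂ * b₃) := by ring
  have hη : 0 ≤ η := (abs_nonneg _).trans h₁
  have t : ∀ d x y z : ℝ, |d| ≤ η → |x| ≤ A → |y| ≤ A → |z| ≤ A →
      |d * (x * y * z)| ≤ A ^ 3 * η := by
    intro d x y z hd hx hy hz
    have hA : 0 ≤ A := (abs_nonneg _).trans hx
    rw [abs_mul, abs_mul, abs_mul]
    calc |d| * (|x| * |y| * |z|) ≤ η * (A * A * A) := by gcongr
      _ = _ := by ring
  rw [e]
  have t1 := t _ _ _ _ h₁ ha₂ ha₃ ha₄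
  have t2 := t _ _ _ _ h₂ hb₁ ha₃ ha₄
  have t3 := t _ _ _ _ h₃ hb₁ hb₂ ha₄
  have t4 := t _ _ _ _ h₄ hb₁ hb₂ hb₃
  refine (abs_add_le _ _).trans ?_
  refine (add_le_add_left ((abs_add_le _ _).trans (add_le_add_left (abs_add_le _ _) _)) _).trans ?_
  linarith

/-- The determinant of the linear parts in `α` of `lag α x` and `lag α x'`. -/
def detOf (x x' : (ℝ × ℝ) × (ℝ × ℝ)) : ℝ :=
  pairDet (x.1 - x.2) (x.1 + x.2) (x'.1 - x'.2) (x'.1 + x'.2)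

theorem degenerate_iff {E : ℝ} {p p' : (ℤ × ℤ) × (ℤ × ℤ)} :
    degenerate E p p' ↔ |detOf (pt p) (pt p')| ≤ E := by
  unfold degenerate detOf
  rw [gI_quad, hI_quad, gI_quad, hI_quad]

theorem degenerate_symm {E : ℝ} {p p' : (ℤ × ℤ) × (ℤ × ℤ)} (h : degenerate E p p') :
    degenerate E p' p := by
  unfold degenerate at *
  rw [← abs_neg]
  convert h using 2
  simp only [pairDet]
  ring

theorem abs_detOf_sub_le {Q η : ℝ} {x x' z z' : (ℝ × ℝ) × (ℝ × ℝ)} (hx : ‖x‖ ≤ Q) (hx' : ‖x'‖ ≤ Q)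
    (hz : ‖z‖ ≤ Q) (hz' : ‖z'‖ ≤ Q) (h : ‖x - z‖ ≤ η) (h' : ‖x' - z'‖ ≤ η) :
    |detOf x x' - detOf z z'| ≤ 128 * Q ^ 3 * η := by
  have e : detOf x x' - detOf z z' =
      ((x.1 - x.2).1 * (x.1 + x.2).1 * ((x'.1 - x'.2).2 * (x'.1 + x'.2).2) -
        (z.1 - z.2).1 * (z.1 + z.2).1 * ((z'.1 - z'.2).2 * (z'.1 + z'.2).2)) -
      ((x.1 - x.2).2 * (x.1 + x.2).2 * ((x'.1 - x'.2).1 * (x'.1 + x'.2).1) -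
        (z.1 - z.2).2 * (z.1 + z.2).2 * ((z'.1 - z'.2).1 * (z'.1 + z'.2).1)) := by
    simp only [detOf, pairDet]
    ring
  have b1 := abs_sub_add_le_of_norm_le hx
  have b2 := abs_sub_add_le_of_norm_le hx'
  have b3 := abs_sub_add_le_of_norm_le hz
  have b4 := abs_sub_add_le_of_norm_le hz'
  have d1 := abs_sub_add_le_of_norm_le h
  have d2 := abs_sub_add_le_of_norm_le h'
  have key : ∀ y w : (ℝ × ℝ) × (ℝ × ℝ),
      ((y - w).1 - (y - w).2).1 = (y.1 - y.2).1 - (w.1 - w.2).1 ∧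
      ((y - w).1 - (y - w).2).2 = (y.1 - y.2).2 - (w.1 - w.2).2 ∧
      ((y - w).1 + (y - w).2).1 = (y.1 + y.2).1 - (w.1 + w.2).1 ∧
      ((y - w).1 + (y - w).2).2 = (y.1 + y.2).2 - (w.1 + w.2).2 := by
    intro y w
    simp only [Prod.fst_sub, Prod.snd_sub, Prod.fst_add, Prod.snd_add]
    refine ⟨?_, ?_, ?_, ?_⟩ <;> ring
  obtain ⟨k1, k2, k3, k4⟩ := key x z
  obtain ⟨k1', k2', k3', k4'⟩ := key x' z'
  rw [k1, k2, k3, k4] at d1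
  rw [k1', k2', k3', k4'] at d2
  rw [e]
  refine (abs_sub _ _).trans ?_
  have t1 := abs_prod_four_sub_le b1.2.1 b2.1.2 b2.2.2 b3.1.1 b3.2.1 b4.1.2 d1.1.1 d1.2.1
    d2.1.2 d2.2.2
  have t2 := abs_prod_four_sub_le b1.2.2 b2.1.1 b2.2.1 b3.1.2 b3.2.2 b4.1.1 d1.1.2 d1.2.2
    d2.1.1 d2.2.1
  calc _ ≤ 4 * (2 * Q) ^ 3 * (2 * η) + 4 * (2 * Q) ^ 3 * (2 * η) := add_le_add t1 t2
    _ = _ := by ring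

theorem mem_largePts {N : ℕ} {l : ℝ} {p : (ℤ × ℤ) × (ℤ × ℤ)} (h : p ∈ largePts N l) :
    ‖pt p‖ ≤ N ∧ inAnnulus l (2 * N) ((pt p).1 - (pt p).2) ∧
      inAnnulus l (2 * N) ((pt p).1 + (pt p).2) := by
  obtain ⟨h1, h2⟩ := Finset.mem_filter.mp h
  have h3 := mem_latticeBox_iff_norm.mp (Finset.mem_filter.mp h1).1
  have h4 := abs_sub_add_le_of_norm_le h3
  rw [← gI_quad, ← hI_quad] at h4 ⊢
  exact ⟨h3, ⟨⟨h2.1.1, h4.1.1⟩, h2.2.1, h4.1.2⟩, ⟨h2.1.2, h4.2.1⟩, h2.2.2, h4.2.2⟩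

theorem near_largePts {N : ℕ} (hN : 1 ≤ N) {l : ℝ} (hl : 4 ≤ l) {p : (ℤ × ℤ) × (ℤ × ℤ)}
    (hp : p ∈ largePts N l) {x : (ℝ × ℝ) × (ℝ × ℝ)} (hx : ‖x - pt p‖ ≤ 1) :
    ‖x‖ ≤ 2 * N ∧ inAnnulus (l / 2) (2 * (2 * N)) (x.1 - x.2) ∧
      inAnnulus (l / 2) (2 * (2 * N)) (x.1 + x.2) := by
  obtain ⟨h1, h2, h3⟩ := mem_largePts hp
  have hN1 : (1 : ℝ) ≤ N := by exact_mod_cast hN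
  have hn : ‖x‖ ≤ 2 * N := by
    calc ‖x‖ = ‖(x - pt p) + pt p‖ := by rw [sub_add_cancel]
      _ ≤ _ := norm_add_le _ _
      _ ≤ 2 * N := by linarith
  obtain ⟨⟨b1, b2⟩, b3, b4⟩ := abs_sub_add_le_of_norm_le hn
  obtain ⟨⟨d1, d2⟩, d3, d4⟩ := abs_sub_add_le_of_norm_le hx
  have low : ∀ a b : ℝ, l ≤ |a| → |b - a| ≤ 2 * 1 → l / 2 ≤ |b| := by
    intro a b ha hb
    have := abs_sub_abs_le_abs_sub a b
    rw [abs_sub_comm] at this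
    linarith
  refine ⟨hn, ⟨⟨low _ _ h2.1.1 ?_, b1⟩, low _ _ h2.2.1 ?_, b2⟩,
    ⟨low _ _ h3.1.1 ?_, b3⟩, low _ _ h3.2.1 ?_, b4⟩
  · convert d1 using 2
    simp only [Prod.fst_sub, Prod.snd_sub]; ring
  · convert d2 using 2
    simp only [Prod.fst_sub, Prod.snd_sub]; ring
  · convert d3 using 2
    simp only [Prod.fst_sub, Prod.snd_sub, Prod.fst_add]; ring
  · convert d4 using 2
    simp only [Prod.fst_sub, Prod.snd_sub, Prod.snd_add]; ring

/-- The measure of the part of a unit cube on which `lag` is small. -/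
noncomputable def cubeMass (δ : ℝ) (α : ℝ × ℝ) (p : (ℤ × ℤ) × (ℤ × ℤ)) : ℝ :=
  volume.real (cubeAt p ∩ {x | |lag α x| ≤ δ})

theorem measurableSet_lag_le (δ : ℝ) (α : ℝ × ℝ) : MeasurableSet {x | |lag α x| ≤ δ} :=
  measurableSet_le ((continuous_lag.comp (Continuous.prodMk_right α)).abs.measurable)
    measurable_const

theorem sum_cubeMass_le {δ b : ℝ} {α : ℝ × ℝ} {s : Finset ((ℤ × ℤ) × (ℤ × ℤ))}
    {S : Set ((ℝ × ℝ) × (ℝ × ℝ))} (hb : 0 ≤ b) (hS : volume S ≤ ENNReal.ofReal b)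
    (h : ∀ p ∈ s, ∀ x ∈ cubeAt p, |lag α x| ≤ δ → x ∈ S) :
    ∑ p ∈ s, cubeMass δ α p ≤ b := by
  unfold cubeMass
  have hf : ∀ p ∈ s, volume (cubeAt p ∩ {x | |lag α x| ≤ δ}) ≠ ⊤ := fun p _ =>
    ((measure_mono Set.inter_subset_left).trans_lt (by simp [volume_cubeAt])).ne
  rw [← measureReal_biUnion_finset (h := hf)]
  · refine ENNReal.toReal_le_of_le_ofReal hb ((measure_mono ?_).trans hS)
    refine Set.iUnion₂_subset fun p hp x hx => h p hp x hx.1 hx.2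
  · intro p _ p' _ hpp
    exact (pairwise_disjoint_cubeAt hpp).mono Set.inter_subset_left Set.inter_subset_left
  · exact fun p _ => (measurableSet_cubeAt p).inter (measurableSet_lag_le δ α)

theorem sum_cubeMass_large_le {R δ l : ℝ} {N : ℕ} {α : ℝ × ℝ} (hα : α ∈ box R) (hδ : 0 ≤ δ)
    (hN : 1 ≤ N) (hl : 4 ≤ l) :
    ∑ p ∈ largePts N l, cubeMass δ α p ≤ 4096 * (N : ℝ) ^ 3 * δ / l := by
  have hl0 : 0 < l := by linarith
  refine sum_cubeMass_le (by positivity) ((volume_thickSet_le (P := 2 * N) (l := l / 2) hα hδ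
    (by positivity) (by positivity)).trans (le_of_eq ?_)) fun p hp x hx hL => ?_
  · congr 1
    field_simp
    ring
  · have := near_largePts hN hl hp (norm_sub_pt_le hx)
    exact ⟨this.1, hL, this.2⟩

theorem sum_cubeMass_degenerate_le {R δ l E Y : ℝ} {N : ℕ} {α : ℝ × ℝ} (hR : 1 ≤ R)
    (hα : α ∈ box R) (hδ : 0 ≤ δ) (hδ1 : δ ≤ 1) (hN : 1 ≤ N) (hl : 4 ≤ l) (hY0 : 0 ≤ Y)
    (hY : 144 * R ^ 3 * ((4 * N : ℝ) ^ 3 * (E + 1024 * (N : ℝ) ^ 3) + (4 * N : ℝ) ^ 5 * δ) /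
      (l / 2) ^ 5 ≤ Y)
    {p' : (ℤ × ℤ) × (ℤ × ℤ)} (hp' : p' ∈ largePts N l) {x' : (ℝ × ℝ) × (ℝ × ℝ)}
    (hx' : ‖x' - pt p'‖ ≤ 1) (hL' : |lag α x'| ≤ δ) :
    ∑ p ∈ (largePts N l).filter (fun p => degenerate E p p'), cubeMass δ α p ≤
      4096 * (N : ℝ) ^ 2 * δ * Y / l ^ 2 := by
  have hl0 : 0 < l := by linarith
  have hN1 : (1 : ℝ) ≤ N := by exact_mod_cast hN
  obtain ⟨n', a', b'⟩ := near_largePts hN hl hp' hx'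
  rw [lag_eq_bf] at hL'
  have hY' : 144 * R ^ 3 * ((2 * (2 * N) : ℝ) ^ 3 * (E + 1024 * (N : ℝ) ^ 3) +
      (2 * (2 * N) : ℝ) ^ 5 * δ) / (l / 2) ^ 5 ≤ Y := by
    rw [show (2 * (2 * N) : ℝ) = 4 * N by ring]
    exact hY
  refine sum_cubeMass_le (by positivity) ((volume_thickSet_det_le (P := 2 * N) (l := l / 2)
    (E := E + 1024 * (N : ℝ) ^ 3) hR hα
    (by linarith) hδ hδ1 (by positivity) a' b' hL' hY').trans (le_of_eq ?_)) fun p hp x hx hL => ?_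
  · congr 1
    field_simp
    ring
  · obtain ⟨hp1, hp2⟩ := Finset.mem_filter.mp hp
    have hxp := norm_sub_pt_le hx
    obtain ⟨n, a, b⟩ := near_largePts hN hl hp1 hxp
    refine ⟨⟨n, hL, a, b⟩, ?_⟩
    have hd := abs_detOf_sub_le n n' ((mem_largePts hp1).1.trans (by linarith))
      ((mem_largePts hp').1.trans (by linarith)) hxp hx'
    rw [degenerate_iff] at hp2
    have := abs_sub_abs_le_abs_sub (detOf x x') (detOf (pt p) (pt p'))
    change |detOf x x'| ≤ _
    calc |detOf x x'| ≤ E + 128 * (2 * (N : ℝ)) ^ 3 * 1 := by linarith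
      _ = _ := by ring

/-- Size of the contribution of the point `p` to the discrepancy between sum and integral. -/
noncomputable def pointMass (R δ : ℝ) (α : ℝ × ℝ) (p : (ℤ × ℤ) × (ℤ × ℤ)) : ℝ :=
  (pointCell R δ p).indicator (1 : ℝ × ℝ → ℝ) α + cubeMass δ α p

theorem indicator_pointCell_nonneg (R δ : ℝ) (α : ℝ × ℝ) (p : (ℤ × ℤ) × (ℤ × ℤ)) :
    0 ≤ (pointCell R δ p).indicator (1 : ℝ × ℝ → ℝ) α :=
  Set.indicator_nonneg (fun _ _ => zero_le_one) _

theorem cubeMass_nonneg (δ : ℝ) (α : ℝ × ℝ) (p : (ℤ × ℤ) × (ℤ × ℤ)) : 0 ≤ cubeMass δ α p :=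
  measureReal_nonneg

theorem pointMass_nonneg (R δ : ℝ) (α : ℝ × ℝ) (p : (ℤ × ℤ) × (ℤ × ℤ)) :
    0 ≤ pointMass R δ α p :=
  add_nonneg (indicator_pointCell_nonneg R δ α p) (cubeMass_nonneg δ α p)

theorem sum_sum_pointMass_le {R δ l E Y : ℝ} {N : ℕ} {α : ℝ × ℝ} (hR : 1 ≤ R)
    (hα : α ∈ box R) (hδ : 0 ≤ δ) (hδ1 : δ ≤ 1) (hN : 1 ≤ N) (hl : 4 ≤ l) (hY0 : 0 ≤ Y)
    (hY : 144 * R ^ 3 * ((4 * N : ℝ) ^ 3 * (E + 1024 * (N : ℝ) ^ 3) + (4 * N : ℝ) ^ 5 * δ) /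
      (l / 2) ^ 5 ≤ Y) :
    ∑ p ∈ largePts N l, ∑ p' ∈ largePts N l,
        (if degenerate E p p' then pointMass R δ α p * pointMass R δ α p' else 0) ≤
      ∑ p ∈ largePts N l, ∑ p' ∈ largePts N l,
        (if degenerate E p p' then (pointCell R δ p).indicator (1 : ℝ × ℝ → ℝ) α *
          (pointCell R δ p').indicator (1 : ℝ × ℝ → ℝ) α else 0) +
      (4096 * (N : ℝ) ^ 2 * δ * Y / l ^ 2) *
        (2 * ∑ p ∈ largePts N l, (pointCell R δ p).indicator (1 : ℝ × ℝ → ℝ) α +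
          4096 * (N : ℝ) ^ 3 * δ / l) := by
  set B : ℝ := 4096 * (N : ℝ) ^ 2 * δ * Y / l ^ 2 with hB
  have hB0 : 0 ≤ B := by positivity
  set L := largePts N l
  set f := fun p => (pointCell R δ p).indicator (1 : ℝ × ℝ → ℝ) α with hf
  set c := fun p => cubeMass δ α p with hc
  have hf0 : ∀ p, 0 ≤ f p := fun p => indicator_pointCell_nonneg R δ α p
  have hc0 : ∀ p, 0 ≤ c p := fun p => cubeMass_nonneg δ α p
  have key1 : ∀ p' ∈ L, ∑ p ∈ L, (if degenerate E p p' then c p * f p' else 0) ≤ B * f p' := by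
    intro p' hp'
    by_cases h : α ∈ pointCell R δ p'
    · have h1 : f p' = 1 := by simp [hf, h]
      rw [h1, ← Finset.sum_filter]
      simp only [mul_one]
      exact sum_cubeMass_degenerate_le hR hα hδ hδ1 hN hl hY0 hY hp' (by simp)
        (mem_pointCell.mp h).2
    · have h1 : f p' = 0 := by simp [hf, h]
      simp [h1]
  have key2 : ∀ p' ∈ L, ∑ p ∈ L, (if degenerate E p p' then c p * c p' else 0) ≤ B * c p' := by
    intro p' hp'
    rcases (cubeAt p' ∩ {x | |lag α x| ≤ δ}).eq_empty_or_nonempty with h | ⟨x', hx', hL'⟩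
    · have h1 : c p' = 0 := by simp [hc, cubeMass, h]
      simp [h1]
    · have h2 := sum_cubeMass_degenerate_le hR hα hδ hδ1 hN hl hY0 hY hp' (norm_sub_pt_le hx') hL'
      rw [← Finset.sum_filter, ← Finset.sum_mul]
      exact mul_le_mul_of_nonneg_right h2 (hc0 p')
  have e : ∀ p p', (if degenerate E p p' then pointMass R δ α p * pointMass R δ α p' else 0) =
      (if degenerate E p p' then f p * f p' else 0) +
      ((if degenerate E p p' then c p * f p' else 0) +
      ((if degenerate E p' p then c p' * f p else 0) +
      (if degenerate E p p' then c p * c p' else 0))) := by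
    intro p p'
    by_cases h : degenerate E p p'
    · have h' := degenerate_symm h
      simp only [h, h', if_true, pointMass, hf, hc]
      ring
    · have h' : ¬ degenerate E p' p := fun h' => h (degenerate_symm h')
      simp [h, h']
  simp only [e, Finset.sum_add_distrib]
  have s1 : ∑ p ∈ L, ∑ p' ∈ L, (if degenerate E p p' then c p * f p' else 0) ≤
      B * ∑ p ∈ L, f p := by
    rw [Finset.sum_comm, Finset.mul_sum]
    exact Finset.sum_le_sum key1
  have s1' : ∑ p ∈ L, ∑ p' ∈ L, (if degenerate E p' p then c p' * f p else 0) ≤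
      B * ∑ p ∈ L, f p := by
    rw [Finset.mul_sum]
    exact Finset.sum_le_sum key1
  have s2 : ∑ p ∈ L, ∑ p' ∈ L, (if degenerate E p p' then c p * c p' else 0) ≤
      B * ∑ p ∈ L, c p := by
    rw [Finset.sum_comm, Finset.mul_sum]
    exact Finset.sum_le_sum key2
  have s3 : ∑ p ∈ L, c p ≤ 4096 * (N : ℝ) ^ 3 * δ / l := sum_cubeMass_large_le hα hδ hN hl
  have s4 := mul_le_mul_of_nonneg_left s3 hB0
  have : (fun p => (pointCell R δ p).indicator (1 : ℝ × ℝ → ℝ) α) = f := rfl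
  change _ ≤ ∑ p ∈ L, ∑ p' ∈ L, (if degenerate E p p' then f p * f p' else 0) +
    B * (2 * ∑ p ∈ L, f p + _)
  linarith

theorem measurableSet_pointCell (R δ : ℝ) (p : (ℤ × ℤ) × (ℤ × ℤ)) :
    MeasurableSet (pointCell R δ p) := measurableSet_cell _ _ _ _

theorem integrable_indicator_box (R : ℝ) {s : Set (ℝ × ℝ)} (hs : MeasurableSet s) :
    Integrable (s.indicator (1 : ℝ × ℝ → ℝ)) (volume.restrict (box R)) := by
  refine (integrable_indicator_iff hs).mpr ?_
  refine (integrableOn_const (μ := volume.restrict (box R)) (C := (1 : ℝ)) (s := s) ?_)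
  rw [Measure.restrict_apply hs]
  exact ((measure_mono Set.inter_subset_right).trans_lt (volume_box_lt_top R)).ne

theorem integral_indicator_box_le (R : ℝ) {s : Set (ℝ × ℝ)} (hs : MeasurableSet s)
    (hb : s ⊆ box R) :
    ∫ α in box R, s.indicator (1 : ℝ × ℝ → ℝ) α = volume.real s := by
  rw [integral_indicator hs, Measure.restrict_restrict hs, Set.inter_eq_left.mpr hb]
  simp

theorem card_latticeBox_le {N : ℕ} (hN : 1 ≤ N) : ((latticeBox N).card : ℝ) ≤ 81 * (N : ℝ) ^ 4 := by
  have hN1 : (1 : ℝ) ≤ N := by exact_mod_cast hN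
  have h : (latticeBox N).card = (2 * N + 1) ^ 4 := by
    simp only [latticeBox, Finset.card_product, Int.card_Icc]
    have : ((N : ℤ) + 1 - -(N : ℤ)).toNat = 2 * N + 1 := by omega
    rw [this]; ring
  rw [h]
  push_cast
  calc (2 * (N : ℝ) + 1) ^ 4 ≤ (3 * N) ^ 4 := by gcongr; linarith
    _ = _ := by ring

theorem sum_pointCell_le {R δ l : ℝ} {N : ℕ} (hR : 1 ≤ R) (hδ : 0 ≤ δ) (hN : 1 ≤ N)
    (hl : 0 < l) :
    ∑ p ∈ largePts N l, volume.real (pointCell R δ p) ≤ 324 * R * (N : ℝ) ^ 4 * δ / l ^ 2 := by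
  have h1 : ∀ p ∈ largePts N l, volume.real (pointCell R δ p) ≤ 4 * R * δ / l ^ 2 := by
    intro p hp
    obtain ⟨-, h2, h3⟩ := mem_largePts hp
    rw [← gI_quad] at h2
    rw [← hI_quad] at h3
    have hg := h2.1.1
    have hh := h3.1.1
    have hg0 : (gI (quad p)).1 ≠ 0 := abs_pos.mp (hl.trans_le hg)
    have hh0 : (hI (quad p)).1 ≠ 0 := abs_pos.mp (hl.trans_le hh)
    refine (cell_le_left (by linarith) hδ (mul_ne_zero hg0 hh0)).trans ?_
    rw [abs_mul, sq]
    gcongr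
  have hs : largePts N l ⊆ latticeBox N :=
    (Finset.filter_subset _ _).trans (Finset.filter_subset _ _)
  calc _ ≤ ∑ p ∈ largePts N l, 4 * R * δ / l ^ 2 := Finset.sum_le_sum h1
    _ = ((largePts N l).card : ℝ) * (4 * R * δ / l ^ 2) := by rw [Finset.sum_const, nsmul_eq_mul]
    _ ≤ (81 * (N : ℝ) ^ 4) * (4 * R * δ / l ^ 2) := by
        refine mul_le_mul_of_nonneg_right (le_trans ?_ (card_latticeBox_le hN)) (by positivity)
        exact_mod_cast Finset.card_le_card hs
    _ = _ := by ring

theorem integral_degenerate_le (R ε : ℝ) (hR : 1 ≤ R) (hε : 0 < ε) :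
    ∃ C : ℝ, 0 ≤ C ∧ ∀ N : ℕ, 1 ≤ N → ∀ l δ E Y : ℝ, 4 ≤ l → 0 < δ → δ ≤ 1 → 1 ≤ Y → 0 ≤ E →
      144 * R ^ 3 * ((4 * N : ℝ) ^ 3 * (E + 1024 * (N : ℝ) ^ 3) + (4 * N : ℝ) ^ 5 * δ) /
        (l / 2) ^ 5 ≤ Y →
      ∀ F : ℝ × ℝ → ℝ, (∀ α, 0 ≤ F α) → (∀ α ∈ box R, F α ≤
        ∑ p ∈ largePts N l, ∑ p' ∈ largePts N l,
          (if degenerate E p p' then pointMass R δ α p * pointMass R δ α p' else 0)) →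
      ∫ α in box R, F α ≤
        C * (N : ℝ) ^ ε * ((N : ℝ) ^ 9 * δ ^ 2 / l ^ 7 * Y + (N : ℝ) ^ 2 * δ) +
        C * ((N : ℝ) ^ 2 * δ * Y / l ^ 2 * ((N : ℝ) ^ 4 * δ / l ^ 2 + (N : ℝ) ^ 3 * δ / l)) := by
  obtain ⟨C, hC, H⟩ := sum_degenerate_le R ε hR hε
  set v := volume.real (box R) with hv
  refine ⟨C + 4096 * (648 * R + 4096 * v), by positivity,
    fun N hN l δ E Y hl hδ hδ1 hY hE hYY F hF0 hF => ?_⟩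
  have hN1 : (1 : ℝ) ≤ N := by exact_mod_cast hN
  have hl0 : 0 < l := by linarith
  have hY' : 144 * R ^ 3 * ((2 * N : ℝ) ^ 3 * E + (2 * N : ℝ) ^ 5 * δ) / l ^ 5 ≤ Y := by
    refine le_trans ?_ hYY
    gcongr
    · linarith
    · linarith [pow_pos (by linarith : (0 : ℝ) < N) 3]
    · linarith
    · linarith
  have h1 := H N hN l δ E Y (by linarith) hδ hδ1 hY hY'
  set L := largePts N l with hL
  set B : ℝ := 4096 * (N : ℝ) ^ 2 * δ * Y / l ^ 2 with hB
  have hB0 : 0 ≤ B := by positivity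
  set f := fun p (α : ℝ × ℝ) => (pointCell R δ p).indicator (1 : ℝ × ℝ → ℝ) α with hf
  have hfi : ∀ p, Integrable (f p) (volume.restrict (box R)) := fun p =>
    integrable_indicator_box R (measurableSet_pointCell R δ p)
  have hff : ∀ p p', (fun α => f p α * f p' α) =
      (pointCell R δ p ∩ pointCell R δ p').indicator (1 : ℝ × ℝ → ℝ) := by
    intro p p'
    rw [Set.inter_indicator_one]
    rfl
  set g := fun p p' (α : ℝ × ℝ) => if degenerate E p p' then f p α * f p' α else 0 with hg
  have hgi : ∀ p p', Integrable (g p p') (volume.restrict (box R)) := by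
    intro p p'
    by_cases h : degenerate E p p'
    · simp only [hg, h, if_true]
      rw [hff]
      exact integrable_indicator_box R ((measurableSet_pointCell R δ p).inter
        (measurableSet_pointCell R δ p'))
    · simp [hg, h]
  have hgv : ∀ p p', ∫ α in box R, g p p' α =
      if degenerate E p p' then pairMeas R δ (quad p) (quad p') else 0 := by
    intro p p'
    by_cases h : degenerate E p p'
    · simp only [hg, h, if_true]
      rw [hff, integral_indicator_box_le R ((measurableSet_pointCell R δ p).inter
        (measurableSet_pointCell R δ p')) (Set.inter_subset_left.trans (cell_subset_box _ _ _ _))]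
      rfl
    · simp [hg, h]
  have i1 : Integrable (fun α => ∑ p ∈ L, ∑ p' ∈ L, g p p' α) (volume.restrict (box R)) :=
    integrable_finsetSum _ fun p _ => integrable_finsetSum _ fun p' _ => hgi p p'
  have i2 : Integrable (fun α => ∑ p ∈ L, f p α) (volume.restrict (box R)) :=
    integrable_finsetSum _ fun p _ => hfi p
  have i3 : Integrable (fun _ : ℝ × ℝ => 4096 * (N : ℝ) ^ 3 * δ / l)
      (volume.restrict (box R)) := integrableOn_const (volume_box_lt_top R).ne
  have i4 : Integrable (fun α => 2 * ∑ p ∈ L, f p α + 4096 * (N : ℝ) ^ 3 * δ / l)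
      (volume.restrict (box R)) := (i2.const_mul 2).add i3
  calc ∫ α in box R, F α ≤ ∫ α in box R, (∑ p ∈ L, ∑ p' ∈ L, g p p' α +
        B * (2 * ∑ p ∈ L, f p α + 4096 * (N : ℝ) ^ 3 * δ / l)) := by
        refine integral_mono_of_nonneg (Filter.Eventually.of_forall hF0)
          (i1.add (i4.const_mul B)) ?_
        refine (ae_restrict_mem (measurableSet_box R)).mono fun α hα => ?_
        exact (hF α hα).trans
          (sum_sum_pointMass_le hR hα hδ.le hδ1 hN hl (by linarith) hYY)
    _ = ∑ p ∈ L, ∑ p' ∈ L, (if degenerate E p p' then pairMeas R δ (quad p) (quad p') else 0) +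
        B * (2 * ∑ p ∈ L, volume.real (pointCell R δ p) + v * (4096 * (N : ℝ) ^ 3 * δ / l)) := by
        rw [integral_add i1 (i4.const_mul B), integral_const_mul, integral_add (i2.const_mul 2) i3,
          integral_const_mul, integral_finsetSum _ fun p _ => hfi p,
          integral_finsetSum _ fun p _ => integrable_finsetSum _ fun p' _ => hgi p p']
        congr 1
        · refine Finset.sum_congr rfl fun p _ => ?_
          rw [integral_finsetSum _ fun p' _ => hgi p p']
          exact Finset.sum_congr rfl fun p' _ => hgv p p'
        · congr 2
          · congr 1
            exact Finset.sum_congr rfl fun p _ => integral_indicator_box_le R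
              (measurableSet_pointCell R δ p) (cell_subset_box _ _ _ _)
          · simp [hv]
    _ ≤ C * (N : ℝ) ^ ε * ((N : ℝ) ^ 9 * δ ^ 2 / l ^ 7 * Y + (N : ℝ) ^ 2 * δ) +
        B * (2 * (324 * R * (N : ℝ) ^ 4 * δ / l ^ 2) + v * (4096 * (N : ℝ) ^ 3 * δ / l)) := by
        gcongr
        exact sum_pointCell_le hR hδ.le hN hl0
    _ ≤ _ := by
        have hv0 : 0 ≤ v := measureReal_nonneg
        set a := (N : ℝ) ^ 4 * δ / l ^ 2 with ha
        set b := (N : ℝ) ^ 3 * δ / l with hb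
        set d := (N : ℝ) ^ 2 * δ * Y / l ^ 2 with hd
        have ha0 : 0 ≤ a := by positivity
        have hb0 : 0 ≤ b := by positivity
        have hd0 : 0 ≤ d := by positivity
        have e1 : B * (2 * (324 * R * (N : ℝ) ^ 4 * δ / l ^ 2) +
            v * (4096 * (N : ℝ) ^ 3 * δ / l)) = 4096 * (d * (648 * R * a + 4096 * v * b)) := by
          rw [hB, ha, hb, hd]; ring
        rw [e1]
        have hX : 0 ≤ (N : ℝ) ^ ε * ((N : ℝ) ^ 9 * δ ^ 2 / l ^ 7 * Y + (N : ℝ) ^ 2 * δ) := by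
          positivity
        refine add_le_add ?_ ?_
        · rw [mul_assoc, mul_assoc]
          refine mul_le_mul_of_nonneg_right ?_ hX
          linarith [mul_nonneg (by norm_num : (0 : ℝ) ≤ 4096)
            (by positivity : 0 ≤ 648 * R + 4096 * v)]
        · have : 648 * R * a + 4096 * v * b ≤ (648 * R + 4096 * v) * (a + b) := by
            nlinarith [mul_nonneg (by linarith : 0 ≤ R) hb0, mul_nonneg hv0 ha0]
          calc _ ≤ 4096 * (d * ((648 * R + 4096 * v) * (a + b))) := by gcongr
            _ = (4096 * (648 * R + 4096 * v)) * (d * (a + b)) := by ring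
            _ ≤ _ := by
              refine mul_le_mul_of_nonneg_right ?_ (by positivity)
              linarith

/-- A bounded Lipschitz function supported in `[-r, r]`, with explicit constants. -/
structure IsProfile (b r : ℝ) (f : ℝ → ℝ) : Prop where
  bound : ∀ t, |f t| ≤ b
  lipschitz : ∀ s t, |f s - f t| ≤ b * |s - t|
  eq_zero : ∀ t, r < |t| → f t = 0

theorem IsProfile.mono {b b' r r' : ℝ} {f : ℝ → ℝ} (h : IsProfile b r f) (hb : b ≤ b')
    (hr : r ≤ r') : IsProfile b' r' f :=
  ⟨fun t => (h.bound t).trans hb, fun s t => (h.lipschitz s t).trans (by gcongr),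
    fun t ht => h.eq_zero t (hr.trans_lt ht)⟩

theorem IsProfile.continuous {b r : ℝ} {f : ℝ → ℝ} (h : IsProfile b r f) : Continuous f := by
  have hb : 0 ≤ b := (abs_nonneg _).trans (h.bound 0)
  refine (LipschitzWith.of_dist_le_mul (K := ⟨b, hb⟩) fun s t => ?_).continuous
  rw [Real.dist_eq, Real.dist_eq]
  exact h.lipschitz s t

theorem IsProfile.abs_le {b r t : ℝ} {f : ℝ → ℝ} (h : IsProfile b r f) (ht : f t ≠ 0) : |t| ≤ r :=
  not_lt.mp fun h' => ht (h.eq_zero t h')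

theorem exists_isProfile {f : ℝ → ℝ} (hf : ContDiff ℝ (⊤ : ℕ∞) f) (hs : HasCompactSupport f) :
    ∃ b r : ℝ, IsProfile b r f := by
  obtain ⟨b₁, h₁⟩ := hf.continuous.bounded_above_of_compact_support hs
  obtain ⟨b₂, h₂⟩ := hf.lipschitzWith_of_hasCompactSupport hs (by simp)
  obtain ⟨r, h₃⟩ := hs.isCompact.isBounded.subset_closedBall 0
  refine ⟨max b₁ b₂, r, fun t => (h₁ t).trans (le_max_left _ _), fun s t => ?_, fun t ht => ?_⟩
  · have := h₂.dist_le_mul s t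
    rw [Real.dist_eq, Real.dist_eq] at this
    exact this.trans (mul_le_mul_of_nonneg_right (le_max_right _ _) (abs_nonneg _))
  · by_contra h
    have := h₃ (subset_tsupport f h)
    rw [mem_closedBall_zero_iff, Real.norm_eq_abs] at this
    linarith

theorem one_le_four_mul_sub {R : ℝ} {α : ℝ × ℝ} (hα : α ∈ box R) : 5 / 4 ≤ 4 * α.1 * α.2 - 1 := by
  rw [mem_box] at hα
  nlinarith

theorem le_Dfun {R : ℝ} {α : ℝ × ℝ} (hα : α ∈ box R) : 3 / 10 ≤ Dfun α := by
  have h := one_le_four_mul_sub hα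
  unfold Dfun
  rw [le_div_iff₀ Real.pi_pos]
  refine Real.le_sqrt_of_sq_le ?_
  have : Real.pi < 3.15 := Real.pi_lt_d2
  nlinarith [Real.pi_pos]

theorem Dfun_pos {R : ℝ} {α : ℝ × ℝ} (hα : α ∈ box R) : 0 < Dfun α := by
  linarith [le_Dfun hα]

theorem Dfun_le {R : ℝ} {α : ℝ × ℝ} (hα : α ∈ box R) : Dfun α ≤ R := by
  have h := one_le_four_mul_sub hα
  rw [mem_box] at hα
  have hR : 0 < R := by linarith
  unfold Dfun
  rw [div_le_iff₀ Real.pi_pos]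
  have h1 : R * 3 ≤ R * Real.pi := by gcongr; exact Real.pi_gt_three.le
  refine (Real.sqrt_le_left (by positivity)).mpr ?_
  have : α.1 * α.2 ≤ R * R := by gcongr <;> linarith
  nlinarith

theorem continuous_Dfun : Continuous Dfun := by
  unfold Dfun
  fun_prop

/-- The summand of `Gsum` at a real point. -/
noncomputable def amp (V W : ℝ → ℝ) (M T : ℝ) (α : ℝ × ℝ) (x : (ℝ × ℝ) × (ℝ × ℝ)) : ℝ :=
  W (T * lag α x / Dfun α) * V (qr α x.1 / (M ^ 2 * Dfun α))

section amp

variable {V W : ℝ → ℝ} {b r M T R : ℝ} {α : ℝ × ℝ} {x : (ℝ × ℝ) × (ℝ × ℝ)}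

theorem abs_amp_le (hV : IsProfile b r V) (hW : IsProfile b r W) : |amp V W M T α x| ≤ b ^ 2 := by
  have hb : 0 ≤ b := (abs_nonneg _).trans (hW.bound 0)
  rw [amp, abs_mul, sq b]
  exact mul_le_mul (hW.bound _) (hV.bound _) (abs_nonneg _) hb

theorem measurable_amp (hV : IsProfile b r V) (hW : IsProfile b r W) :
    Measurable fun z : (ℝ × ℝ) × ((ℝ × ℝ) × (ℝ × ℝ)) => amp V W M T z.1 z.2 := by
  have hD : Measurable fun z : (ℝ × ℝ) × ((ℝ × ℝ) × (ℝ × ℝ)) => Dfun z.1 :=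
    (continuous_Dfun.comp continuous_fst).measurable
  have hL := continuous_lag.measurable
  have hQ : Measurable fun z : (ℝ × ℝ) × ((ℝ × ℝ) × (ℝ × ℝ)) => qr z.1 z.2.1 := by
    unfold qr
    exact Continuous.measurable (by fun_prop)
  exact (hW.continuous.measurable.comp ((hL.const_mul T).div hD)).mul
    (hV.continuous.measurable.comp (hQ.div (hD.const_mul (M ^ 2))))

theorem abs_lag_le_of_amp_ne_zero (hW : IsProfile b r W) (hT : 0 < T) (hα : α ∈ box R)
    (h : amp V W M T α x ≠ 0) : |lag α x| ≤ r * R / T := by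
  have h1 := hW.abs_le (left_ne_zero_of_mul h)
  have hD := Dfun_pos hα
  rw [abs_div, abs_mul, abs_of_pos hD, abs_of_pos hT, div_le_iff₀ hD] at h1
  rw [le_div_iff₀ hT, mul_comm]
  have hr : 0 ≤ r := by
    by_contra hr
    have := mul_nonneg hT.le (abs_nonneg (lag α x))
    nlinarith
  exact h1.trans (mul_le_mul_of_nonneg_left (Dfun_le hα) hr)

theorem norm_le_of_amp_ne_zero (hV : IsProfile b r V) (hW : IsProfile b r W) (hr : 1 ≤ r)
    (hR : 1 ≤ R) (hM : 1 ≤ M) (hT : 1 ≤ T) (hα : α ∈ box R) (h : amp V W M T α x ≠ 0) :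
    ‖x‖ ≤ 8 * r * R * M := by
  have h0 := abs_lag_le_of_amp_ne_zero hW (by linarith) hα h
  have h1 := hV.abs_le (right_ne_zero_of_mul h)
  have hD := Dfun_pos hα
  have hD' := Dfun_le hα
  have hp : 0 < M ^ 2 * Dfun α := by positivity
  have hM2 : 1 ≤ M ^ 2 := one_le_pow₀ hM
  have q1 : qr α x.1 ≤ r * R * M ^ 2 := by
    have := (le_abs_self _).trans h1
    rw [div_le_iff₀ hp] at this
    calc _ ≤ r * (M ^ 2 * Dfun α) := this
      _ ≤ r * (M ^ 2 * R) := by gcongr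
      _ = _ := by ring
  have q2 : qr α x.2 ≤ 2 * (r * R * M ^ 2) := by
    have e : r * R / T ≤ r * R * M ^ 2 := by
      calc r * R / T ≤ r * R := div_le_self (by positivity) hT
        _ ≤ r * R * M ^ 2 := le_mul_of_one_le_right (by positivity) hM2
    have := (neg_le_abs (lag α x)).trans h0
    unfold lag at this
    linarith
  have hrR : 1 ≤ r * R := one_le_mul_of_one_le_of_one_le hr hR
  have key : ∀ v : ℝ × ℝ, qr α v ≤ 2 * (r * R * M ^ 2) →
      |v.1| ≤ 8 * r * R * M ∧ |v.2| ≤ 8 * r * R * M := by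
    intro v hv
    have h2 := le_qr hα v
    have h3 : 8 * (r * R * M ^ 2) ≤ (8 * r * R * M) ^ 2 := by
      have : (8 * r * R * M) ^ 2 = 64 * (r * R) * (r * R * M ^ 2) := by ring
      rw [this]
      have : 0 ≤ r * R * M ^ 2 := by positivity
      nlinarith
    constructor <;> refine abs_le_of_sq_le_sq ?_ (by positivity) <;>
      nlinarith [sq_nonneg v.1, sq_nonneg v.2]
  rw [norm_pair_le_iff]
  have : 0 ≤ r * R * M ^ 2 := by positivity
  exact ⟨key _ (by linarith), key _ q2⟩

theorem integrable_amp (hV : IsProfile b r V) (hW : IsProfile b r W) (hr : 1 ≤ r)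
    (hR : 1 ≤ R) (hM : 1 ≤ M) (hT : 1 ≤ T) (hα : α ∈ box R) : Integrable (amp V W M T α) := by
  have hm : Measurable (amp V W M T α) := (measurable_amp hV hW).comp measurable_prodMk_left
  rw [← integrableOn_iff_integrable_of_support_subset
    (s := Metric.closedBall (0 : (ℝ × ℝ) × (ℝ × ℝ)) (8 * r * R * M))]
  · have : IsFiniteMeasure (volume.restrict
        (Metric.closedBall (0 : (ℝ × ℝ) × (ℝ × ℝ)) (8 * r * R * M))) :=
      ⟨by simpa using (isCompact_closedBall _ _).measure_lt_top⟩
    exact Integrable.of_bound (hf := hm.aestronglyMeasurable) (b ^ 2)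
      (Filter.Eventually.of_forall fun x => abs_amp_le hV hW)
  · intro x hx
    rw [mem_closedBall_zero_iff]
    exact norm_le_of_amp_ne_zero hV hW hr hR hM hT hα hx

end amp

theorem integral_comp_add_sq (f : ℝ → ℝ) :
    ∫ x : ℝ × ℝ, f (x.1 ^ 2 + x.2 ^ 2) = Real.pi * ∫ s in Set.Ioi (0 : ℝ), f s := by
  rw [← integral_comp_polarCoord_symm]
  have h1 : ∀ p : ℝ × ℝ, p.1 • f ((polarCoord.symm p).1 ^ 2 + (polarCoord.symm p).2 ^ 2) =
      p.1 * f (p.1 ^ 2) * 1 := by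
    intro p
    rw [polarCoord_symm_apply, smul_eq_mul, mul_one]
    congr 2
    simp only
    linear_combination p.1 ^ 2 * Real.cos_sq_add_sin_sq p.2
  simp only [h1]
  rw [polarCoord_target, Measure.volume_eq_prod, setIntegral_prod_mul (fun s : ℝ => s * f (s ^ 2))
    (fun _ => (1 : ℝ))]
  rw [← integral_comp_rpow_Ioi_of_pos (g := f) (p := 2) two_pos]
  have h2 : ∀ x : ℝ, (2 * x ^ ((2 : ℝ) - 1)) • f (x ^ (2 : ℝ)) = 2 * (x * f (x ^ 2)) := by
    intro x
    rw [show (2 : ℝ) - 1 = 1 by norm_num, Real.rpow_one, Real.rpow_two, smul_eq_mul, mul_assoc]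
  simp only [h2]
  rw [integral_const_mul]
  simp
  rw [max_eq_left (by positivity)]
  ring

/-- The area of an ellipse `qr α ≤ s * Dfun α` is `2 * s`. -/
theorem integral_comp_qr_div {R : ℝ} {α : ℝ × ℝ} (hα : α ∈ box R) (f : ℝ → ℝ) :
    ∫ v : ℝ × ℝ, f (qr α v / Dfun α) = 2 * ∫ s in Set.Ioi (0 : ℝ), f s := by
  have hD := Dfun_pos hα
  have h54 := one_le_four_mul_sub hα
  have hα1 : 0 < α.1 := by have := (mem_box.mp hα).1.1; linarith
  set D := Dfun α with hDdef
  set a := √(α.1 / D) with ha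
  set k := (4 * α.1 * α.2 - 1) / (4 * α.1 * D) with hk
  have hk0 : 0 < k := by positivity
  set d := √k with hd
  have ha0 : 0 < a := Real.sqrt_pos.mpr (by positivity)
  have hd0 : 0 < d := Real.sqrt_pos.mpr hk0
  have ha2 : a ^ 2 = α.1 / D := Real.sq_sqrt (by positivity)
  have hd2 : d ^ 2 = k := Real.sq_sqrt hk0.le
  have hS : √(4 * α.1 * α.2 - 1) = Real.pi * D := by
    rw [hDdef, Dfun]
    field_simp
  have hS2 : 4 * α.1 * α.2 - 1 = (Real.pi * D) ^ 2 := by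
    rw [← hS, Real.sq_sqrt (by linarith)]
  have had : a * d = Real.pi / 2 := by
    have : (a * d) ^ 2 = (Real.pi / 2) ^ 2 := by
      rw [mul_pow, ha2, hd2, hk, hS2]
      field_simp
      ring
    exact (pow_left_inj₀ (by positivity) (by positivity) two_ne_zero).mp this
  have h0 : a * d - (1 / (2 * a * D)) * 0 ≠ 0 := by
    rw [mul_zero, sub_zero]; positivity
  have h1 := integral_comp_linMap h0 fun v => f (v.1 ^ 2 + v.2 ^ 2)
  rw [integral_comp_add_sq, mul_zero, sub_zero, had, abs_of_pos (by positivity)] at h1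
  have h2 : ∀ x : ℝ × ℝ, qr α x / D =
      (a * x.1 + 1 / (2 * a * D) * x.2) ^ 2 + (0 * x.1 + d * x.2) ^ 2 := by
    intro x
    have e1 : (1 / (2 * a * D)) ^ 2 = 1 / (4 * α.1 * D) := by
      rw [div_pow, mul_pow, mul_pow, ha2]
      field_simp
      norm_num
    have e2 : (a * x.1 + 1 / (2 * a * D) * x.2) ^ 2 =
        a ^ 2 * x.1 ^ 2 + x.1 * x.2 / D + (1 / (2 * a * D)) ^ 2 * x.2 ^ 2 := by
      field_simp
      ring
    rw [e2, e1, ha2, zero_mul, zero_add, mul_pow, hd2, hk]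
    simp only [qr]
    field_simp
    ring
  simp only [h2]
  rw [h1]
  field_simp

theorem abs_setIntegral_Iic_le {W : ℝ → ℝ} {b r T s : ℝ} (hW : IsProfile b r W) (hr : 0 ≤ r)
    (hT : 0 < T) (hs : 0 < s) :
    |∫ t in Set.Iic (0 : ℝ), W (T * (s - t))| ≤
      (Set.Icc 0 (r / T)).indicator (fun _ => b * (r / T)) s := by
  have hb : 0 ≤ b := (abs_nonneg _).trans (hW.bound 0)
  by_cases hsT : s ≤ r / T
  · rw [Set.indicator_of_mem (Set.mem_Icc.mpr ⟨hs.le, hsT⟩)]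
    have hi : Integrable ((Set.Icc (-(r / T)) 0).indicator fun _ => b)
        (volume.restrict (Set.Iic (0 : ℝ))) := by
      refine Integrable.restrict ?_
      rw [integrable_indicator_iff measurableSet_Icc]
      exact integrableOn_const (by simp)
    have h := norm_integral_le_of_norm_le hi (f := fun t => W (T * (s - t))) ?_
    · refine h.trans (le_of_eq ?_)
      rw [integral_indicator measurableSet_Icc, Measure.restrict_restrict measurableSet_Icc,
        Set.inter_eq_left.mpr (fun t ht => ht.2), setIntegral_const]
      have : 0 ≤ r / T := by positivity
      simp [this]
      ring
    · refine (ae_restrict_mem measurableSet_Iic).mono fun t ht => ?_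
      by_cases ht' : t ∈ Set.Icc (-(r / T)) 0
      · rw [Set.indicator_of_mem ht']
        exact hW.bound _
      · rw [Set.indicator_of_notMem ht']
        refine le_of_eq (norm_eq_zero.mpr (hW.eq_zero _ ?_))
        have h1 : t < -(r / T) := by
          by_contra h
          exact ht' ⟨not_lt.mp h, ht⟩
        refine lt_of_lt_of_le ?_ (le_abs_self _)
        have : r / T < s - t := by linarith
        rw [div_lt_iff₀ hT] at this
        linarith
  · rw [Set.indicator_of_notMem (fun h => hsT h.2)]
    have : ∀ t ∈ Set.Iic (0 : ℝ), W (T * (s - t)) = 0 := by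
      intro t ht
      refine hW.eq_zero _ (lt_of_lt_of_le ?_ (le_abs_self _))
      have : r / T < s - t := by linarith [Set.mem_Iic.mp ht, not_le.mp hsT]
      rw [div_lt_iff₀ hT] at this
      linarith
    rw [setIntegral_congr_fun measurableSet_Iic this]
    simp

theorem IsProfile.integrable {b r : ℝ} {f : ℝ → ℝ} (h : IsProfile b r f) : Integrable f := by
  refine h.continuous.integrable_of_hasCompactSupport
    (HasCompactSupport.intro (isCompact_Icc (a := -r) (b := r)) fun t ht => h.eq_zero t ?_)
  by_contra h'
  exact ht (_root_.abs_le.mp (not_lt.mp h'))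

theorem abs_integral_amp_sub_le {V W : ℝ → ℝ} {b r M T R : ℝ} {α : ℝ × ℝ}
    (hV : IsProfile b r V) (hW : IsProfile b r W) (hr : 1 ≤ r)
    (hR : 1 ≤ R) (hM : 1 ≤ M) (hT : 1 ≤ T) (hα : α ∈ box R) :
    |(∫ x, amp V W M T α x) - 4 * ((∫ s in Set.Ioi (0 : ℝ), V s) * (∫ s, W s) * M ^ 2 / T)| ≤
      4 * (b * r) ^ 2 / T ^ 2 := by
  have hT0 : 0 < T := by linarith
  have hb : 0 ≤ b := (abs_nonneg _).trans (hW.bound 0)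
  have hD := Dfun_pos hα
  have hWi : ∀ s : ℝ, Integrable fun t => W (T * (s - t)) := fun s =>
    ((hW.integrable.comp_mul_left' hT0.ne').comp_sub_left s)
  set Z : ℝ → ℝ := fun s => ∫ t in Set.Iic (0 : ℝ), W (T * (s - t)) with hZ
  have inner : ∀ s : ℝ, ∫ t in Set.Ioi (0 : ℝ), W (T * (s - t)) = (∫ t, W t) / T - Z s := by
    intro s
    have h1 := integral_add_compl (measurableSet_Iic (a := (0 : ℝ))) (hWi s)
    rw [Set.compl_Iic] at h1
    have h2 : ∫ t, W (T * (s - t)) = (∫ t, W t) / T := by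
      rw [integral_sub_left_eq_self (fun t => W (T * t)), Measure.integral_comp_mul_left,
        abs_of_pos (by positivity), smul_eq_mul]
      ring
    simp only [hZ]
    linarith
  have outer : ∫ x, amp V W M T α x =
      4 * ∫ s in Set.Ioi (0 : ℝ), V (s / M ^ 2) * ((∫ t, W t) / T - Z s) := by
    have h1 := integral_prod (μ := (volume : Measure (ℝ × ℝ))) (ν := (volume : Measure (ℝ × ℝ)))
      (amp V W M T α) (integrable_amp hV hW hr hR hM hT hα)
    rw [← Measure.volume_eq_prod] at h1
    rw [h1]
    have h2 : ∀ v : ℝ × ℝ, ∫ w, amp V W M T α (v, w) =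
        (fun s => V (s / M ^ 2) * (2 * ((∫ t, W t) / T - Z s))) (qr α v / Dfun α) := by
      intro v
      simp only
      rw [← inner, ← integral_comp_qr_div hα (fun t => W (T * (qr α v / Dfun α - t))),
        ← integral_const_mul]
      refine integral_congr_ae (Filter.Eventually.of_forall fun w => ?_)
      simp only [amp, lag]
      rw [mul_comm]
      congr 2
      · field_simp
      · field_simp
    simp only [h2]
    rw [integral_comp_qr_div hα fun s => V (s / M ^ 2) * (2 * ((∫ t, W t) / T - Z s)),
      ← integral_const_mul, ← integral_const_mul]
    exact integral_congr_ae (Filter.Eventually.of_forall fun s => by simp only; ring)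
  have hM0 : (0 : ℝ) < M ^ 2 := by positivity
  have hVi : IntegrableOn (fun s => V (s / M ^ 2) * ((∫ t, W t) / T)) (Set.Ioi 0) :=
    ((hV.integrable.comp_div hM0.ne').mul_const _).integrableOn
  have hZm : Measurable Z := by
    have : StronglyMeasurable (Function.uncurry fun s t : ℝ => W (T * (s - t))) :=
      (hW.continuous.comp (by fun_prop)).stronglyMeasurable
    exact this.integral_prod_right.measurable
  have hIi : IntegrableOn ((Set.Icc 0 (r / T)).indicator fun _ => b * (b * (r / T)))
      (Set.Ioi (0 : ℝ)) := by
    refine Integrable.integrableOn ?_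
    rw [integrable_indicator_iff measurableSet_Icc]
    exact integrableOn_const (by simp)
  have hbd : ∀ᵐ s ∂volume.restrict (Set.Ioi (0 : ℝ)), ‖V (s / M ^ 2) * Z s‖ ≤
      (Set.Icc 0 (r / T)).indicator (fun _ => b * (b * (r / T))) s := by
    refine (ae_restrict_mem measurableSet_Ioi).mono fun s hs => ?_
    have h1 := abs_setIntegral_Iic_le hW (by linarith) hT0 hs
    rw [Real.norm_eq_abs, abs_mul]
    refine (mul_le_mul (hV.bound _) h1 (abs_nonneg _) hb).trans (le_of_eq ?_)
    by_cases h : s ∈ Set.Icc 0 (r / T) <;> simp [h]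
  have hZi : IntegrableOn (fun s => V (s / M ^ 2) * Z s) (Set.Ioi 0) :=
    Integrable.mono' hIi ((hV.continuous.measurable.comp
      (measurable_id.div_const _)).mul hZm).aestronglyMeasurable hbd
  have hmain : ∫ s in Set.Ioi (0 : ℝ), V (s / M ^ 2) = M ^ 2 * ∫ s in Set.Ioi (0 : ℝ), V s := by
    have h := integral_comp_mul_left_Ioi V 0 (inv_pos.mpr hM0)
    rw [inv_inv, mul_zero, smul_eq_mul] at h
    rw [← h]
    exact integral_congr_ae (Filter.Eventually.of_forall fun s => by
      simp only; rw [div_eq_inv_mul])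
  have e : (∫ x, amp V W M T α x) - 4 * ((∫ s in Set.Ioi (0 : ℝ), V s) * (∫ s, W s) * M ^ 2 / T) =
      -(4 * ∫ s in Set.Ioi (0 : ℝ), V (s / M ^ 2) * Z s) := by
    rw [outer]
    simp only [mul_sub]
    rw [integral_sub hVi hZi, integral_mul_const, hmain]
    ring
  rw [e, abs_neg, abs_mul, abs_of_pos (by norm_num : (0 : ℝ) < 4)]
  have h := norm_integral_le_of_norm_le hIi hbd
  rw [integral_indicator measurableSet_Icc, Measure.restrict_restrict measurableSet_Icc,
    setIntegral_const, Real.norm_eq_abs] at h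
  have hv : volume.real (Set.Icc 0 (r / T) ∩ Set.Ioi 0) ≤ r / T := by
    refine ENNReal.toReal_le_of_le_ofReal (by positivity) ((measure_mono
      Set.inter_subset_left).trans (by simp))
  rw [smul_eq_mul] at h
  calc _ ≤ 4 * (r / T * (b * (b * (r / T)))) := by
        refine mul_le_mul_of_nonneg_left (h.trans ?_) (by norm_num)
        exact mul_le_mul_of_nonneg_right hv (by positivity)
    _ = _ := by field_simp

/-- A Lipschitz cutoff equal to `1` on `[1, R - 1]` and supported in `[7/8, R - 1/2]`. -/
noncomputable def bump (R t : ℝ) : ℝ := max 0 (min 1 (min (8 * (t - 7 / 8)) (8 * (R - 1 / 2 - t))))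

theorem bump_nonneg (R t : ℝ) : 0 ≤ bump R t := le_max_left _ _

theorem bump_le_one (R t : ℝ) : bump R t ≤ 1 := max_le zero_le_one (min_le_left _ _)

theorem bump_eq_one {R t : ℝ} (h1 : 1 ≤ t) (h2 : t ≤ R - 1) : bump R t = 1 := by
  have h : (1 : ℝ) ≤ min (8 * (t - 7 / 8)) (8 * (R - 1 / 2 - t)) :=
    le_min (by linarith) (by linarith)
  rw [bump, min_eq_left h]
  exact max_eq_right zero_le_one

theorem of_bump_ne_zero {R t : ℝ} (h : bump R t ≠ 0) : 7 / 8 ≤ t ∧ t ≤ R - 1 / 2 := by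
  constructor <;> by_contra h' <;> refine h (max_eq_left ?_)
  · exact (min_le_right _ _).trans ((min_le_left _ _).trans (by linarith))
  · exact (min_le_right _ _).trans ((min_le_right _ _).trans (by linarith))

theorem abs_bump_sub_le (R s t : ℝ) : |bump R s - bump R t| ≤ 8 * |s - t| := by
  unfold bump
  refine (abs_max_sub_max_le_max _ _ _ _).trans (max_le (by simp) ?_)
  refine (abs_min_sub_min_le_max _ _ _ _).trans (max_le (by simp) ?_)
  refine (abs_min_sub_min_le_max _ _ _ _).trans (max_le ?_ ?_)
  · rw [show 8 * (s - 7 / 8) - 8 * (t - 7 / 8) = 8 * (s - t) by ring, abs_mul]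
    norm_num
  · rw [show 8 * (R - 1 / 2 - s) - 8 * (R - 1 / 2 - t) = 8 * (t - s) by ring, abs_mul,
      abs_sub_comm]
    norm_num

theorem continuous_bump (R : ℝ) : Continuous (bump R) := by
  unfold bump
  fun_prop

/-- A Lipschitz cutoff supported in the interior of `box R`. -/
noncomputable def wt (R : ℝ) (α : ℝ × ℝ) : ℝ := bump R α.1 * bump R α.2

theorem wt_nonneg (R : ℝ) (α : ℝ × ℝ) : 0 ≤ wt R α :=
  mul_nonneg (bump_nonneg _ _) (bump_nonneg _ _)

theorem wt_le_one (R : ℝ) (α : ℝ × ℝ) : wt R α ≤ 1 :=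
  mul_le_one₀ (bump_le_one _ _) (bump_nonneg _ _) (bump_le_one _ _)

theorem abs_wt_le_one (R : ℝ) (α : ℝ × ℝ) : |wt R α| ≤ 1 := by
  rw [abs_of_nonneg (wt_nonneg R α)]
  exact wt_le_one R α

theorem continuous_wt (R : ℝ) : Continuous (wt R) :=
  ((continuous_bump R).comp continuous_fst).mul ((continuous_bump R).comp continuous_snd)

theorem abs_wt_sub_le (R : ℝ) (α β : ℝ × ℝ) : |wt R α - wt R β| ≤ 16 * ‖α - β‖ := by
  have h1 := abs_bump_sub_le R α.1 β.1
  have h2 := abs_bump_sub_le R α.2 β.2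
  have n1 : |α.1 - β.1| ≤ ‖α - β‖ := norm_fst_le (α - β)
  have n2 : |α.2 - β.2| ≤ ‖α - β‖ := norm_snd_le (α - β)
  have e : wt R α - wt R β =
      (bump R α.1 - bump R β.1) * bump R α.2 + bump R β.1 * (bump R α.2 - bump R β.2) := by
    unfold wt; ring
  rw [e]
  refine (abs_add_le _ _).trans ?_
  rw [abs_mul, abs_mul, abs_of_nonneg (bump_nonneg R α.2), abs_of_nonneg (bump_nonneg R β.1)]
  have t1 : |bump R α.1 - bump R β.1| * bump R α.2 ≤ |bump R α.1 - bump R β.1| :=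
    mul_le_of_le_one_right (abs_nonneg _) (bump_le_one _ _)
  have t2 : bump R β.1 * |bump R α.2 - bump R β.2| ≤ |bump R α.2 - bump R β.2| :=
    mul_le_of_le_one_left (abs_nonneg _) (bump_le_one _ _)
  linarith

theorem mem_box_of_wt_ne_zero {R : ℝ} {α β : ℝ × ℝ} (h : wt R α ≠ 0) (hβ : ‖β - α‖ ≤ 1 / 8) :
    β ∈ box R := by
  have h1 := of_bump_ne_zero (left_ne_zero_of_mul h)
  have h2 := of_bump_ne_zero (right_ne_zero_of_mul h)
  have n1 : |β.1 - α.1| ≤ 1 / 8 := (norm_fst_le (β - α)).trans hβ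
  have n2 : |β.2 - α.2| ≤ 1 / 8 := (norm_snd_le (β - α)).trans hβ
  rw [abs_le] at n1 n2
  rw [mem_box]
  refine ⟨⟨?_, ?_⟩, ?_, ?_⟩ <;> linarith [h1.1, h1.2, h2.1, h2.2, n1.1, n1.2, n2.1, n2.2]

theorem abs_Dfun_sub_le {R : ℝ} {α β : ℝ × ℝ} (hα : α ∈ box R) (hβ : β ∈ box R) :
    |Dfun α - Dfun β| ≤ 2 * R * ‖α - β‖ := by
  have h1 := one_le_four_mul_sub hα
  have h2 := one_le_four_mul_sub hβ
  have n1 : |α.1 - β.1| ≤ ‖α - β‖ := norm_fst_le (α - β)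
  have n2 : |α.2 - β.2| ≤ ‖α - β‖ := norm_snd_le (α - β)
  rw [mem_box] at hα hβ
  set s := 4 * α.1 * α.2 - 1
  set t := 4 * β.1 * β.2 - 1
  have hs : 1 ≤ √s := Real.one_le_sqrt.mpr (by linarith)
  have ht : 1 ≤ √t := Real.one_le_sqrt.mpr (by linarith)
  have e : (√s - √t) * (√s + √t) = s - t := by
    have := Real.sq_sqrt (show 0 ≤ s by linarith)
    have := Real.sq_sqrt (show 0 ≤ t by linarith)
    nlinarith
  have h3 : |s - t| ≤ 8 * R * ‖α - β‖ := by
    have : s - t = 4 * ((α.1 - β.1) * α.2 + β.1 * (α.2 - β.2)) := by simp only [s, t]; ring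
    rw [this, abs_mul, abs_of_pos (by norm_num : (0 : ℝ) < 4)]
    have t1 : |(α.1 - β.1) * α.2| ≤ ‖α - β‖ * R := by
      rw [abs_mul, abs_of_nonneg (show 0 ≤ α.2 by linarith)]
      exact mul_le_mul n1 hα.2.2 (by linarith) (norm_nonneg _)
    have t2 : |β.1 * (α.2 - β.2)| ≤ R * ‖α - β‖ := by
      rw [abs_mul, abs_of_nonneg (show 0 ≤ β.1 by linarith)]
      exact mul_le_mul hβ.1.2 n2 (abs_nonneg _) (by linarith)
    linarith [abs_add_le ((α.1 - β.1) * α.2) (β.1 * (α.2 - β.2))]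
  have h4 : |√s - √t| * 2 ≤ |s - t| := by
    rw [← e, abs_mul, abs_of_nonneg (show 0 ≤ √s + √t by linarith)]
    exact mul_le_mul_of_nonneg_left (by linarith) (abs_nonneg _)
  have e2 : Dfun α - Dfun β = (√s - √t) / Real.pi := by
    simp only [Dfun, s, t]; ring
  rw [e2, abs_div, abs_of_pos Real.pi_pos, div_le_iff₀ Real.pi_pos]
  have hR : 0 ≤ R := by linarith
  have h5 : 2 * R * ‖α - β‖ * 3 ≤ 2 * R * ‖α - β‖ * Real.pi :=
    mul_le_mul_of_nonneg_left Real.pi_gt_three.le (by positivity)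
  nlinarith [mul_nonneg hR (norm_nonneg (α - β))]

theorem abs_div_Dfun_sub_le {R a c P : ℝ} {α β : ℝ × ℝ} (hα : α ∈ box R) (hβ : β ∈ box R)
    (hc : |c| ≤ P) :
    |a / Dfun α - c / Dfun β| ≤ 4 * |a - c| + 32 * R * P * ‖α - β‖ := by
  have h1 := le_Dfun hα
  have h2 := le_Dfun hβ
  have h3 := abs_Dfun_sub_le hα hβ
  have hR : 0 ≤ R := by have := (mem_box.mp hα).1; linarith
  set D := Dfun α
  set D' := Dfun β
  have e : a / D - c / D' = (a - c) / D + c * (D' - D) / (D * D') := by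
    field_simp
    ring
  have hP : 0 ≤ P := (abs_nonneg _).trans hc
  rw [e]
  refine (abs_add_le _ _).trans (add_le_add ?_ ?_)
  · rw [abs_div, abs_of_pos (by linarith : 0 < D), div_le_iff₀ (by linarith)]
    nlinarith [abs_nonneg (a - c)]
  · have hDD : 9 / 100 ≤ D * D' := by nlinarith
    rw [abs_div, abs_mul, abs_of_pos (by linarith : 0 < D * D'), div_le_iff₀ (by linarith),
      abs_sub_comm]
    calc |c| * |D - D'| ≤ P * (2 * R * ‖α - β‖) := mul_le_mul hc h3 (abs_nonneg _) hP
      _ ≤ 32 * R * P * ‖α - β‖ * (9 / 100) := by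
          have : 0 ≤ P * R * ‖α - β‖ := by positivity
          nlinarith
      _ ≤ _ := by gcongr

theorem abs_qr_sub_le {R Q η : ℝ} {α v w : ℝ × ℝ} (hR : 1 ≤ R) (hα : α ∈ box R) (hv : ‖v‖ ≤ Q)
    (hw : ‖w‖ ≤ Q) (h : ‖v - w‖ ≤ η) : |qr α v - qr α w| ≤ 6 * R * Q * η := by
  rw [mem_box] at hα
  have hη : 0 ≤ η := (norm_nonneg _).trans h
  have hQ : 0 ≤ Q := (norm_nonneg _).trans hv
  have hs : ‖v + w‖ ≤ 2 * Q := (norm_add_le _ _).trans (by linarith)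
  have a1 := (norm_fst_le (v - w)).trans h
  have a2 := (norm_snd_le (v - w)).trans h
  have b1 := (norm_fst_le (v + w)).trans hs
  have b2 := (norm_snd_le (v + w)).trans hs
  rw [Real.norm_eq_abs] at a1 a2 b1 b2
  have m : ∀ {a c : ℝ}, |a| ≤ η → |c| ≤ 2 * Q → |a * c| ≤ η * (2 * Q) := by
    intro a c ha hc
    rw [abs_mul]
    exact mul_le_mul ha hc (abs_nonneg _) hη
  have m11 := m a1 b1
  have m12 := m a1 b2
  have m21 := m a2 b1
  have m22 := m a2 b2
  rw [qr_sub_qr, bf]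
  have t1 : |α.1 * ((v - w).1 * (v + w).1)| ≤ R * (η * (2 * Q)) := by
    rw [abs_mul, abs_of_nonneg (show 0 ≤ α.1 by linarith)]
    exact mul_le_mul hα.1.2 m11 (abs_nonneg _) (by linarith)
  have t2 : |α.2 * ((v - w).2 * (v + w).2)| ≤ R * (η * (2 * Q)) := by
    rw [abs_mul, abs_of_nonneg (show 0 ≤ α.2 by linarith)]
    exact mul_le_mul hα.2.2 m22 (abs_nonneg _) (by linarith)
  have hX : η * (2 * Q) ≤ R * (η * (2 * Q)) := le_mul_of_one_le_left (by positivity) hR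
  rw [abs_le] at t1 t2 m12 m21 ⊢
  constructor <;> linarith [t1.1, t1.2, t2.1, t2.2, m12.1, m12.2, m21.1, m21.2]

theorem abs_qr_sub_le_param {Q : ℝ} {α β v : ℝ × ℝ} (hv : ‖v‖ ≤ Q) :
    |qr α v - qr β v| ≤ 2 * Q ^ 2 * ‖α - β‖ := by
  have n1 : |α.1 - β.1| ≤ ‖α - β‖ := norm_fst_le (α - β)
  have n2 : |α.2 - β.2| ≤ ‖α - β‖ := norm_snd_le (α - β)
  have b1 := (norm_fst_le v).trans hv
  have b2 := (norm_snd_le v).trans hv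
  rw [Real.norm_eq_abs] at b1 b2
  have s1 : v.1 ^ 2 ≤ Q ^ 2 := sq_le_sq' (by linarith [(abs_le.mp b1).1]) (abs_le.mp b1).2
  have s2 : v.2 ^ 2 ≤ Q ^ 2 := sq_le_sq' (by linarith [(abs_le.mp b2).1]) (abs_le.mp b2).2
  have e : qr α v - qr β v = (α.1 - β.1) * v.1 ^ 2 + (α.2 - β.2) * v.2 ^ 2 := by
    simp only [qr]; ring
  rw [e]
  refine (abs_add_le _ _).trans ?_
  rw [abs_mul, abs_mul, abs_of_nonneg (sq_nonneg v.1), abs_of_nonneg (sq_nonneg v.2)]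
  have t1 := mul_le_mul n1 s1 (sq_nonneg _) (norm_nonneg _)
  have t2 := mul_le_mul n2 s2 (sq_nonneg _) (norm_nonneg _)
  linarith

theorem abs_qr_le {R Q : ℝ} {α v : ℝ × ℝ} (hR : 1 ≤ R) (hα : α ∈ box R) (hv : ‖v‖ ≤ Q) :
    |qr α v| ≤ 6 * R * Q * Q := by
  have h0 : ‖(0 : ℝ × ℝ)‖ ≤ Q := by rw [norm_zero]; exact (norm_nonneg _).trans hv
  have := abs_qr_sub_le hR hα hv h0 (η := Q) (by rwa [sub_zero])
  simpa [qr] using this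

theorem abs_lag_sub_le {R Q η : ℝ} {α : ℝ × ℝ} {x y : (ℝ × ℝ) × (ℝ × ℝ)} (hR : 1 ≤ R)
    (hα : α ∈ box R) (hx : ‖x‖ ≤ Q) (hy : ‖y‖ ≤ Q) (h : ‖x - y‖ ≤ η) :
    |lag α x - lag α y| ≤ 12 * R * Q * η := by
  have h1 := abs_qr_sub_le hR hα ((norm_fst_le x).trans hx) ((norm_fst_le y).trans hy)
    ((norm_fst_le (x - y)).trans h)
  have h2 := abs_qr_sub_le hR hα ((norm_snd_le x).trans hx) ((norm_snd_le y).trans hy)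
    ((norm_snd_le (x - y)).trans h)
  have e : lag α x - lag α y = (qr α x.1 - qr α y.1) - (qr α x.2 - qr α y.2) := by
    simp only [lag]; ring
  rw [e]
  linarith [abs_sub (qr α x.1 - qr α y.1) (qr α x.2 - qr α y.2)]

/-- `amp` with the value of `lag` treated as an independent variable. -/
noncomputable def ker (V W : ℝ → ℝ) (M T u : ℝ) (α v : ℝ × ℝ) : ℝ :=
  W (T * u / Dfun α) * V (qr α v / (M ^ 2 * Dfun α))

section ker

variable {V W : ℝ → ℝ} {b r M T R u : ℝ} {α β v v' : ℝ × ℝ}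

theorem abs_ker_le (hV : IsProfile b r V) (hW : IsProfile b r W) :
    |ker V W M T u α v| ≤ b ^ 2 := by
  have hb : 0 ≤ b := (abs_nonneg _).trans (hW.bound 0)
  rw [ker, abs_mul, sq b]
  exact mul_le_mul (hW.bound _) (hV.bound _) (abs_nonneg _) hb

theorem abs_le_of_ker_ne_zero (hW : IsProfile b r W) (hr : 0 ≤ r) (hT : 0 < T) (hα : α ∈ box R)
    (h : ker V W M T u α v ≠ 0) : |u| ≤ r * R / T := by
  have h1 := hW.abs_le (left_ne_zero_of_mul h)
  have hD := Dfun_pos hα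
  rw [abs_div, abs_mul, abs_of_pos hD, abs_of_pos hT, div_le_iff₀ hD] at h1
  rw [le_div_iff₀ hT, mul_comm]
  exact h1.trans (mul_le_mul_of_nonneg_left (Dfun_le hα) hr)

theorem measurable_ker (hV : IsProfile b r V) (hW : IsProfile b r W) (v : ℝ × ℝ) :
    Measurable fun z : ℝ × (ℝ × ℝ) => ker V W M T z.1 z.2 v := by
  have hD : Measurable fun z : ℝ × (ℝ × ℝ) => Dfun z.2 :=
    (continuous_Dfun.comp continuous_snd).measurable
  have hQ : Measurable fun z : ℝ × (ℝ × ℝ) => qr z.2 v := by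
    unfold qr
    exact Continuous.measurable (by fun_prop)
  exact (hW.continuous.measurable.comp ((measurable_fst.const_mul T).div hD)).mul
    (hV.continuous.measurable.comp (hQ.div (hD.const_mul (M ^ 2))))

theorem abs_ker_sub_le {ρ : ℝ} (hV : IsProfile b r V) (hW : IsProfile b r W) (hr : 0 ≤ r)
    (hR : 1 ≤ R) (hM : 0 < M) (hT : 0 < T) (hρ : 0 ≤ ρ) (hα : α ∈ box R) (hβ : β ∈ box R)
    (hu : |u| ≤ r * R / T) (hv : ‖v‖ ≤ ρ * M) (hv' : ‖v'‖ ≤ ρ * M) (h : ‖v - v'‖ ≤ 1) :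
    |ker V W M T u α v - ker V W M T u β v'| ≤
      b ^ 2 * (32 * R ^ 2 * r + 200 * R ^ 2 * ρ ^ 2 + 24 * R * ρ) * (‖α - β‖ + 1 / M) := by
  have hb : 0 ≤ b := (abs_nonneg _).trans (hW.bound 0)
  have hn := norm_nonneg (α - β)
  have hM2 : (0 : ℝ) < M ^ 2 := by positivity
  have w1 : |W (T * u / Dfun α) - W (T * u / Dfun β)| ≤ b * (32 * R * (r * R) * ‖α - β‖) := by
    have hc : |T * u| ≤ r * R := by
      rw [abs_mul, abs_of_pos hT, mul_comm]
      exact (le_div_iff₀ hT).mp hu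
    have := abs_div_Dfun_sub_le (a := T * u) hα hβ hc
    rw [sub_self, abs_zero, mul_zero, zero_add] at this
    exact (hW.lipschitz _ _).trans (mul_le_mul_of_nonneg_left this hb)
  have v1 : |V (qr α v / (M ^ 2 * Dfun α)) - V (qr β v' / (M ^ 2 * Dfun β))| ≤
      b * ((8 * ρ ^ 2 + 192 * R ^ 2 * ρ ^ 2) * ‖α - β‖ + 24 * R * ρ * (1 / M)) := by
    have hc : |qr β v' / M ^ 2| ≤ 6 * R * ρ ^ 2 := by
      rw [abs_div, abs_of_pos hM2, div_le_iff₀ hM2]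
      exact (abs_qr_le hR hβ hv').trans (le_of_eq (by ring))
    have hd : |qr α v / M ^ 2 - qr β v' / M ^ 2| ≤ 2 * ρ ^ 2 * ‖α - β‖ + 6 * R * ρ * (1 / M) := by
      rw [← sub_div, abs_div, abs_of_pos hM2, div_le_iff₀ hM2]
      have t1 := abs_qr_sub_le_param (α := α) (β := β) hv
      have t2 := abs_qr_sub_le hR hβ hv hv' h
      have t3 := abs_sub_le (qr α v) (qr β v) (qr β v')
      calc _ ≤ 2 * (ρ * M) ^ 2 * ‖α - β‖ + 6 * R * (ρ * M) * 1 := t3.trans (add_le_add t1 t2)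
        _ = _ := by field_simp
    have := abs_div_Dfun_sub_le (a := qr α v / M ^ 2) hα hβ hc
    rw [div_div, div_div] at this
    refine (hV.lipschitz _ _).trans (mul_le_mul_of_nonneg_left (this.trans ?_) hb)
    calc _ ≤ 4 * (2 * ρ ^ 2 * ‖α - β‖ + 6 * R * ρ * (1 / M)) +
          32 * R * (6 * R * ρ ^ 2) * ‖α - β‖ := by gcongr
      _ = _ := by ring
  have e : ker V W M T u α v - ker V W M T u β v' =
      (W (T * u / Dfun α) - W (T * u / Dfun β)) * V (qr α v / (M ^ 2 * Dfun α)) +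
        W (T * u / Dfun β) * (V (qr α v / (M ^ 2 * Dfun α)) - V (qr β v' / (M ^ 2 * Dfun β))) := by
    simp only [ker]; ring
  rw [e]
  refine (abs_add_le _ _).trans ?_
  rw [abs_mul, abs_mul]
  have s1 := mul_le_mul w1 (hV.bound (qr α v / (M ^ 2 * Dfun α))) (abs_nonneg _) (by positivity)
  have s2 := mul_le_mul (hW.bound (T * u / Dfun β)) v1 (abs_nonneg _) hb
  refine (add_le_add s1 s2).trans ?_
  have hM1 : 0 < 1 / M := by positivity
  set n := ‖α - β‖
  set m := 1 / M
  have hR2 : 1 ≤ R ^ 2 := one_le_pow₀ hR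
  have h8 : 8 * ρ ^ 2 ≤ 8 * R ^ 2 * ρ ^ 2 := by
    have : 0 ≤ ρ ^ 2 := by positivity
    nlinarith
  have key : (32 * R * (r * R) * n) + ((8 * ρ ^ 2 + 192 * R ^ 2 * ρ ^ 2) * n + 24 * R * ρ * m) ≤
      (32 * R ^ 2 * r + 200 * R ^ 2 * ρ ^ 2 + 24 * R * ρ) * (n + m) := by
    have p1 : 0 ≤ 32 * R ^ 2 * r * m := by positivity
    have p2 : 0 ≤ 200 * R ^ 2 * ρ ^ 2 * m := by positivity
    have p3 : 0 ≤ 24 * R * ρ * n := by positivity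
    have p4 := mul_le_mul_of_nonneg_right h8 hn
    nlinarith
  calc _ = b ^ 2 * ((32 * R * (r * R) * n) +
        ((8 * ρ ^ 2 + 192 * R ^ 2 * ρ ^ 2) * n + 24 * R * ρ * m)) := by ring
    _ ≤ b ^ 2 * ((32 * R ^ 2 * r + 200 * R ^ 2 * ρ ^ 2 + 24 * R * ρ) * (n + m)) := by gcongr
    _ = _ := by ring

end ker

/-- The coefficients of `lag` as an affine function of the parameter. -/
noncomputable def lagCoeff (x : (ℝ × ℝ) × (ℝ × ℝ)) : ℝ × ℝ × ℝ :=
  ((x.1 - x.2).1 * (x.1 + x.2).1, (x.1 - x.2).2 * (x.1 + x.2).2,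
    ((x.1 - x.2).1 * (x.1 + x.2).2 + (x.1 - x.2).2 * (x.1 + x.2).1) / 2)

theorem lag_eq_lagCoeff (α : ℝ × ℝ) (x : (ℝ × ℝ) × (ℝ × ℝ)) :
    lag α x = (lagCoeff x).1 * α.1 + (lagCoeff x).2.1 * α.2 + (lagCoeff x).2.2 := by
  rw [lag_eq_bf, bf, lagCoeff]
  ring

theorem detOf_eq_lagCoeff (x x' : (ℝ × ℝ) × (ℝ × ℝ)) :
    detOf x x' = (lagCoeff x).1 * (lagCoeff x').2.1 - (lagCoeff x).2.1 * (lagCoeff x').1 := rfl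

theorem abs_lagCoeff_le {Q : ℝ} {x : (ℝ × ℝ) × (ℝ × ℝ)} (hx : ‖x‖ ≤ Q) :
    |(lagCoeff x).1| ≤ 4 * Q ^ 2 ∧ |(lagCoeff x).2.1| ≤ 4 * Q ^ 2 := by
  have hQ : 0 ≤ Q := (norm_nonneg _).trans hx
  obtain ⟨⟨h1, h2⟩, h3, h4⟩ := abs_sub_add_le_of_norm_le hx
  simp only [lagCoeff, abs_mul]
  constructor
  · calc _ ≤ (2 * Q) * (2 * Q) := mul_le_mul h1 h3 (abs_nonneg _) (by positivity)
      _ = _ := by ring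
  · calc _ ≤ (2 * Q) * (2 * Q) := mul_le_mul h2 h4 (abs_nonneg _) (by positivity)
      _ = _ := by ring

/-- The parameter at which `lag` takes the values `u` at a pair of points. -/
noncomputable def lagInv (x x' : (ℝ × ℝ) × (ℝ × ℝ)) (u : ℝ × ℝ) : ℝ × ℝ :=
  (((lagCoeff x').2.1 * (u.1 - (lagCoeff x).2.2) - (lagCoeff x).2.1 * (u.2 - (lagCoeff x').2.2)) /
      detOf x x',
    ((lagCoeff x).1 * (u.2 - (lagCoeff x').2.2) - (lagCoeff x').1 * (u.1 - (lagCoeff x).2.2)) /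
      detOf x x')

theorem continuous_lagInv (x x' : (ℝ × ℝ) × (ℝ × ℝ)) : Continuous (lagInv x x') := by
  unfold lagInv
  fun_prop

theorem lagInv_lag {x x' : (ℝ × ℝ) × (ℝ × ℝ)} (h : detOf x x' ≠ 0) (α : ℝ × ℝ) :
    lagInv x x' (lag α x, lag α x') = α := by
  ext
  · simp only [lagInv, lag_eq_lagCoeff]
    rw [div_eq_iff h, detOf_eq_lagCoeff]
    ring
  · simp only [lagInv, lag_eq_lagCoeff]
    rw [div_eq_iff h, detOf_eq_lagCoeff]
    ring

theorem lag_lagInv {x x' : (ℝ × ℝ) × (ℝ × ℝ)} (h : detOf x x' ≠ 0) (u : ℝ × ℝ) :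
    lag (lagInv x x' u) x = u.1 ∧ lag (lagInv x x' u) x' = u.2 := by
  constructor
  · rw [lag_eq_lagCoeff]
    simp only [lagInv]
    field_simp
    rw [detOf_eq_lagCoeff]
    ring
  · rw [lag_eq_lagCoeff]
    simp only [lagInv]
    field_simp
    rw [detOf_eq_lagCoeff]
    ring

theorem norm_lagInv_sub_le {R Q E : ℝ} {x x' y y' : (ℝ × ℝ) × (ℝ × ℝ)} {u : ℝ × ℝ} (hR : 1 ≤ R)
    (hE : 0 < E) (hd : detOf x x' ≠ 0) (hdE : E ≤ |detOf y y'|) (hx : ‖x‖ ≤ Q) (hx' : ‖x'‖ ≤ Q)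
    (hy : ‖y‖ ≤ Q) (hy' : ‖y'‖ ≤ Q) (h : ‖x - y‖ ≤ 1) (h' : ‖x' - y'‖ ≤ 1)
    (hα : lagInv x x' u ∈ box R) :
    ‖lagInv x x' u - lagInv y y' u‖ ≤ 96 * R * Q ^ 3 / E := by
  set α := lagInv x x' u with hαdef
  have hQ : 0 ≤ Q := (norm_nonneg _).trans hx
  have hd' : detOf y y' ≠ 0 := abs_pos.mp (hE.trans_le hdE)
  obtain ⟨l1, l2⟩ := lag_lagInv hd u
  rw [← hαdef] at l1 l2
  obtain ⟨m1, m2⟩ := lag_lagInv hd' u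
  set β := lagInv y y' u with hβdef
  have d1 := abs_lag_sub_le hR hα hx hy h
  have d2 := abs_lag_sub_le hR hα hx' hy' h'
  rw [l1, ← m1] at d1
  rw [l2, ← m2] at d2
  rw [lag_eq_lagCoeff, lag_eq_lagCoeff] at d1 d2
  obtain ⟨c1, c2⟩ := abs_lagCoeff_le hy
  obtain ⟨c3, c4⟩ := abs_lagCoeff_le hy'
  have hD := detOf_eq_lagCoeff y y'
  set a := (lagCoeff y).1
  set c := (lagCoeff y).2.1
  set g := (lagCoeff y).2.2
  set a' := (lagCoeff y').1
  set c' := (lagCoeff y').2.1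
  set g' := (lagCoeff y').2.2
  set e1 := a * β.1 + c * β.2 + g - (a * α.1 + c * α.2 + g) with he1
  set e2 := a' * β.1 + c' * β.2 + g' - (a' * α.1 + c' * α.2 + g') with he2
  have hb : ∀ {s t : ℝ}, |s| ≤ 4 * Q ^ 2 → |t| ≤ 4 * Q ^ 2 →
      |s * e1 - t * e2| ≤ 96 * R * Q ^ 3 := by
    intro s t hs ht
    refine (abs_sub _ _).trans ?_
    rw [abs_mul, abs_mul]
    calc _ ≤ 4 * Q ^ 2 * (12 * R * Q * 1) + 4 * Q ^ 2 * (12 * R * Q * 1) :=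
          add_le_add (mul_le_mul hs d1 (abs_nonneg _) (by positivity))
            (mul_le_mul ht d2 (abs_nonneg _) (by positivity))
      _ = _ := by ring
  have fin : ∀ {z : ℝ}, |detOf y y' * z| ≤ 96 * R * Q ^ 3 → |z| ≤ 96 * R * Q ^ 3 / E := by
    intro z hz
    rw [abs_mul] at hz
    rw [le_div_iff₀ hE]
    calc |z| * E ≤ |z| * |detOf y y'| := by gcongr
      _ = |detOf y y'| * |z| := mul_comm _ _
      _ ≤ _ := hz
  rw [Prod.norm_def]
  refine max_le (fin ?_) (fin ?_)
  · have : detOf y y' * (α - β).1 = -(c' * e1 - c * e2) := by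
      rw [hD, he1, he2, Prod.fst_sub]; ring
    rw [this, abs_neg]
    exact hb c4 c2
  · have : detOf y y' * (α - β).2 = a' * e1 - a * e2 := by
      rw [hD, he1, he2, Prod.snd_sub]; ring
    rw [this]
    exact hb c3 c1

/-- The integrand of `corr` in the coordinates `u`. -/
noncomputable def corrKer (R : ℝ) (V W : ℝ → ℝ) (M T : ℝ) (x x' : (ℝ × ℝ) × (ℝ × ℝ))
    (u : ℝ × ℝ) : ℝ :=
  wt R (lagInv x x' u) *
    (ker V W M T u.1 (lagInv x x' u) x.1 * ker V W M T u.2 (lagInv x x' u) x'.1)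

/-- The weighted correlation of `amp` at two points. -/
noncomputable def corr (R : ℝ) (V W : ℝ → ℝ) (M T : ℝ) (x x' : (ℝ × ℝ) × (ℝ × ℝ)) : ℝ :=
  ∫ α, wt R α * (amp V W M T α x * amp V W M T α x')

theorem corr_eq {R : ℝ} {V W : ℝ → ℝ} {M T : ℝ} {x x' : (ℝ × ℝ) × (ℝ × ℝ)}
    (h : detOf x x' ≠ 0) :
    corr R V W M T x x' = |detOf x x'|⁻¹ * ∫ u, corrKer R V W M T x x' u := by
  have h1 : ∀ α, wt R α * (amp V W M T α x * amp V W M T α x') =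
      corrKer R V W M T x x' (lag α x, lag α x') := by
    intro α
    simp only [corrKer, lagInv_lag h]
    rfl
  have hd := h
  rw [detOf_eq_lagCoeff] at hd
  have h2 := integral_comp_linMap hd fun u =>
    corrKer R V W M T x x' (u + ((lagCoeff x).2.2, (lagCoeff x').2.2))
  rw [integral_add_right_eq_self (fun u => corrKer R V W M T x x' u), ← detOf_eq_lagCoeff] at h2
  rw [← h2, corr]
  refine integral_congr_ae (Filter.Eventually.of_forall fun α => ?_)
  simp only [h1, lag_eq_lagCoeff, Prod.mk_add_mk]

/-- The square of values of `lag` on which the weighted correlations are supported. -/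
def lagBox (δ : ℝ) : Set (ℝ × ℝ) := Set.Icc (-δ) δ ×ˢ Set.Icc (-δ) δ

theorem measurableSet_lagBox (δ : ℝ) : MeasurableSet (lagBox δ) :=
  measurableSet_Icc.prod measurableSet_Icc

theorem volume_real_lagBox {δ : ℝ} (hδ : 0 ≤ δ) : volume.real (lagBox δ) = 4 * δ ^ 2 := by
  rw [lagBox, Measure.volume_eq_prod, measureReal_prod_prod,
    Real.volume_real_Icc_of_le (by linarith)]
  ring

theorem abs_mul_mul_sub_le {w w' a a' c c' B : ℝ} (hw : |w'| ≤ 1) (ha : |a| ≤ B) (ha' : |a'| ≤ B)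
    (hc : |c| ≤ B) : |w * (a * c) - w' * (a' * c')| ≤
      |w - w'| * B ^ 2 + B * |a - a'| + B * |c - c'| := by
  have hB : 0 ≤ B := (abs_nonneg _).trans ha
  have e : w * (a * c) - w' * (a' * c') =
      (w - w') * (a * c) + w' * ((a - a') * c) + w' * (a' * (c - c')) := by ring
  rw [e]
  refine (abs_add_three _ _ _).trans ?_
  simp only [abs_mul]
  have h1 : |a| * |c| ≤ B ^ 2 := by
    rw [sq]; exact mul_le_mul ha hc (abs_nonneg _) hB
  have h2 : |w'| * (|a - a'| * |c|) ≤ 1 * (|a - a'| * B) := by gcongr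
  have h3 : |w'| * (|a'| * |c - c'|) ≤ 1 * (B * |c - c'|) := by gcongr
  have h4 := mul_le_mul_of_nonneg_left h1 (abs_nonneg (w - w'))
  linarith

/-- The constant in the continuity estimate for `corrKer`. -/
noncomputable def kerConst (b r R ρ : ℝ) : ℝ :=
  b ^ 4 * (16 + 2 * (32 * R ^ 2 * r + 200 * R ^ 2 * ρ ^ 2 + 24 * R * ρ)) * (96 * R * ρ ^ 3 + 1)

/-- The constant in the continuity estimate for `corr`. -/
noncomputable def corrConst (b r R ρ : ℝ) : ℝ :=
  4 * (r * R) ^ 2 * (kerConst b r R ρ + 128 * ρ ^ 3 * b ^ 4)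

theorem kerConst_nonneg {b r R ρ : ℝ} (hr : 0 ≤ r) (hR : 0 ≤ R) (hρ : 0 ≤ ρ) :
    0 ≤ kerConst b r R ρ := by
  unfold kerConst; positivity

theorem corrConst_nonneg {b r R ρ : ℝ} (hr : 0 ≤ r) (hR : 0 ≤ R) (hρ : 0 ≤ ρ) :
    0 ≤ corrConst b r R ρ := by
  have := kerConst_nonneg (b := b) hr hR hρ
  unfold corrConst; positivity

section corr

variable {V W : ℝ → ℝ} {b r M T R ρ E : ℝ} {x x' y y' : (ℝ × ℝ) × (ℝ × ℝ)} {u : ℝ × ℝ}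

theorem of_corrKer_ne_zero (hW : IsProfile b r W) (hr : 0 ≤ r) (hT : 0 < T)
    (h : corrKer R V W M T x x' u ≠ 0) :
    wt R (lagInv x x' u) ≠ 0 ∧ lagInv x x' u ∈ box R ∧ u ∈ lagBox (r * R / T) := by
  have h1 := left_ne_zero_of_mul h
  have h2 := right_ne_zero_of_mul h
  have h3 : lagInv x x' u ∈ box R := mem_box_of_wt_ne_zero h1 (by simp)
  refine ⟨h1, h3, ?_⟩
  have k1 := abs_le.mp (abs_le_of_ker_ne_zero hW hr hT h3 (left_ne_zero_of_mul h2))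
  have k2 := abs_le.mp (abs_le_of_ker_ne_zero hW hr hT h3 (right_ne_zero_of_mul h2))
  exact ⟨k1, k2⟩

theorem abs_corrKer_le (hV : IsProfile b r V) (hW : IsProfile b r W) (hr : 0 ≤ r) (hT : 0 < T) :
    |corrKer R V W M T x x' u| ≤ (lagBox (r * R / T)).indicator (fun _ => b ^ 4) u := by
  by_cases h : corrKer R V W M T x x' u = 0
  · rw [h, abs_zero]
    exact Set.indicator_nonneg (fun _ _ => by positivity) _
  · rw [Set.indicator_of_mem (of_corrKer_ne_zero hW hr hT h).2.2, corrKer, abs_mul, abs_mul]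
    calc _ ≤ 1 * (b ^ 2 * b ^ 2) := by
          gcongr
          · exact abs_wt_le_one _ _
          · exact abs_ker_le hV hW
          · exact abs_ker_le hV hW
      _ = _ := by ring

theorem measurable_corrKer (hV : IsProfile b r V) (hW : IsProfile b r W) :
    Measurable (corrKer R V W M T x x') := by
  have hl := continuous_lagInv x x'
  exact ((continuous_wt R).comp hl).measurable.mul
    (((measurable_ker hV hW x.1).comp (measurable_fst.prodMk hl.measurable)).mul
      ((measurable_ker hV hW x'.1).comp (measurable_snd.prodMk hl.measurable)))

theorem integrable_indicator_lagBox (δ c : ℝ) :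
    Integrable ((lagBox δ).indicator fun _ => c) := by
  rw [integrable_indicator_iff (measurableSet_lagBox δ)]
  refine integrableOn_const ?_
  rw [lagBox, Measure.volume_eq_prod, Measure.prod_prod]
  exact ENNReal.mul_ne_top (by simp) (by simp)

theorem integral_indicator_lagBox {δ : ℝ} (hδ : 0 ≤ δ) (c : ℝ) :
    ∫ u, (lagBox δ).indicator (fun _ => c) u = 4 * δ ^ 2 * c := by
  rw [integral_indicator (measurableSet_lagBox δ), setIntegral_const, volume_real_lagBox hδ,
    smul_eq_mul]

theorem abs_integral_le_of_lagBox {δ c : ℝ} {f : ℝ × ℝ → ℝ} (hδ : 0 ≤ δ)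
    (h : ∀ u, |f u| ≤ (lagBox δ).indicator (fun _ => c) u) : |∫ u, f u| ≤ 4 * δ ^ 2 * c := by
  rw [← integral_indicator_lagBox hδ c]
  exact norm_integral_le_of_norm_le (f := f) (integrable_indicator_lagBox δ c)
    (Filter.Eventually.of_forall h)

theorem integrable_corrKer (hV : IsProfile b r V) (hW : IsProfile b r W) (hr : 0 ≤ r)
    (hT : 0 < T) : Integrable (corrKer R V W M T x x') :=
  (integrable_indicator_lagBox _ _).mono' (measurable_corrKer hV hW).aestronglyMeasurable
    (Filter.Eventually.of_forall fun _ => abs_corrKer_le hV hW hr hT)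

theorem abs_corrKer_sub_le_of_ne_zero (hV : IsProfile b r V) (hW : IsProfile b r W) (hr : 0 ≤ r)
    (hR : 1 ≤ R) (hM : 0 < M) (hT : 0 < T) (hρ : 0 ≤ ρ) (hE : 0 < E) (hEM : E ≤ M ^ 4)
    (hxE : E ≤ |detOf x x'|) (hyE : E ≤ |detOf y y'|) (hx : ‖x‖ ≤ ρ * M) (hx' : ‖x'‖ ≤ ρ * M)
    (hy : ‖y‖ ≤ ρ * M) (hy' : ‖y'‖ ≤ ρ * M) (h : ‖x - y‖ ≤ 1) (h' : ‖x' - y'‖ ≤ 1)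
    (hs : 96 * R * ρ ^ 3 * (M ^ 3 / E) ≤ 1 / 8) (hu : corrKer R V W M T x x' u ≠ 0) :
    |corrKer R V W M T x x' u - corrKer R V W M T y y' u| ≤
      (lagBox (r * R / T)).indicator (fun _ => kerConst b r R ρ * (M ^ 3 / E)) u := by
  obtain ⟨w0, hα, hδ⟩ := of_corrKer_ne_zero hW hr hT hu
  rw [Set.indicator_of_mem hδ]
  have hd : detOf x x' ≠ 0 := abs_pos.mp (hE.trans_le hxE)
  have n1 := norm_lagInv_sub_le hR hE hd hyE hx hx' hy hy' h h' hα
  have e1 : 96 * R * (ρ * M) ^ 3 / E = 96 * R * ρ ^ 3 * (M ^ 3 / E) := by ring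
  rw [e1] at n1
  have hβ : lagInv y y' u ∈ box R := by
    refine mem_box_of_wt_ne_zero w0 ?_
    rw [norm_sub_rev]
    exact n1.trans hs
  have hM1 : 1 / M ≤ M ^ 3 / E := by
    rw [div_le_div_iff₀ hM hE]
    nlinarith
  have fst_le : ∀ z : (ℝ × ℝ) × (ℝ × ℝ), ‖z.1‖ ≤ ‖z‖ := fun z => norm_fst_le z
  have k1 := abs_ker_sub_le (u := u.1) hV hW hr hR hM hT hρ hα hβ (abs_le.mpr hδ.1)
    ((fst_le x).trans hx) ((fst_le y).trans hy) ((fst_le (x - y)).trans h)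
  have k2 := abs_ker_sub_le (u := u.2) hV hW hr hR hM hT hρ hα hβ (abs_le.mpr hδ.2)
    ((fst_le x').trans hx') ((fst_le y').trans hy') ((fst_le (x' - y')).trans h')
  have w1 := abs_wt_sub_le R (lagInv x x' u) (lagInv y y' u)
  refine (abs_mul_mul_sub_le (B := b ^ 2) (abs_wt_le_one _ _) (abs_ker_le hV hW) (abs_ker_le hV hW)
    (abs_ker_le hV hW)).trans ?_
  unfold kerConst
  set n := ‖lagInv x x' u - lagInv y y' u‖
  set c := 32 * R ^ 2 * r + 200 * R ^ 2 * ρ ^ 2 + 24 * R * ρ with hc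
  have hc0 : 0 ≤ c := by positivity
  set q := M ^ 3 / E
  set m := 1 / M
  have hm : 0 ≤ m := by positivity
  have hn : n + m ≤ (96 * R * ρ ^ 3 + 1) * q := by linarith
  calc _ ≤ 16 * n * (b ^ 2) ^ 2 + b ^ 2 * (b ^ 2 * c * (n + m)) +
        b ^ 2 * (b ^ 2 * c * (n + m)) := by
        gcongr
    _ = 16 * b ^ 4 * n + 2 * b ^ 4 * c * (n + m) := by ring
    _ ≤ 16 * b ^ 4 * (n + m) + 2 * b ^ 4 * c * (n + m) := by gcongr; linarith
    _ = b ^ 4 * (16 + 2 * c) * (n + m) := by ring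
    _ ≤ b ^ 4 * (16 + 2 * c) * ((96 * R * ρ ^ 3 + 1) * q) := by gcongr
    _ = _ := by ring

theorem abs_corrKer_sub_le (hV : IsProfile b r V) (hW : IsProfile b r W) (hr : 0 ≤ r)
    (hR : 1 ≤ R) (hM : 0 < M) (hT : 0 < T) (hρ : 0 ≤ ρ) (hE : 0 < E) (hEM : E ≤ M ^ 4)
    (hxE : E ≤ |detOf x x'|) (hyE : E ≤ |detOf y y'|) (hx : ‖x‖ ≤ ρ * M) (hx' : ‖x'‖ ≤ ρ * M)
    (hy : ‖y‖ ≤ ρ * M) (hy' : ‖y'‖ ≤ ρ * M) (h : ‖x - y‖ ≤ 1) (h' : ‖x' - y'‖ ≤ 1)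
    (hs : 96 * R * ρ ^ 3 * (M ^ 3 / E) ≤ 1 / 8) :
    |corrKer R V W M T x x' u - corrKer R V W M T y y' u| ≤
      (lagBox (r * R / T)).indicator (fun _ => kerConst b r R ρ * (M ^ 3 / E)) u := by
  by_cases h1 : corrKer R V W M T x x' u = 0
  · by_cases h2 : corrKer R V W M T y y' u = 0
    · rw [h1, h2, sub_zero, abs_zero]
      have := kerConst_nonneg (b := b) hr (zero_le_one.trans hR) hρ
      exact Set.indicator_nonneg (fun _ _ => by positivity) _
    · rw [abs_sub_comm]
      exact abs_corrKer_sub_le_of_ne_zero hV hW hr hR hM hT hρ hE hEM hyE hxE hy hy' hx hx'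
        (by rwa [norm_sub_rev]) (by rwa [norm_sub_rev]) hs h2
  · exact abs_corrKer_sub_le_of_ne_zero hV hW hr hR hM hT hρ hE hEM hxE hyE hx hx' hy hy' h h' hs h1

theorem abs_corr_sub_le (hV : IsProfile b r V) (hW : IsProfile b r W) (hr : 0 ≤ r)
    (hR : 1 ≤ R) (hM : 0 < M) (hT : 0 < T) (hρ : 0 ≤ ρ) (hE : 0 < E) (hEM : E ≤ M ^ 4)
    (hxE : E ≤ |detOf x x'|) (hyE : E ≤ |detOf y y'|) (hx : ‖x‖ ≤ ρ * M) (hx' : ‖x'‖ ≤ ρ * M)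
    (hy : ‖y‖ ≤ ρ * M) (hy' : ‖y'‖ ≤ ρ * M) (h : ‖x - y‖ ≤ 1) (h' : ‖x' - y'‖ ≤ 1)
    (hs : 96 * R * ρ ^ 3 * (M ^ 3 / E) ≤ 1 / 8) :
    |corr R V W M T x x' - corr R V W M T y y'| ≤
      corrConst b r R ρ * (M ^ 3 / (E ^ 2 * T ^ 2)) := by
  have hx0 := hE.trans_le hxE
  have hy0 := hE.trans_le hyE
  have hδ : 0 ≤ r * R / T := by positivity
  have hk := kerConst_nonneg (b := b) hr (zero_le_one.trans hR) hρ
  rw [corr_eq (abs_pos.mp hx0), corr_eq (abs_pos.mp hy0)]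
  set I := ∫ u, corrKer R V W M T x x' u with hI
  set J := ∫ u, corrKer R V W M T y y' u with hJ
  have i1 : |I - J| ≤ 4 * (r * R / T) ^ 2 * (kerConst b r R ρ * (M ^ 3 / E)) := by
    rw [hI, hJ, ← integral_sub (integrable_corrKer hV hW hr hT) (integrable_corrKer hV hW hr hT)]
    exact abs_integral_le_of_lagBox hδ fun u =>
      abs_corrKer_sub_le hV hW hr hR hM hT hρ hE hEM hxE hyE
        hx hx' hy hy' h h' hs
  have i2 : |J| ≤ 4 * (r * R / T) ^ 2 * b ^ 4 := by
    exact abs_integral_le_of_lagBox hδ fun u => abs_corrKer_le hV hW hr hT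
  have i3 : |(|detOf x x'|⁻¹ - |detOf y y'|⁻¹)| ≤ 128 * ρ ^ 3 * (M ^ 3 / E ^ 2) := by
    rw [inv_sub_inv hx0.ne' hy0.ne', abs_div, abs_of_pos (mul_pos hx0 hy0), abs_sub_comm]
    have d := (abs_abs_sub_abs_le _ _).trans (abs_detOf_sub_le hx hx' hy hy' h h')
    calc _ ≤ 128 * (ρ * M) ^ 3 * 1 / (E * E) := by gcongr
      _ = _ := by rw [← sq]; ring
  have i4 : |detOf x x'|⁻¹ ≤ E⁻¹ := inv_anti₀ hE hxE
  have e : |detOf x x'|⁻¹ * I - |detOf y y'|⁻¹ * J =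
      |detOf x x'|⁻¹ * (I - J) + (|detOf x x'|⁻¹ - |detOf y y'|⁻¹) * J := by ring
  rw [e]
  refine (abs_add_le _ _).trans ?_
  rw [abs_mul, abs_mul, abs_of_pos (inv_pos.mpr hx0)]
  calc _ ≤ E⁻¹ * (4 * (r * R / T) ^ 2 * (kerConst b r R ρ * (M ^ 3 / E))) +
        128 * ρ ^ 3 * (M ^ 3 / E ^ 2) * (4 * (r * R / T) ^ 2 * b ^ 4) := by gcongr
    _ = _ := by
      unfold corrConst
      field_simp

end corr

/-- The difference between the value of `amp` at an integer point and its mean over the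
corresponding cube. -/
noncomputable def defect (V W : ℝ → ℝ) (M T : ℝ) (α : ℝ × ℝ) (p : (ℤ × ℤ) × (ℤ × ℤ)) : ℝ :=
  amp V W M T α (pt p) - ∫ x in cubeAt p, amp V W M T α x

instance isProbabilityMeasure_cubeAt (p : (ℤ × ℤ) × (ℤ × ℤ)) :
    IsProbabilityMeasure (volume.restrict (cubeAt p)) :=
  ⟨by rw [Measure.restrict_apply_univ, volume_cubeAt]⟩

instance isFiniteMeasure_box (R : ℝ) : IsFiniteMeasure (volume.restrict (box R)) :=
  ⟨by rw [Measure.restrict_apply_univ]; exact volume_box_lt_top R⟩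

section defect

variable {V W : ℝ → ℝ} {b r M T R ρ E : ℝ} {α : ℝ × ℝ} {p p' : (ℤ × ℤ) × (ℤ × ℤ)}

theorem measurable_comp_prodMk {X Y Z : Type*} [MeasurableSpace X] [MeasurableSpace Y]
    [MeasurableSpace Z] {F : X → Y → ℝ} {g : Z → X} {f : Z → Y}
    (hF : Measurable fun z : X × Y => F z.1 z.2) (hg : Measurable g) (hf : Measurable f) :
    Measurable fun z => F (g z) (f z) :=
  hF.comp (hg.prodMk hf)

theorem measurable_amp_comp {Z : Type*} [MeasurableSpace Z] {g : Z → ℝ × ℝ}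
    {f : Z → (ℝ × ℝ) × (ℝ × ℝ)} (hV : IsProfile b r V) (hW : IsProfile b r W) (hg : Measurable g)
    (hf : Measurable f) : Measurable fun z => amp V W M T (g z) (f z) :=
  measurable_comp_prodMk (F := amp V W M T) (measurable_amp hV hW) hg hf

theorem measurable_amp_left (hV : IsProfile b r V) (hW : IsProfile b r W)
    (x : (ℝ × ℝ) × (ℝ × ℝ)) : Measurable fun α => amp V W M T α x :=
  (measurable_amp hV hW).comp measurable_prodMk_right

theorem measurable_amp_right (hV : IsProfile b r V) (hW : IsProfile b r W) (α : ℝ × ℝ) :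
    Measurable (amp V W M T α) :=
  (measurable_amp hV hW).comp measurable_prodMk_left

theorem integrable_amp_cubeAt (hV : IsProfile b r V) (hW : IsProfile b r W) (α : ℝ × ℝ)
    (p : (ℤ × ℤ) × (ℤ × ℤ)) : Integrable (amp V W M T α) (volume.restrict (cubeAt p)) :=
  Integrable.of_bound (measurable_amp_right hV hW α).aestronglyMeasurable (b ^ 2)
    (Filter.Eventually.of_forall fun _ => abs_amp_le hV hW)

theorem measurable_defect (hV : IsProfile b r V) (hW : IsProfile b r W)
    (p : (ℤ × ℤ) × (ℤ × ℤ)) : Measurable fun α => defect V W M T α p :=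
  (measurable_amp_left hV hW _).sub
    ((measurable_amp hV hW).stronglyMeasurable.integral_prod_right
      (ν := volume.restrict (cubeAt p))).measurable

theorem defect_eq (hV : IsProfile b r V) (hW : IsProfile b r W) :
    defect V W M T α p = ∫ x in cubeAt p, (amp V W M T α (pt p) - amp V W M T α x) := by
  rw [integral_sub (integrable_const _) (integrable_amp_cubeAt hV hW α p), integral_const]
  simp [defect]

theorem abs_amp_pt_le (hV : IsProfile b r V) (hW : IsProfile b r W) (hT : 0 < T) (hα : α ∈ box R) :
    |amp V W M T α (pt p)| ≤
      b ^ 2 * (pointCell R (r * R / T) p).indicator (1 : ℝ × ℝ → ℝ) α := by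
  by_cases h : amp V W M T α (pt p) = 0
  · rw [h, abs_zero]
    exact mul_nonneg (sq_nonneg b) (indicator_pointCell_nonneg _ _ _ _)
  · rw [Set.indicator_of_mem (mem_pointCell.mpr ⟨hα, abs_lag_le_of_amp_ne_zero hW hT hα h⟩)]
    simpa using abs_amp_le hV hW

theorem abs_defect_le (hV : IsProfile b r V) (hW : IsProfile b r W) (hT : 0 < T)
    (hα : α ∈ box R) : |defect V W M T α p| ≤ b ^ 2 * pointMass R (r * R / T) α p := by
  refine (abs_sub _ _).trans ?_
  rw [pointMass, mul_add]
  refine add_le_add (abs_amp_pt_le hV hW hT hα) ?_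
  set S := {x : (ℝ × ℝ) × (ℝ × ℝ) | |lag α x| ≤ r * R / T}
  have hS : MeasurableSet S := measurableSet_lag_le _ _
  have h1 : ∀ x, ‖amp V W M T α x‖ ≤ S.indicator (fun _ => b ^ 2) x := by
    intro x
    by_cases h : amp V W M T α x = 0
    · rw [h, norm_zero]
      exact Set.indicator_nonneg (fun _ _ => sq_nonneg b) _
    · rw [Set.indicator_of_mem (show x ∈ S from abs_lag_le_of_amp_ne_zero hW hT hα h)]
      exact abs_amp_le hV hW
  have h2 := norm_integral_le_of_norm_le (μ := volume.restrict (cubeAt p))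
    ((integrable_const (b ^ 2)).indicator hS) (Filter.Eventually.of_forall h1)
  rw [integral_indicator hS, setIntegral_const, measureReal_restrict_apply hS, Set.inter_comm,
    smul_eq_mul, mul_comm] at h2
  exact h2

theorem corr_eq_box (V W : ℝ → ℝ) (M T R : ℝ) (x x' : (ℝ × ℝ) × (ℝ × ℝ)) :
    corr R V W M T x x' = ∫ α in box R, wt R α * (amp V W M T α x * amp V W M T α x') := by
  refine (setIntegral_eq_integral_of_forall_compl_eq_zero fun α hα => ?_).symm
  have : wt R α = 0 := by
    by_contra h
    exact hα (mem_box_of_wt_ne_zero h (by simp))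
  rw [this, zero_mul]

theorem integrable_wt_mul_amp (hV : IsProfile b r V) (hW : IsProfile b r W)
    (x x' : (ℝ × ℝ) × (ℝ × ℝ)) :
    Integrable (fun α => wt R α * (amp V W M T α x * amp V W M T α x'))
      (volume.restrict (box R)) := by
  refine Integrable.of_bound (((continuous_wt R).measurable.mul
    ((measurable_amp_left hV hW x).mul (measurable_amp_left hV hW x'))).aestronglyMeasurable)
    (1 * (b ^ 2 * b ^ 2)) (Filter.Eventually.of_forall fun α => ?_)
  rw [norm_mul, norm_mul]
  have h1 : ‖wt R α‖ ≤ 1 := abs_wt_le_one R α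
  have h2 : ‖amp V W M T α x‖ ≤ b ^ 2 := abs_amp_le hV hW
  have h3 : ‖amp V W M T α x'‖ ≤ b ^ 2 := abs_amp_le hV hW
  gcongr

theorem integral_wt_mul_sub_mul_sub (hV : IsProfile b r V) (hW : IsProfile b r W)
    (x x' y y' : (ℝ × ℝ) × (ℝ × ℝ)) :
    ∫ α in box R, wt R α *
        ((amp V W M T α x - amp V W M T α y) * (amp V W M T α x' - amp V W M T α y')) =
      corr R V W M T x x' - corr R V W M T x y' - (corr R V W M T y x' - corr R V W M T y y') := by
  have hi : ∀ z z', Integrable (fun α => wt R α * (amp V W M T α z * amp V W M T α z'))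
    (volume.restrict (box R)) := integrable_wt_mul_amp hV hW
  simp only [corr_eq_box]
  rw [← integral_sub (hi _ _) (hi _ _), ← integral_sub (hi _ _) (hi _ _)]
  refine Eq.trans ?_ (integral_sub ((hi _ _).sub (hi _ _)) ((hi _ _).sub (hi _ _)))
  refine integral_congr_ae (Filter.Eventually.of_forall fun α => ?_)
  ring

theorem integral_wt_mul_defect (hV : IsProfile b r V) (hW : IsProfile b r W) :
    ∫ α in box R, wt R α * (defect V W M T α p * defect V W M T α p') =
      ∫ z in cubeAt p ×ˢ cubeAt p', ∫ α in box R, wt R α *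
        ((amp V W M T α (pt p) - amp V W M T α z.1) *
          (amp V W M T α (pt p') - amp V W M T α z.2)) := by
  have h1 : ∀ α, wt R α * (defect V W M T α p * defect V W M T α p') =
      ∫ z in cubeAt p ×ˢ cubeAt p', wt R α *
        ((amp V W M T α (pt p) - amp V W M T α z.1) *
          (amp V W M T α (pt p') - amp V W M T α z.2)) := by
    intro α
    rw [integral_const_mul, defect_eq hV hW, defect_eq hV hW, Measure.volume_eq_prod
      (((ℝ × ℝ) × (ℝ × ℝ))) (((ℝ × ℝ) × (ℝ × ℝ))), setIntegral_prod_mul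
      (fun x => amp V W M T α (pt p) - amp V W M T α x)
      (fun x => amp V W M T α (pt p') - amp V W M T α x)]
  simp only [h1]
  refine integral_integral_swap ?_
  have : IsFiniteMeasure (volume.restrict (cubeAt p ×ˢ cubeAt p')) := by
    refine ⟨?_⟩
    rw [Measure.restrict_apply_univ, Measure.volume_eq_prod, Measure.prod_prod, volume_cubeAt,
      volume_cubeAt]
    simp
  have hmeas : Measurable fun w : (ℝ × ℝ) × (((ℝ × ℝ) × (ℝ × ℝ)) × ((ℝ × ℝ) × (ℝ × ℝ))) =>
      wt R w.1 * ((amp V W M T w.1 (pt p) - amp V W M T w.1 w.2.1) *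
        (amp V W M T w.1 (pt p') - amp V W M T w.1 w.2.2)) :=
    ((continuous_wt R).measurable.comp measurable_fst).mul
      (((measurable_amp_comp hV hW measurable_fst measurable_const).sub
          (measurable_amp_comp hV hW measurable_fst measurable_snd.fst)).mul
        ((measurable_amp_comp hV hW measurable_fst measurable_const).sub
          (measurable_amp_comp hV hW measurable_fst measurable_snd.snd)))
  refine Integrable.of_bound hmeas.aestronglyMeasurable (1 * ((2 * b ^ 2) * (2 * b ^ 2)))
    (Filter.Eventually.of_forall fun w => ?_)
  have h3 : ∀ x, |amp V W M T w.1 x| ≤ b ^ 2 := fun x => abs_amp_le hV hW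
  have h2 : ∀ x y, |amp V W M T w.1 x - amp V W M T w.1 y| ≤ 2 * b ^ 2 := fun x y =>
    (abs_sub _ _).trans ((add_le_add (h3 x) (h3 y)).trans_eq (two_mul _).symm)
  change |wt R w.1 * ((amp V W M T w.1 (pt p) - amp V W M T w.1 w.2.1) *
    (amp V W M T w.1 (pt p') - amp V W M T w.1 w.2.2))| ≤ _
  rw [abs_mul, abs_mul]
  exact mul_le_mul (abs_wt_le_one _ _) (mul_le_mul (h2 _ _) (h2 _ _) (abs_nonneg _)
    (by positivity)) (by positivity) zero_le_one

theorem abs_integral_wt_mul_defect_le (hV : IsProfile b r V) (hW : IsProfile b r W) (hr : 0 ≤ r)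
    (hR : 1 ≤ R) (hM : 0 < M) (hT : 0 < T) (hρ : 0 ≤ ρ) (hE : 0 < E) (hEM : E ≤ M ^ 4)
    (hp : ‖pt p‖ + 1 ≤ ρ * M) (hp' : ‖pt p'‖ + 1 ≤ ρ * M)
    (hd : E + 128 * (ρ * M) ^ 3 ≤ |detOf (pt p) (pt p')|)
    (hs : 96 * R * ρ ^ 3 * (M ^ 3 / E) ≤ 1 / 8) :
    |∫ α in box R, wt R α * (defect V W M T α p * defect V W M T α p')| ≤
      2 * corrConst b r R ρ * (M ^ 3 / (E ^ 2 * T ^ 2)) := by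
  have hvol : volume (cubeAt p ×ˢ cubeAt p') = 1 := by
    rw [Measure.volume_eq_prod, Measure.prod_prod, volume_cubeAt, volume_cubeAt, one_mul]
  have norm_le : ∀ {q x}, x ∈ cubeAt q → ‖pt q‖ + 1 ≤ ρ * M → ‖x‖ ≤ ρ * M := by
    intro q x hx hq
    have := norm_le_norm_add_norm_sub' x (pt q)
    linarith [norm_sub_pt_le hx]
  have norm_pt : ∀ {q : (ℤ × ℤ) × (ℤ × ℤ)}, ‖pt q‖ + 1 ≤ ρ * M → ‖pt q‖ ≤ ρ * M := by
    intro q hq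
    linarith
  have le_det : ∀ {x x' : (ℝ × ℝ) × (ℝ × ℝ)}, ‖x‖ ≤ ρ * M → ‖x'‖ ≤ ρ * M → ‖x - pt p‖ ≤ 1 →
      ‖x' - pt p'‖ ≤ 1 → E ≤ |detOf x x'| := by
    intro x x' h1 h2 h3 h4
    have h5 := abs_detOf_sub_le (η := 1) (norm_pt hp) (norm_pt hp') h1 h2 (by rwa [norm_sub_rev])
      (by rwa [norm_sub_rev])
    have h6 := abs_sub_abs_le_abs_sub (detOf (pt p) (pt p')) (detOf x x')
    linarith
  rw [integral_wt_mul_defect hV hW]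
  have key : ∀ z ∈ cubeAt p ×ˢ cubeAt p', ‖∫ α in box R, wt R α *
        ((amp V W M T α (pt p) - amp V W M T α z.1) *
          (amp V W M T α (pt p') - amp V W M T α z.2))‖ ≤
      2 * corrConst b r R ρ * (M ^ 3 / (E ^ 2 * T ^ 2)) := by
    rintro ⟨x, x'⟩ ⟨hx, hx'⟩
    have b1 := norm_le hx hp
    have b2 := norm_le hx' hp'
    have b3 := norm_sub_pt_le hx
    have b4 := norm_sub_pt_le hx'
    have b5 : ‖pt p' - x'‖ ≤ 1 := by rwa [norm_sub_rev]
    have z1 : ‖pt p - pt p‖ ≤ 1 := by simp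
    have z2 : ‖pt p' - pt p'‖ ≤ 1 := by simp
    have z3 : ‖x - x‖ ≤ 1 := by simp
    rw [integral_wt_mul_sub_mul_sub hV hW]
    have c1 := abs_corr_sub_le hV hW hr hR hM hT hρ hE hEM (le_det (norm_pt hp) (norm_pt hp') z1 z2)
      (le_det (norm_pt hp) b2 z1 b4) (norm_pt hp) (norm_pt hp') (norm_pt hp) b2 z1 b5 hs
    have c2 := abs_corr_sub_le hV hW hr hR hM hT hρ hE hEM (le_det b1 (norm_pt hp') b3 z2)
      (le_det b1 b2 b3 b4) b1 (norm_pt hp') b1 b2 z3 b5 hs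
    refine (norm_sub_le _ _).trans ((add_le_add c1 c2).trans (le_of_eq (by ring)))
  have := norm_setIntegral_le_of_norm_le_const (by rw [hvol]; simp) key
  rwa [Measure.real, hvol, ENNReal.toReal_one, mul_one] at this

end defect

section defect

variable {V W : ℝ → ℝ} {b r M T R ρ E : ℝ} {α : ℝ × ℝ} {p p' : (ℤ × ℤ) × (ℤ × ℤ)}

theorem abs_defect_le_const (hV : IsProfile b r V) (hW : IsProfile b r W) :
    |defect V W M T α p| ≤ 2 * b ^ 2 := by
  have h1 : |∫ x in cubeAt p, amp V W M T α x| ≤ b ^ 2 := by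
    have := norm_integral_le_of_norm_le_const (μ := volume.restrict (cubeAt p))
      (f := amp V W M T α) (C := b ^ 2) (Filter.Eventually.of_forall fun x => abs_amp_le hV hW)
    simpa using this
  have h2 := abs_amp_le (M := M) (T := T) (α := α) (x := pt p) hV hW
  exact (abs_sub _ _).trans (by linarith)

theorem integrable_wt_mul_defect (hV : IsProfile b r V) (hW : IsProfile b r W)
    (p p' : (ℤ × ℤ) × (ℤ × ℤ)) :
    Integrable (fun α => wt R α * (defect V W M T α p * defect V W M T α p'))
      (volume.restrict (box R)) := by
  refine Integrable.of_bound ((continuous_wt R).measurable.mul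
    ((measurable_defect hV hW p).mul (measurable_defect hV hW p'))).aestronglyMeasurable
    (1 * ((2 * b ^ 2) * (2 * b ^ 2))) (Filter.Eventually.of_forall fun α => ?_)
  rw [norm_mul, norm_mul]
  exact mul_le_mul (abs_wt_le_one _ _) (mul_le_mul (abs_defect_le_const hV hW)
    (abs_defect_le_const hV hW) (norm_nonneg _) (by positivity)) (by positivity) zero_le_one

theorem integral_wt_mul_sq_sum_defect_le {s : Finset ((ℤ × ℤ) × (ℤ × ℤ))} {A X : ℝ}
    (hV : IsProfile b r V) (hW : IsProfile b r W) (hb : 1 ≤ b) (hT : 0 < T) (hA : 0 ≤ A)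
    (hnd : ∀ p ∈ s, ∀ p' ∈ s, ¬ degenerate E p p' →
      |∫ α in box R, wt R α * (defect V W M T α p * defect V W M T α p')| ≤ A)
    (hdeg : ∀ F : ℝ × ℝ → ℝ, (∀ α, 0 ≤ F α) → (∀ α ∈ box R, F α ≤
      ∑ p ∈ s, ∑ p' ∈ s, (if degenerate E p p' then
        pointMass R (r * R / T) α p * pointMass R (r * R / T) α p' else 0)) →
      ∫ α in box R, F α ≤ X) :
    ∫ α in box R, wt R α * (∑ p ∈ s, defect V W M T α p) ^ 2 ≤
      (s.card : ℝ) ^ 2 * A + b ^ 4 * X := by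
  have hb4 : 0 < b ^ 4 := by positivity
  set d := fun (α : ℝ × ℝ) p p' => wt R α * (defect V W M T α p * defect V W M T α p') with hd
  have hi : ∀ p p', Integrable (fun α => d α p p') (volume.restrict (box R)) :=
    fun p p' => integrable_wt_mul_defect hV hW p p'
  have hi1 : ∀ p p', Integrable (fun α => if degenerate E p p' then 0 else d α p p')
      (volume.restrict (box R)) := by
    intro p p'
    split_ifs
    · exact integrable_zero _ _ _
    · exact hi p p'
  have hi2 : ∀ p p', Integrable (fun α => if degenerate E p p' then d α p p' else 0)
      (volume.restrict (box R)) := by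
    intro p p'
    split_ifs
    · exact hi p p'
    · exact integrable_zero _ _ _
  have hI1 : Integrable (fun α => ∑ p ∈ s, ∑ p' ∈ s, if degenerate E p p' then 0 else d α p p')
      (volume.restrict (box R)) :=
    integrable_finsetSum _ fun p _ => integrable_finsetSum _ fun p' _ => hi1 p p'
  have hI2 : Integrable (fun α => ∑ p ∈ s, ∑ p' ∈ s, if degenerate E p p' then d α p p' else 0)
      (volume.restrict (box R)) :=
    integrable_finsetSum _ fun p _ => integrable_finsetSum _ fun p' _ => hi2 p p'
  have split : ∀ α, wt R α * (∑ p ∈ s, defect V W M T α p) ^ 2 =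
      (∑ p ∈ s, ∑ p' ∈ s, if degenerate E p p' then 0 else d α p p') +
        ∑ p ∈ s, ∑ p' ∈ s, if degenerate E p p' then d α p p' else 0 := by
    intro α
    rw [sq, Finset.sum_mul_sum, Finset.mul_sum, ← Finset.sum_add_distrib]
    refine Finset.sum_congr rfl fun p _ => ?_
    rw [Finset.mul_sum, ← Finset.sum_add_distrib]
    refine Finset.sum_congr rfl fun p' _ => ?_
    split_ifs <;> simp [hd]
  simp only [split]
  rw [integral_add hI1 hI2]
  refine add_le_add ?_ ?_
  · rw [integral_finsetSum _ fun p _ => integrable_finsetSum _ fun p' _ => hi1 p p']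
    calc _ ≤ ∑ _p ∈ s, (s.card : ℝ) * A := by
          refine Finset.sum_le_sum fun p hp => ?_
          rw [integral_finsetSum _ fun p' _ => hi1 p p', ← nsmul_eq_mul, ← Finset.sum_const]
          refine Finset.sum_le_sum fun p' hp' => ?_
          by_cases hE : degenerate E p p'
          · simpa [hE] using hA
          · simpa [hE] using (le_abs_self _).trans (hnd p hp p' hp' hE)
      _ = _ := by rw [Finset.sum_const, nsmul_eq_mul]; ring
  · set B := fun α => ∑ p ∈ s, ∑ p' ∈ s, if degenerate E p p' then d α p p' else 0
    have h1 : ∀ α ∈ box R, |B α| ≤ b ^ 4 * ∑ p ∈ s, ∑ p' ∈ s, (if degenerate E p p' then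
        pointMass R (r * R / T) α p * pointMass R (r * R / T) α p' else 0) := by
      intro α hα
      rw [Finset.mul_sum]
      refine (Finset.abs_sum_le_sum_abs _ _).trans (Finset.sum_le_sum fun p _ => ?_)
      rw [Finset.mul_sum]
      refine (Finset.abs_sum_le_sum_abs _ _).trans (Finset.sum_le_sum fun p' _ => ?_)
      split_ifs
      · rw [hd, abs_mul, abs_mul]
        calc _ ≤ 1 * ((b ^ 2 * pointMass R (r * R / T) α p) *
              (b ^ 2 * pointMass R (r * R / T) α p')) := by
              have q1 := pointMass_nonneg R (r * R / T) α p
              gcongr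
              · exact abs_wt_le_one _ _
              · exact abs_defect_le hV hW hT hα
              · exact abs_defect_le hV hW hT hα
          _ = _ := by ring
      · simp
    have h2 := hdeg (fun α => |B α| / b ^ 4) (fun α => by positivity) fun α hα => by
      rw [div_le_iff₀ hb4, mul_comm]
      exact h1 α hα
    rw [integral_div, div_le_iff₀ hb4, mul_comm] at h2
    exact (integral_mono hI2 hI2.abs fun α => le_abs_self _).trans h2

end defect

/-- The integer points of a box lying off the two diagonals. -/
noncomputable def offDiagPts (N : ℕ) : Finset ((ℤ × ℤ) × (ℤ × ℤ)) :=
  (latticeBox N).filter fun p => p.1 ≠ p.2 ∧ p.1 ≠ -p.2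

theorem offDiag_of_mem_goodPts {N : ℕ} {p : (ℤ × ℤ) × (ℤ × ℤ)} (h : p ∈ goodPts N) :
    p.1 ≠ p.2 ∧ p.1 ≠ -p.2 := by
  have h1 := (mem_nzQuads.mp (Finset.mem_filter.mp h).2).1
  simp only [quad, mem_nzInts] at h1
  constructor
  · intro h2
    exact h1.1.1 (by rw [h2, sub_self])
  · intro h2
    exact h1.2.1 (by rw [h2, Prod.fst_neg, neg_add_cancel])

theorem sum_offDiagPts (N : ℕ) (l : ℝ) (f : (ℤ × ℤ) × (ℤ × ℤ) → ℝ) :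
    ∑ p ∈ offDiagPts N, f p =
      ∑ p ∈ badPts N, f p + ∑ p ∈ smallPts N l, f p + ∑ p ∈ largePts N l, f p := by
  have h1 : (offDiagPts N).filter (· ∈ goodPts N) = goodPts N := by
    ext p
    simp only [Finset.mem_filter, offDiagPts, and_iff_right_iff_imp]
    exact fun h => ⟨(Finset.mem_filter.mp h).1, offDiag_of_mem_goodPts h⟩
  have h2 : (offDiagPts N).filter (· ∉ goodPts N) = badPts N := by
    rw [offDiagPts, badPts, Finset.filter_filter]
  rw [← Finset.sum_filter_add_sum_filter_not (offDiagPts N) (· ∈ goodPts N), h1, h2,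
    ← Finset.sum_filter_add_sum_filter_not (goodPts N) (fun p => largeQuad l (quad p))]
  rw [smallPts, largePts]
  ring

section decomposition

variable {V W : ℝ → ℝ} {b r M T R l : ℝ} {N : ℕ} {α : ℝ × ℝ}

theorem Gsum_eq (hV : IsProfile b r V) (hW : IsProfile b r W) (hr : 1 ≤ r) (hR : 1 ≤ R)
    (hM : 1 ≤ M) (hT : 1 ≤ T) (hN : 8 * r * R * M ≤ N) (hα : α ∈ box R) :
    Gsum V W α M T = 1 / 4 * ∑ p ∈ offDiagPts N, amp V W M T α (pt p) := by
  have hterm : ∀ p : (ℤ × ℤ) × (ℤ × ℤ), W (T * (qf α p.1.1 p.1.2 - qf α p.2.1 p.2.2) / Dfun α) *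
      V (qf α p.1.1 p.1.2 / (M ^ 2 * Dfun α)) = amp V W M T α (pt p) := fun p => rfl
  rw [Gsum]
  simp only [hterm]
  rw [offDiagPts, Finset.sum_filter, tsum_eq_sum]
  intro p hp
  rw [mem_latticeBox_iff_norm] at hp
  split_ifs
  · by_contra h
    exact hp ((norm_le_of_amp_ne_zero hV hW hr hR hM hT hα h).trans hN)
  · rfl

theorem mem_thinSet_of_notMem (hV : IsProfile b r V) (hW : IsProfile b r W) (hr : 1 ≤ r)
    (hR : 1 ≤ R) (hM : 1 ≤ M) (hT : 1 ≤ T) (hl : 0 ≤ l) (hN : 8 * r * R * M + 1 ≤ N)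
    (hα : α ∈ box R) {x : (ℝ × ℝ) × (ℝ × ℝ)} (hx : x ∉ ⋃ p ∈ largePts N l, cubeAt p)
    (h : amp V W M T α x ≠ 0) : x ∈ thinSet α (r * R / T) (8 * r * R * M) (l + 2) := by
  have hn := norm_le_of_amp_ne_zero hV hW hr hR hM hT hα h
  refine ⟨hn, abs_lag_le_of_amp_ne_zero hW (by linarith) hα h, ?_⟩
  set p := floorPt x with hp
  have hxp : x ∈ cubeAt p := mem_cubeAt_iff.mpr rfl
  have hd := norm_sub_pt_le hxp
  have hpN : p ∈ latticeBox N := by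
    rw [mem_latticeBox_iff_norm]
    have := norm_le_norm_add_norm_sub x (pt p)
    linarith
  have hpl : p ∉ largePts N l := fun h' => hx (Set.mem_biUnion (Finset.mem_coe.mpr h') hxp)
  have hnl : ¬ ((l < |((quad p).1.1 : ℝ)| ∧ l < |((quad p).1.2 : ℝ)|) ∧
      l < |((quad p).2.1 : ℝ)| ∧ l < |((quad p).2.2 : ℝ)|) := by
    rintro ⟨⟨a1, a2⟩, a3, a4⟩
    have ne : ∀ {z : ℤ}, l < |(z : ℝ)| → z ≠ 0 := by
      rintro z hz rfl
      simp at hz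
      linarith
    exact hpl (Finset.mem_filter.mpr ⟨Finset.mem_filter.mpr ⟨hpN,
      quad_mem_nzQuads hpN ⟨⟨ne a1, ne a2⟩, ne a3, ne a4⟩⟩, ⟨a1.le, a2.le⟩, a3.le, a4.le⟩)
  obtain ⟨⟨d1, d2⟩, d3, d4⟩ := norm_pair_le_iff.mp hd
  have close : ∀ {s t : ℝ} {u v : ℝ}, |s - u| ≤ 1 → |t - v| ≤ 1 →
      |s - t| ≤ |u - v| + 2 ∧ |s + t| ≤ |u + v| + 2 := by
    intro s t u v h1 h2
    constructor
    · have e : s - t = (u - v) + (s - u) - (t - v) := by ring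
      rw [e]
      linarith [abs_sub (u - v + (s - u)) (t - v), abs_add_le (u - v) (s - u)]
    · have e : s + t = (u + v) + (s - u) + (t - v) := by ring
      rw [e]
      linarith [abs_add_le (u + v + (s - u)) (t - v), abs_add_le (u + v) (s - u)]
  obtain ⟨c1, c2⟩ := close d1 d3
  obtain ⟨c3, c4⟩ := close d2 d4
  simp only [pt] at c1 c2 c3 c4
  simp only [quad, Int.cast_sub, Int.cast_add] at hnl
  simp only [Prod.fst_sub, Prod.snd_sub, Prod.fst_add, Prod.snd_add]
  by_contra hcon
  push Not at hcon
  obtain ⟨⟨e1, e2⟩, e3, e4⟩ := hcon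
  exact hnl ⟨⟨by linarith, by linarith⟩, by linarith, by linarith⟩

theorem abs_integral_sub_sum_le (hV : IsProfile b r V) (hW : IsProfile b r W) (hr : 1 ≤ r)
    (hR : 1 ≤ R) (hM : 1 ≤ M) (hT : 1 ≤ T) (hl : 0 ≤ l) (hN : 8 * r * R * M + 1 ≤ N)
    (hα : α ∈ box R) :
    |(∫ x, amp V W M T α x) - ∑ p ∈ largePts N l, ∫ x in cubeAt p, amp V W M T α x| ≤
      b ^ 2 * (2048 * (8 * r * R * M) * (r * R / T) * √(l + 2) * √(8 * r * R * M)) := by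
  have hi := integrable_amp hV hW hr hR hM hT hα
  set U := ⋃ p ∈ largePts N l, cubeAt p with hU
  have hUm : MeasurableSet U := Finset.measurableSet_biUnion _ fun p _ => measurableSet_cubeAt p
  have h1 : ∫ x in U, amp V W M T α x = ∑ p ∈ largePts N l, ∫ x in cubeAt p, amp V W M T α x :=
    integral_biUnion_finset _ (fun p _ => measurableSet_cubeAt p)
      (fun p _ p' _ h => pairwise_disjoint_cubeAt h) fun p _ => hi.integrableOn
  rw [← h1, ← integral_add_compl hUm hi, add_sub_cancel_left]
  set S := thinSet α (r * R / T) (8 * r * R * M) (l + 2)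
  have hr0 : 0 ≤ r := by linarith
  have hT0 : 0 < T := by linarith
  have hM0 : 0 ≤ M := by linarith
  have hvol : volume S ≤ _ := volume_thinSet_le (s := l + 2) (P := 8 * r * R * M) hα
    (show 0 ≤ r * R / T by positivity) (by positivity)
  have h2 : ∫ x in Uᶜ, amp V W M T α x = ∫ x in Uᶜ ∩ S, amp V W M T α x := by
    refine setIntegral_eq_of_subset_of_forall_sdiff_eq_zero hUm.compl Set.inter_subset_left ?_
    intro x hx
    by_contra h
    exact hx.2 ⟨hx.1, mem_thinSet_of_notMem hV hW hr hR hM hT hl hN hα hx.1 h⟩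
  have hle : volume (Uᶜ ∩ S) ≤ _ := (measure_mono Set.inter_subset_right).trans hvol
  rw [h2]
  refine (norm_setIntegral_le_of_norm_le_const (f := amp V W M T α) (C := b ^ 2)
    (hle.trans_lt ENNReal.ofReal_lt_top) fun x _ => abs_amp_le hV hW).trans ?_
  refine mul_le_mul_of_nonneg_left ?_ (sq_nonneg b)
  exact ENNReal.toReal_le_of_le_ofReal (by positivity) hle

/-- The pointwise majorant of the squared error term. -/
noncomputable def errBound (V W : ℝ → ℝ) (b r M T R l : ℝ) (N : ℕ) (α : ℝ × ℝ) : ℝ :=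
  b ^ 4 * (∑ p ∈ badPts N, (pointCell R (r * R / T) p).indicator (1 : ℝ × ℝ → ℝ) α) ^ 2 +
  b ^ 4 * (∑ p ∈ smallPts N l, (pointCell R (r * R / T) p).indicator (1 : ℝ × ℝ → ℝ) α) ^ 2 +
  wt R α * (∑ p ∈ largePts N l, defect V W M T α p) ^ 2 +
  ((b ^ 2 * (2048 * (8 * r * R * M) * (r * R / T) * √(l + 2) * √(8 * r * R * M))) ^ 2 +
    (4 * (b * r) ^ 2 / T ^ 2) ^ 2)

theorem sq_sum_amp_le (hV : IsProfile b r V) (hW : IsProfile b r W) (hT : 0 < T) (hα : α ∈ box R)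
    (s : Finset ((ℤ × ℤ) × (ℤ × ℤ))) :
    (∑ p ∈ s, amp V W M T α (pt p)) ^ 2 ≤
      b ^ 4 * (∑ p ∈ s, (pointCell R (r * R / T) p).indicator (1 : ℝ × ℝ → ℝ) α) ^ 2 := by
  have h : |∑ p ∈ s, amp V W M T α (pt p)| ≤
      b ^ 2 * ∑ p ∈ s, (pointCell R (r * R / T) p).indicator (1 : ℝ × ℝ → ℝ) α := by
    rw [Finset.mul_sum]
    exact (Finset.abs_sum_le_sum_abs _ _).trans
      (Finset.sum_le_sum fun p _ => abs_amp_pt_le hV hW hT hα)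
  calc _ = |∑ p ∈ s, amp V W M T α (pt p)| ^ 2 := (sq_abs _).symm
    _ ≤ _ := pow_le_pow_left₀ (abs_nonneg _) h 2
    _ = _ := by ring

theorem sq_Gsum_sub_le (hV : IsProfile b r V) (hW : IsProfile b r W) (hr : 1 ≤ r)
    (hR : 1 ≤ R) (hM : 1 ≤ M) (hT : 1 ≤ T) (hl : 0 ≤ l) (hN : 8 * r * R * M + 1 ≤ N)
    (hα : α ∈ box R) (hw : wt R α = 1) :
    |Gsum V W α M T - (∫ x in Set.Ioi (0 : ℝ), V x) * (∫ x, W x) * M ^ 2 / T| ^ 2 ≤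
      errBound V W b r M T R l N α := by
  have hT0 : 0 < T := by linarith
  rw [sq_abs, Gsum_eq hV hW hr hR hM hT (by linarith) hα, sum_offDiagPts N l, errBound, hw, one_mul]
  have s1 := sq_sum_amp_le (M := M) hV hW hT0 hα (badPts N)
  have s2 := sq_sum_amp_le (M := M) hV hW hT0 hα (smallPts N l)
  have s4 := abs_integral_sub_sum_le hV hW hr hR hM hT hl hN hα
  have s5 := abs_integral_amp_sub_le hV hW hr hR hM hT hα
  have s3 : ∑ p ∈ largePts N l, amp V W M T α (pt p) = ∑ p ∈ largePts N l, defect V W M T α p +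
      ∑ p ∈ largePts N l, ∫ x in cubeAt p, amp V W M T α x := by
    rw [← Finset.sum_add_distrib]
    exact Finset.sum_congr rfl fun p _ => (sub_add_cancel _ _).symm
  rw [s3]
  set A := ∑ p ∈ badPts N, amp V W M T α (pt p)
  set B := ∑ p ∈ smallPts N l, amp V W M T α (pt p)
  set D := ∑ p ∈ largePts N l, defect V W M T α p
  set I := ∑ p ∈ largePts N l, ∫ x in cubeAt p, amp V W M T α x
  set J := ∫ x, amp V W M T α x
  set m := (∫ x in Set.Ioi (0 : ℝ), V x) * (∫ x, W x) * M ^ 2 / T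
  have q4 := pow_le_pow_left₀ (abs_nonneg _) s4 2
  have q5 := pow_le_pow_left₀ (abs_nonneg _) s5 2
  rw [sq_abs] at q4 q5
  have key : (1 / 4 * (A + B + (D + I)) - m) ^ 2 ≤
      A ^ 2 + B ^ 2 + D ^ 2 + ((J - I) ^ 2 + (J - 4 * m) ^ 2) := by
    set X := J - I with hX
    set Y := J - 4 * m with hY
    have e : 1 / 4 * (A + B + (D + I)) - m = (A + B + D - X + Y) / 4 := by
      rw [hX, hY]; ring
    rw [e]
    nlinarith [sq_nonneg (A - B), sq_nonneg (A - D), sq_nonneg (A + X), sq_nonneg (A - Y),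
      sq_nonneg (B - D), sq_nonneg (B + X), sq_nonneg (B - Y), sq_nonneg (D + X),
      sq_nonneg (D - Y), sq_nonneg (X + Y), sq_nonneg A, sq_nonneg B, sq_nonneg D, sq_nonneg X,
      sq_nonneg Y]
  linarith

end decomposition

section integral

variable {V W : ℝ → ℝ} {b r M T R l ε : ℝ} {N : ℕ}

theorem pointCell_subset_box (R δ : ℝ) (p : (ℤ × ℤ) × (ℤ × ℤ)) : pointCell R δ p ⊆ box R :=
  fun _ h => (mem_pointCell.mp h).1

theorem integrable_sq_sum_pointCell (R δ : ℝ) (s : Finset ((ℤ × ℤ) × (ℤ × ℤ))) :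
    Integrable (fun α => (∑ p ∈ s, (pointCell R δ p).indicator (1 : ℝ × ℝ → ℝ) α) ^ 2)
      (volume.restrict (box R)) := by
  have hm : Measurable fun α => ∑ p ∈ s, (pointCell R δ p).indicator (1 : ℝ × ℝ → ℝ) α :=
    Finset.measurable_fun_sum _ fun p _ => measurable_one.indicator (measurableSet_pointCell R δ p)
  refine Integrable.of_bound (hm.pow_const 2).aestronglyMeasurable ((s.card : ℝ) ^ 2)
    (Filter.Eventually.of_forall fun α => ?_)
  rw [Real.norm_eq_abs, abs_of_nonneg (sq_nonneg _)]
  refine pow_le_pow_left₀ (Finset.sum_nonneg fun p _ => indicator_pointCell_nonneg R δ α p) ?_ 2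
  refine (Finset.sum_le_card_nsmul _ _ 1 fun p _ => ?_).trans (by simp)
  exact Set.indicator_le_self' (fun _ _ => zero_le_one) α

theorem integrable_wt_mul_sq_sum_defect (hV : IsProfile b r V) (hW : IsProfile b r W)
    (s : Finset ((ℤ × ℤ) × (ℤ × ℤ))) :
    Integrable (fun α => wt R α * (∑ p ∈ s, defect V W M T α p) ^ 2)
      (volume.restrict (box R)) := by
  have h : ∀ α, wt R α * (∑ p ∈ s, defect V W M T α p) ^ 2 =
      ∑ p ∈ s, ∑ p' ∈ s, wt R α * (defect V W M T α p * defect V W M T α p') := fun α => by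
    rw [sq, Finset.sum_mul_sum, Finset.mul_sum]
    exact Finset.sum_congr rfl fun p _ => Finset.mul_sum _ _ _
  simp only [h]
  exact integrable_finsetSum _ fun p _ => integrable_finsetSum _ fun p' _ =>
    integrable_wt_mul_defect hV hW p p'

theorem errBound_nonneg (V W : ℝ → ℝ) (b r M T R l : ℝ) (N : ℕ) (α : ℝ × ℝ) :
    0 ≤ errBound V W b r M T R l N α := by
  have := wt_nonneg R α
  unfold errBound
  positivity

theorem integrable_errBound (hV : IsProfile b r V) (hW : IsProfile b r W) :
    Integrable (errBound V W b r M T R l N) (volume.restrict (box R)) :=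
  ((((integrable_sq_sum_pointCell R _ _).const_mul _).add
    ((integrable_sq_sum_pointCell R _ _).const_mul _)).add
    (integrable_wt_mul_sq_sum_defect hV hW _)).add (integrable_const _)

theorem integral_errBound (hV : IsProfile b r V) (hW : IsProfile b r W) :
    ∫ α in box R, errBound V W b r M T R l N α =
      b ^ 4 * (∫ α in box R,
        (∑ p ∈ badPts N, (pointCell R (r * R / T) p).indicator (1 : ℝ × ℝ → ℝ) α) ^ 2) +
      b ^ 4 * (∑ p ∈ smallPts N l, ∑ p' ∈ smallPts N l,
        pairMeas R (r * R / T) (quad p) (quad p')) +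
      (∫ α in box R, wt R α * (∑ p ∈ largePts N l, defect V W M T α p) ^ 2) +
      volume.real (box R) *
        ((b ^ 2 * (2048 * (8 * r * R * M) * (r * R / T) * √(l + 2) * √(8 * r * R * M))) ^ 2 +
          (4 * (b * r) ^ 2 / T ^ 2) ^ 2) := by
  have i1 := (integrable_sq_sum_pointCell R (r * R / T) (badPts N)).const_mul (b ^ 4)
  have i2 := (integrable_sq_sum_pointCell R (r * R / T) (smallPts N l)).const_mul (b ^ 4)
  have i3 := integrable_wt_mul_sq_sum_defect (R := R) (M := M) (T := T) hV hW (largePts N l)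
  have e2 := integral_sq_sum_indicator R (smallPts N l)
    (fun p => measurableSet_pointCell R (r * R / T) p)
    (fun p => pointCell_subset_box R (r * R / T) p)
  refine (integral_add ((i1.add i2).add i3) (integrable_const _)).trans ?_
  rw [integral_add' (i1.add i2) i3, integral_add' i1 i2, integral_const_mul,
    integral_const_mul, e2, integral_const,
    measureReal_restrict_apply MeasurableSet.univ, Set.univ_inter, smul_eq_mul]
  rfl

end integral

section estimates

variable {u T c d n K : ℝ}

theorem sq_mul_lag_le (hT : 1 ≤ T) (hd : 0 ≤ d) (hn : 0 ≤ n) (hnc : n ≤ c * u ^ 44) :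
    n ^ 2 * (d / T) ≤ c ^ 2 * d * (u ^ 88 / T) := by
  calc _ ≤ (c * u ^ 44) ^ 2 * (d / T) := by gcongr
    _ = _ := by ring

theorem cube_mul_sq_lag_le (hu : 1 ≤ u) (hn : 0 ≤ n) (hnc : n ≤ c * u ^ 44) :
    n ^ 3 * u ^ 43 * (d / T) ^ 2 ≤ c ^ 3 * d ^ 2 * (u ^ 175 / T ^ 2) := by
  calc _ ≤ (c * u ^ 44) ^ 3 * u ^ 43 * (d / T) ^ 2 := by gcongr
    _ = _ := by ring

theorem ninth_mul_sq_lag_le (hu : 1 ≤ u) (hc : 1 ≤ c) (hK : 0 ≤ K) (hn : 0 ≤ n)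
    (hnc : n ≤ c * u ^ 44) :
    n ^ 9 * (d / T) ^ 2 / (u ^ 43) ^ 7 * (K * u ^ 77) ≤ c ^ 9 * d ^ 2 * K * (u ^ 175 / T ^ 2) := by
  have hu0 : 0 < u := by linarith
  calc _ ≤ (c * u ^ 44) ^ 9 * (d / T) ^ 2 / (u ^ 43) ^ 7 * (K * u ^ 77) := by gcongr
    _ = c ^ 9 * d ^ 2 * K * (u ^ 172 / T ^ 2) := by
      field_simp
    _ ≤ _ := by gcongr; norm_num

theorem mixed_mul_sq_lag_le (hu : 1 ≤ u) (hT : 1 ≤ T) (hc : 1 ≤ c) (hd : 0 ≤ d) (hK : 0 ≤ K)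
    (hn : 0 ≤ n) (hnc : n ≤ c * u ^ 44) :
    n ^ 2 * (d / T) * (K * u ^ 77) / (u ^ 43) ^ 2 *
        (n ^ 4 * (d / T) / (u ^ 43) ^ 2 + n ^ 3 * (d / T) / u ^ 43) ≤
      2 * c ^ 6 * d ^ 2 * K * (u ^ 175 / T ^ 2) := by
  have hu0 : 0 < u := by linarith
  have hT0 : 0 < T := by linarith
  have h1 : n ^ 2 * (d / T) * (K * u ^ 77) / (u ^ 43) ^ 2 ≤ c ^ 2 * d * K * (u ^ 79 / T) := by
    calc _ ≤ (c * u ^ 44) ^ 2 * (d / T) * (K * u ^ 77) / (u ^ 43) ^ 2 := by gcongr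
      _ = _ := by field_simp
  have h2 : n ^ 4 * (d / T) / (u ^ 43) ^ 2 ≤ c ^ 4 * d * (u ^ 90 / T) := by
    calc _ ≤ (c * u ^ 44) ^ 4 * (d / T) / (u ^ 43) ^ 2 := by gcongr
      _ = _ := by field_simp
  have h3 : n ^ 3 * (d / T) / u ^ 43 ≤ c ^ 4 * d * (u ^ 90 / T) := by
    calc _ ≤ (c * u ^ 44) ^ 3 * (d / T) / u ^ 43 := by gcongr
      _ = c ^ 3 * d * (u ^ 89 / T) := by field_simp
      _ ≤ _ := by gcongr <;> norm_num
  calc _ ≤ c ^ 2 * d * K * (u ^ 79 / T) *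
        (c ^ 4 * d * (u ^ 90 / T) + c ^ 4 * d * (u ^ 90 / T)) := by
        gcongr
    _ = 2 * c ^ 6 * d ^ 2 * K * (u ^ 169 / T ^ 2) := by field_simp; ring
    _ ≤ _ := by gcongr; norm_num

theorem degenerate_scale_le {R : ℝ} (hR : 1 ≤ R) (hu : 1 ≤ u) (hT : 1 ≤ T) (hc : 1 ≤ c)
    (hd : 0 ≤ d) (hn : 0 ≤ n) (hnc : n ≤ c * u ^ 44) :
    144 * R ^ 3 * ((4 * n) ^ 3 * (u ^ 160 + 1024 * n ^ 3) + (4 * n) ^ 5 * (d / T)) /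
        (u ^ 43 / 2) ^ 5 ≤
      4608 * R ^ 3 * (64 * c ^ 3 * (1 + 1024 * c ^ 3) + 1024 * c ^ 5 * d) * u ^ 77 := by
  have hu0 : 0 < u := by linarith
  have h1 : (4 * n) ^ 3 ≤ 64 * c ^ 3 * u ^ 132 := by
    calc _ ≤ (4 * (c * u ^ 44)) ^ 3 := by gcongr
      _ = _ := by ring
  have h2 : 1024 * n ^ 3 ≤ 1024 * c ^ 3 * u ^ 160 := by
    calc _ ≤ 1024 * (c * u ^ 44) ^ 3 := by gcongr
      _ = 1024 * c ^ 3 * u ^ 132 := by ring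
      _ ≤ _ := by gcongr; norm_num
  have h3 : (4 * n) ^ 5 * (d / T) ≤ 1024 * c ^ 5 * d * u ^ 292 := by
    calc _ ≤ (4 * (c * u ^ 44)) ^ 5 * (d / 1) := by gcongr
      _ = 1024 * c ^ 5 * d * u ^ 220 := by ring
      _ ≤ _ := by gcongr; norm_num
  calc _ ≤ 144 * R ^ 3 * (64 * c ^ 3 * u ^ 132 * (u ^ 160 + 1024 * c ^ 3 * u ^ 160) +
        1024 * c ^ 5 * d * u ^ 292) / (u ^ 43 / 2) ^ 5 := by gcongr
    _ = _ := by field_simp; ring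

end estimates

section estimates

variable {V W : ℝ → ℝ} {b r R c : ℝ}

theorem rpow_le_of_le {n u ε : ℝ} (hn : 0 ≤ n) (hc : 0 ≤ c) (hε : 0 ≤ ε)
    (hnc : n ≤ c * u ^ 44) : n ^ ε ≤ c ^ ε * (u ^ 44) ^ ε := by
  rw [← Real.mul_rpow hc (by positivity)]
  exact Real.rpow_le_rpow hn hnc hε

theorem abs_integral_nondegenerate_le (hV : IsProfile b r V) (hW : IsProfile b r W) (hr : 1 ≤ r)
    (hR : 1 ≤ R) (hc : 1 ≤ c) {u T : ℝ} (hu : 1536 * R * (c + 1) ^ 3 ≤ u) (hT : 1 ≤ T) {N : ℕ}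
    (hN : N ≤ c * u ^ 44) {p p' : (ℤ × ℤ) × (ℤ × ℤ)} (hp : ‖pt p‖ ≤ N) (hp' : ‖pt p'‖ ≤ N)
    (hd : ¬ degenerate (u ^ 160) p p') :
    |∫ α in box R, wt R α * (defect V W (u ^ 44) T α p * defect V W (u ^ 44) T α p')| ≤
      8 * corrConst b r R (c + 1) * (u ^ 132 / (u ^ 320 * T ^ 2)) := by
  have hc3 : 1 ≤ (c + 1) ^ 3 := one_le_pow₀ (by linarith)
  have hRc : 1 ≤ R * (c + 1) ^ 3 := one_le_mul_of_one_le_of_one_le hR hc3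
  have hu1 : 1 ≤ u := by nlinarith
  have hu0 : 0 < u := by linarith
  have h28 : u ≤ u ^ 28 := le_self_pow₀ hu1 (by norm_num)
  have hM1 : 1 ≤ u ^ 44 := one_le_pow₀ hu1
  have hρ : ‖pt p‖ + 1 ≤ (c + 1) * u ^ 44 := by linarith
  have hρ' : ‖pt p'‖ + 1 ≤ (c + 1) * u ^ 44 := by linarith
  rw [degenerate_iff, not_le] at hd
  have hc4 : 256 * (c + 1) ^ 3 ≤ u ^ 28 := by nlinarith
  have h1 : u ^ 160 / 2 + 128 * ((c + 1) * u ^ 44) ^ 3 ≤ |detOf (pt p) (pt p')| := by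
    have : 256 * (c + 1) ^ 3 * u ^ 132 ≤ u ^ 28 * u ^ 132 := by gcongr
    have e : u ^ 28 * u ^ 132 = u ^ 160 := by ring
    have e' : ((c + 1) * u ^ 44) ^ 3 = (c + 1) ^ 3 * u ^ 132 := by ring
    rw [e']
    linarith
  have h2 : 96 * R * (c + 1) ^ 3 * ((u ^ 44) ^ 3 / (u ^ 160 / 2)) ≤ 1 / 8 := by
    have e : 96 * R * (c + 1) ^ 3 * ((u ^ 44) ^ 3 / (u ^ 160 / 2)) =
        192 * R * (c + 1) ^ 3 / u ^ 28 := by field_simp; ring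
    rw [e, div_le_iff₀ (by positivity)]
    linarith
  have h3 : u ^ 160 / 2 ≤ (u ^ 44) ^ 4 := by
    have : u ^ 160 ≤ u ^ 176 := pow_le_pow_right₀ hu1 (by norm_num)
    have e : (u ^ 44) ^ 4 = u ^ 176 := by ring
    rw [e]
    linarith [pow_pos hu0 160]
  refine (abs_integral_wt_mul_defect_le hV hW (by linarith) hR (by positivity) (by linarith)
    (by linarith) (by positivity) h3 hρ hρ' h1 h2).trans (le_of_eq ?_)
  field_simp
  ring

theorem integral_large_le (hV : IsProfile b r V) (hW : IsProfile b r W) (hb : 1 ≤ b) (hr : 1 ≤ r)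
    (hR : 1 ≤ R) (hc : 1 ≤ c) {ε : ℝ} (hε : 0 < ε) :
    ∃ C : ℝ, 0 ≤ C ∧ ∀ u T : ℝ, 1536 * R * (c + 1) ^ 3 ≤ u → r * R ≤ T → ∀ N : ℕ, 1 ≤ N →
      N ≤ c * u ^ 44 →
      ∫ α in box R, wt R α * (∑ p ∈ largePts N (u ^ 43), defect V W (u ^ 44) T α p) ^ 2 ≤
        C * ((u ^ 44) ^ ε * (u ^ 175 / T ^ 2 + u ^ 88 / T)) := by
  obtain ⟨C, hC, H⟩ := integral_degenerate_le R ε hR hε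
  set d := r * R with hd
  set K := 4608 * R ^ 3 * (64 * c ^ 3 * (1 + 1024 * c ^ 3) + 1024 * c ^ 5 * d) with hK
  have hd1 : 1 ≤ d := one_le_mul_of_one_le_of_one_le hr hR
  have hK1 : 1 ≤ K := by
    have h1 : 1 ≤ R ^ 3 := one_le_pow₀ hR
    have h2 : 1 ≤ c ^ 3 := one_le_pow₀ hc
    have h3 : 0 ≤ 1024 * c ^ 5 * d := by positivity
    have h4 : 1 ≤ 64 * c ^ 3 * (1 + 1024 * c ^ 3) + 1024 * c ^ 5 * d := by nlinarith
    exact one_le_mul_of_one_le_of_one_le (by linarith) h4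
  have hQ := corrConst_nonneg (b := b) (r := r) (R := R) (ρ := c + 1) (by linarith) (by linarith)
    (by linarith)
  set Q := corrConst b r R (c + 1)
  have hcε : 0 ≤ c ^ ε := by positivity
  refine ⟨52488 * c ^ 8 * Q + b ^ 4 * (C * c ^ ε * (c ^ 9 * d ^ 2 * K + c ^ 2 * d) +
    C * (2 * c ^ 6 * d ^ 2 * K)), by positivity, fun u T hu hT N hN hNc => ?_⟩
  have hc3 : 1 ≤ (c + 1) ^ 3 := one_le_pow₀ (by linarith)
  have hRc : 1 ≤ R * (c + 1) ^ 3 := one_le_mul_of_one_le_of_one_le hR hc3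
  have hu4 : 4 ≤ u := by nlinarith
  have hu1 : 1 ≤ u := by linarith
  have hu0 : 0 < u := by linarith
  have hT1 : 1 ≤ T := by linarith
  have hT0 : 0 < T := by linarith
  have hN0 : (0 : ℝ) ≤ N := by positivity
  have hl4 : 4 ≤ u ^ 43 := hu4.trans (le_self_pow₀ hu1 (by norm_num))
  have hP1 : 1 ≤ (u ^ 44) ^ ε := Real.one_le_rpow (one_le_pow₀ hu1) hε.le
  have hY1 : 1 ≤ K * u ^ 77 := one_le_mul_of_one_le_of_one_le hK1 (one_le_pow₀ hu1)
  have main := integral_wt_mul_sq_sum_defect_le (M := u ^ 44) (E := u ^ 160)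
    (s := largePts N (u ^ 43))
    (A := 8 * Q * (u ^ 132 / (u ^ 320 * T ^ 2))) hV hW hb hT0 (by positivity)
    (fun p hp p' hp' h => abs_integral_nondegenerate_le hV hW hr hR hc hu hT1 hNc
      (mem_largePts hp).1 (mem_largePts hp').1 h)
    (H N hN (u ^ 43) (d / T) (u ^ 160) (K * u ^ 77) hl4 (by positivity)
      ((div_le_one hT0).mpr hT) hY1 (by positivity)
      (degenerate_scale_le hR hu1 hT1 hc (by positivity) hN0 hNc))
  have hcard : ((largePts N (u ^ 43)).card : ℝ) ≤ 81 * c ^ 4 * u ^ 176 := by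
    have h1 : (largePts N (u ^ 43)).card ≤ (latticeBox N).card :=
      Finset.card_le_card fun p hp => mem_latticeBox_iff_norm.mpr (mem_largePts hp).1
    calc ((largePts N (u ^ 43)).card : ℝ) ≤ (latticeBox N).card := by exact_mod_cast h1
      _ ≤ 81 * (N : ℝ) ^ 4 := card_latticeBox_le hN
      _ ≤ 81 * (c * u ^ 44) ^ 4 := by gcongr
      _ = _ := by ring
  set G := u ^ 175 / T ^ 2 with hG
  set L := u ^ 88 / T with hL
  set P := (u ^ 44) ^ ε with hP
  have hG0 : 0 ≤ G := by positivity
  have hL0 : 0 ≤ L := by positivity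
  have h1 : ((largePts N (u ^ 43)).card : ℝ) ^ 2 * (8 * Q * (u ^ 132 / (u ^ 320 * T ^ 2))) ≤
      52488 * c ^ 8 * Q * G := by
    calc _ ≤ (81 * c ^ 4 * u ^ 176) ^ 2 * (8 * Q * (u ^ 132 / (u ^ 320 * T ^ 2))) := by gcongr
      _ = 52488 * c ^ 8 * Q * (u ^ 164 / T ^ 2) := by field_simp; ring
      _ ≤ _ := by rw [hG]; gcongr; norm_num
  have hNε : (N : ℝ) ^ ε ≤ c ^ ε * P := rpow_le_of_le hN0 (by linarith) hε.le hNc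
  have h2 : C * (N : ℝ) ^ ε * ((N : ℝ) ^ 9 * (d / T) ^ 2 / (u ^ 43) ^ 7 * (K * u ^ 77) +
      (N : ℝ) ^ 2 * (d / T)) ≤ C * (c ^ ε * P) * (c ^ 9 * d ^ 2 * K * G + c ^ 2 * d * L) := by
    have q1 := ninth_mul_sq_lag_le (T := T) (d := d) hu1 hc (zero_le_one.trans hK1) hN0 hNc
    have q2 := sq_mul_lag_le (c := c) (d := d) hT1 (by positivity) hN0 hNc
    gcongr
  have h3 := mul_le_mul_of_nonneg_left (mixed_mul_sq_lag_le (K := K) hu1 hT1 hc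
    (show 0 ≤ d by positivity) (by positivity) hN0 hNc) hC
  have hPG : G ≤ P * (G + L) := by nlinarith
  have hsum : c ^ 9 * d ^ 2 * K * G + c ^ 2 * d * L ≤
      (c ^ 9 * d ^ 2 * K + c ^ 2 * d) * (G + L) := by
    have q1 : 0 ≤ c ^ 9 * d ^ 2 * K * L := by positivity
    have q2 : 0 ≤ c ^ 2 * d * G := by positivity
    linarith
  calc _ ≤ _ := main
    _ ≤ 52488 * c ^ 8 * Q * G + b ^ 4 * (C * (c ^ ε * P) * (c ^ 9 * d ^ 2 * K * G + c ^ 2 * d * L) +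
        C * (2 * c ^ 6 * d ^ 2 * K * G)) := by gcongr
    _ ≤ 52488 * c ^ 8 * Q * (P * (G + L)) + b ^ 4 * (C * (c ^ ε * P) *
        ((c ^ 9 * d ^ 2 * K + c ^ 2 * d) * (G + L)) +
        C * (2 * c ^ 6 * d ^ 2 * K * (P * (G + L)))) := by
        gcongr
    _ = _ := by ring

end estimates

section estimates

variable {V W : ℝ → ℝ} {b r R : ℝ}

theorem tail_sq_le {u T : ℝ} (hr : 1 ≤ r) (hR : 1 ≤ R) (hu : 4 ≤ u) (hT : 1 ≤ T) :
    (b ^ 2 * (2048 * (8 * r * R * u ^ 44) * (r * R / T) * √(u ^ 43 + 2) *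
        √(8 * r * R * u ^ 44))) ^ 2 + (4 * (b * r) ^ 2 / T ^ 2) ^ 2 ≤
      (2 * b ^ 4 * 2048 ^ 2 * (8 * r * R) ^ 3 * (r * R) ^ 2 + 16 * (b * r) ^ 4) *
        (u ^ 175 / T ^ 2) := by
  have hT0 : 0 < T := by linarith
  have hu0 : 0 < u := by linarith
  have hu1 : 1 ≤ u := by linarith
  have hr0 : 0 < r := by linarith
  have hR0 : 0 < R := by linarith
  have h2 : u ^ 43 + 2 ≤ 2 * u ^ 43 := by
    have := le_self_pow₀ hu1 (show 43 ≠ 0 by norm_num)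
    linarith
  have e : (b ^ 2 * (2048 * (8 * r * R * u ^ 44) * (r * R / T) * √(u ^ 43 + 2) *
      √(8 * r * R * u ^ 44))) ^ 2 = b ^ 4 * 2048 ^ 2 * (8 * r * R * u ^ 44) ^ 2 * (r * R / T) ^ 2 *
      (√(u ^ 43 + 2) ^ 2) * (√(8 * r * R * u ^ 44) ^ 2) := by ring
  rw [e, Real.sq_sqrt (by positivity), Real.sq_sqrt (by positivity), add_mul]
  refine add_le_add ?_ ?_
  · calc _ ≤ b ^ 4 * 2048 ^ 2 * (8 * r * R * u ^ 44) ^ 2 * (r * R / T) ^ 2 * (2 * u ^ 43) *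
          (8 * r * R * u ^ 44) := by gcongr
      _ = _ := by ring
  · have h1 : 1 / T ^ 4 ≤ u ^ 175 / T ^ 2 :=
      div_le_div₀ (by positivity) (one_le_pow₀ hu1) (by positivity)
        (pow_le_pow_right₀ hT (by norm_num))
    calc _ = 16 * (b * r) ^ 4 * (1 / T ^ 4) := by ring
      _ ≤ _ := by gcongr

theorem integral_errBound_le (hV : IsProfile b r V) (hW : IsProfile b r W) (hb : 1 ≤ b)
    (hr : 1 ≤ r) (hR : 1 ≤ R) {ε : ℝ} (hε : 0 < ε) :
    ∃ C u₀ T₀ : ℝ, 0 ≤ C ∧ ∀ u T : ℝ, u₀ ≤ u → T₀ ≤ T → ∃ N : ℕ, ∃ l : ℝ, 1 ≤ u ∧ 1 ≤ T ∧ 0 ≤ l ∧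
      8 * r * R * u ^ 44 + 1 ≤ N ∧
      ∫ α in box R, errBound V W b r (u ^ 44) T R l N α ≤
        C * ((u ^ 44) ^ ε * (u ^ 175 / T ^ 2 + u ^ 88 / T)) := by
  set c := 8 * r * R + 3 with hc
  set d := r * R with hd
  have hd1 : 1 ≤ d := one_le_mul_of_one_le_of_one_le hr hR
  have hc1 : 1 ≤ c := by
    have : 8 * r * R = 8 * d := by ring
    linarith
  obtain ⟨C₁, hC₁, H₁⟩ := integral_bad_le R ε hR hε
  obtain ⟨C₂, hC₂, H₂⟩ := sum_smallPts_le R ε (by linarith) hε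
  obtain ⟨C₃, hC₃, H₃⟩ := integral_large_le hV hW hb hr hR hc1 hε
  set C₄ := volume.real (box R) *
    (2 * b ^ 4 * 2048 ^ 2 * (8 * r * R) ^ 3 * (r * R) ^ 2 + 16 * (b * r) ^ 4) with hC₄'
  have hC₄ : 0 ≤ C₄ := by positivity
  have hcε : 0 ≤ c ^ ε := by positivity
  refine ⟨b ^ 4 * (C₁ * c ^ ε * (c ^ 2 * d)) + b ^ 4 * (C₂ * c ^ ε * (c ^ 3 * d ^ 2 + c ^ 2 * d)) +
    C₃ + C₄, 1536 * R * (c + 1) ^ 3, 3 * d, by positivity, fun u T hu hT => ?_⟩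
  have hc3 : 1 ≤ (c + 1) ^ 3 := one_le_pow₀ (by linarith)
  have hRc : 1 ≤ R * (c + 1) ^ 3 := one_le_mul_of_one_le_of_one_le hR hc3
  have hu4 : 4 ≤ u := by nlinarith
  have hu1 : 1 ≤ u := by linarith
  have hT1 : 1 ≤ T := by linarith
  have hT0 : 0 < T := by linarith
  have hM1 : 1 ≤ u ^ 44 := one_le_pow₀ hu1
  have h0 : 0 ≤ 8 * r * R * u ^ 44 := by positivity
  have hceil : 8 * r * R * u ^ 44 ≤ ⌈8 * r * R * u ^ 44⌉₊ := Nat.le_ceil _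
  have hceil' := Nat.ceil_lt_add_one h0
  set N := ⌈8 * r * R * u ^ 44⌉₊ + 1 with hN
  have hNr : (N : ℝ) = ⌈8 * r * R * u ^ 44⌉₊ + 1 := by rw [hN]; push_cast; rfl
  have hN1 : 1 ≤ N := by omega
  have hN0 : (0 : ℝ) ≤ N := by positivity
  have hNc : (N : ℝ) ≤ c * u ^ 44 := by rw [hc, add_mul]; linarith
  refine ⟨N, u ^ 43, hu1, hT1, by positivity, by linarith, ?_⟩
  rw [integral_errBound hV hW]
  have hδ : 2 * (d / T) < 1 := by
    rw [← mul_div_assoc, div_lt_one hT0]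
    linarith
  have h1 := H₁ N hN1 (d / T) (by positivity) hδ
  have h2 := H₂ N hN1 (u ^ 43) (d / T) (by positivity) (by positivity)
  have h3 := H₃ u T hu (by linarith) N hN1 hNc
  have h4 := mul_le_mul_of_nonneg_left (tail_sq_le (b := b) hr hR hu4 hT1)
    (measureReal_nonneg (μ := volume) (s := box R))
  have q1 := sq_mul_lag_le (c := c) (d := d) hT1 (by positivity) hN0 hNc
  have q2 := cube_mul_sq_lag_le (d := d) (T := T) hu1 hN0 hNc
  have hNε : (N : ℝ) ^ ε ≤ c ^ ε * (u ^ 44) ^ ε := rpow_le_of_le hN0 (by linarith) hε.le hNc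
  have hP1 : 1 ≤ (u ^ 44) ^ ε := Real.one_le_rpow hM1 hε.le
  set G := u ^ 175 / T ^ 2 with hG
  set L := u ^ 88 / T with hL
  set P := (u ^ 44) ^ ε with hP
  have hG0 : 0 ≤ G := by positivity
  have hL0 : 0 ≤ L := by positivity
  have hPG : G ≤ P * (G + L) := by nlinarith
  have hLG : c ^ 2 * d * L ≤ c ^ 2 * d * (G + L) := by gcongr; linarith
  have hGL : c ^ 3 * d ^ 2 * G + c ^ 2 * d * L ≤ (c ^ 3 * d ^ 2 + c ^ 2 * d) * (G + L) := by
    have : 0 ≤ c ^ 3 * d ^ 2 * L + c ^ 2 * d * G := by positivity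
    linarith
  have s1 : b ^ 4 * (∫ α in box R,
      (∑ p ∈ badPts N, (pointCell R (d / T) p).indicator (1 : ℝ × ℝ → ℝ) α) ^ 2) ≤
      b ^ 4 * (C₁ * c ^ ε * (c ^ 2 * d)) * (P * (G + L)) := by
    calc _ ≤ b ^ 4 * (C₁ * (c ^ ε * P) * (c ^ 2 * d * (G + L))) := by
          refine mul_le_mul_of_nonneg_left (h1.trans ?_) (by positivity)
          have := q1.trans hLG
          gcongr
      _ = _ := by ring
  have s2 : b ^ 4 * (∑ p ∈ smallPts N (u ^ 43), ∑ p' ∈ smallPts N (u ^ 43),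
      pairMeas R (d / T) (quad p) (quad p')) ≤
      b ^ 4 * (C₂ * c ^ ε * (c ^ 3 * d ^ 2 + c ^ 2 * d)) * (P * (G + L)) := by
    calc _ ≤ b ^ 4 * (C₂ * (c ^ ε * P) * ((c ^ 3 * d ^ 2 + c ^ 2 * d) * (G + L))) := by
          refine mul_le_mul_of_nonneg_left (h2.trans ?_) (by positivity)
          have := (add_le_add q2 q1).trans hGL
          gcongr
      _ = _ := by ring
  have s4 := mul_le_mul_of_nonneg_left hPG hC₄
  replace h4 := h4.trans_eq (show _ = C₄ * G by rw [hC₄']; ring)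
  rw [← hd] at h4 ⊢
  refine (add_le_add (add_le_add (add_le_add s1 s2) h3) (h4.trans s4)).trans (le_of_eq ?_)
  ring

end estimates

section measure

theorem hypStar_restrict_le {K : Set (ℝ × ℝ)} (hm : MeasurableSet K)
    (hK : K ⊆ {a : ℝ × ℝ | 1 ≤ a.1 ∧ a.1 ≤ a.2}) : hypStar.restrict K ≤ volume.restrict K := by
  rw [hypStar, restrict_withDensity hm]
  refine (withDensity_mono ((ae_restrict_iff' hm).mpr (Filter.Eventually.of_forall
    fun α hα => ?_))).trans_eq withDensity_one
  have h1 := (hK hα).1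
  have h2 := (hK hα).2
  have h3 : 1 ≤ 4 * α.1 * α.2 - 1 := by nlinarith
  exact ENNReal.ofReal_le_one.mpr (Real.rpow_le_one_of_one_le_of_nonpos h3 (by norm_num))

theorem setIntegral_hypStar_le {K : Set (ℝ × ℝ)} {R : ℝ} {f g : ℝ × ℝ → ℝ} (hm : MeasurableSet K)
    (hK : K ⊆ {a : ℝ × ℝ | 1 ≤ a.1 ∧ a.1 ≤ a.2}) (hKR : K ⊆ box R) (hf : ∀ α, 0 ≤ f α)
    (hg : ∀ α, 0 ≤ g α) (hfg : ∀ α ∈ K, f α ≤ g α) (hi : Integrable g (volume.restrict (box R))) :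
    ∫ α in K, f α ∂hypStar ≤ ∫ α in box R, g α := by
  have hle := (hypStar_restrict_le hm hK).trans (Measure.restrict_mono_set volume hKR)
  exact (integral_mono_of_nonneg (Filter.Eventually.of_forall hf) (hi.mono_measure hle)
    ((ae_restrict_iff' hm).mpr (Filter.Eventually.of_forall hfg))).trans
    (integral_mono_measure hle (Filter.Eventually.of_forall hg) hi)

theorem exists_box {K : Set (ℝ × ℝ)} (hKc : IsCompact K)
    (hK : K ⊆ {a : ℝ × ℝ | 1 ≤ a.1 ∧ a.1 ≤ a.2}) :
    ∃ R : ℝ, 1 ≤ R ∧ ∀ α ∈ K, α ∈ box R ∧ wt R α = 1 := by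
  obtain ⟨ρ, hρ⟩ := hKc.isBounded.subset_closedBall 0
  refine ⟨max ρ 0 + 1, by linarith [le_max_right ρ 0], fun α hα => ?_⟩
  have h := mem_closedBall_zero_iff.mp (hρ hα)
  rw [Prod.norm_def] at h
  have h1 : α.1 ≤ max ρ 0 :=
    (le_abs_self _).trans ((le_max_left _ _).trans (h.trans (le_max_left _ _)))
  have h2 : α.2 ≤ max ρ 0 :=
    (le_abs_self _).trans ((le_max_right _ _).trans (h.trans (le_max_left _ _)))
  have h3 := (hK hα).1
  have h4 := (hK hα).2
  refine ⟨mem_box.mpr ⟨⟨by linarith, by linarith⟩, by linarith, by linarith⟩, ?_⟩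
  rw [wt, bump_eq_one h3 (by linarith), bump_eq_one (by linarith) (by linarith), one_mul]

end measure

section trivial_range

variable {V W : ℝ → ℝ} {b r M T R : ℝ}

theorem abs_Gsum_le (hV : IsProfile b r V) (hW : IsProfile b r W) (hr : 1 ≤ r) (hR : 1 ≤ R)
    (hM : 1 ≤ M) (hT : 1 ≤ T) {N : ℕ} (hN : 8 * r * R * M ≤ N) (hN1 : 1 ≤ N) {α : ℝ × ℝ}
    (hα : α ∈ box R) : |Gsum V W α M T| ≤ 81 * (N : ℝ) ^ 4 * b ^ 2 := by
  rw [Gsum_eq hV hW hr hR hM hT hN hα, abs_mul]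
  have h1 : |∑ p ∈ offDiagPts N, amp V W M T α (pt p)| ≤ 81 * (N : ℝ) ^ 4 * b ^ 2 := by
    calc _ ≤ ∑ p ∈ offDiagPts N, |amp V W M T α (pt p)| := Finset.abs_sum_le_sum_abs _ _
      _ ≤ ∑ p ∈ offDiagPts N, b ^ 2 := Finset.sum_le_sum fun p _ => abs_amp_le hV hW
      _ = (offDiagPts N).card * b ^ 2 := by rw [Finset.sum_const, nsmul_eq_mul]
      _ ≤ (latticeBox N).card * b ^ 2 := by
        gcongr
        exact Finset.filter_subset _ _
      _ ≤ _ := by gcongr; exact card_latticeBox_le hN1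
  rw [abs_of_pos (by norm_num : (0 : ℝ) < 1 / 4)]
  have := abs_nonneg (∑ p ∈ offDiagPts N, amp V W M T α (pt p))
  linarith

theorem exists_sq_Gsum_sub_le (hV : IsProfile b r V) (hW : IsProfile b r W) (hr : 1 ≤ r)
    (hR : 1 ≤ R) (M₀ : ℝ) : ∃ B : ℝ, ∀ M T : ℝ, ∀ α ∈ box R, 1 ≤ M → M ≤ M₀ → 1 ≤ T →
      |Gsum V W α M T - (∫ x in Set.Ioi (0 : ℝ), V x) * (∫ x, W x) * M ^ 2 / T| ^ 2 ≤ B := by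
  set N := ⌈8 * r * R * M₀⌉₊ + 1 with hN
  refine ⟨(81 * (N : ℝ) ^ 4 * b ^ 2 + |(∫ x in Set.Ioi (0 : ℝ), V x) * (∫ x, W x)| * M₀ ^ 2) ^ 2,
    fun M T α hα hM hM₀ hT => ?_⟩
  have hNr : 8 * r * R * M ≤ N := by
    have h1 : 8 * r * R * M ≤ 8 * r * R * M₀ := by gcongr
    have h2 := Nat.le_ceil (8 * r * R * M₀)
    rw [hN]
    push_cast
    linarith
  have h1 := abs_Gsum_le hV hW hr hR hM hT hNr (by omega) hα
  set I := (∫ x in Set.Ioi (0 : ℝ), V x) * (∫ x, W x)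
  have h2 : |I * M ^ 2 / T| ≤ |I| * M₀ ^ 2 := by
    rw [abs_div, abs_mul, abs_of_nonneg (sq_nonneg M), abs_of_pos (by linarith : 0 < T)]
    calc _ ≤ |I| * M ^ 2 := div_le_self (by positivity) hT
      _ ≤ _ := by gcongr
  exact pow_le_pow_left₀ (abs_nonneg _) ((abs_sub _ _).trans (add_le_add h1 h2)) 2

end trivial_range

theorem one_le_mul_rpow_div {M M₀ T η ε : ℝ} (hη : 0 < η) (hε : 0 < ε) (hM : 1 ≤ M) (hM₀ : M ≤ M₀)
    (hT : 1 ≤ T) (hTM : T ≤ M ^ (2 - η)) :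
    1 ≤ M₀ ^ 4 * (M ^ (4 - 1 / 44 + ε) / T ^ 2 + M ^ (2 + ε) / T) := by
  have hT0 : 0 < T := by linarith
  have h1 : T ≤ M₀ ^ 2 := by
    calc T ≤ M ^ (2 - η) := hTM
      _ ≤ M ^ (2 : ℝ) := Real.rpow_le_rpow_of_exponent_le hM (by linarith)
      _ = M ^ 2 := Real.rpow_ofNat M 2
      _ ≤ M₀ ^ 2 := by gcongr
  have h2 : 1 ≤ M ^ (4 - 1 / 44 + ε) := Real.one_le_rpow hM (by linarith)
  calc (1 : ℝ) = T ^ 2 * (1 / T ^ 2) := by field_simp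
    _ ≤ (M₀ ^ 2) ^ 2 * (M ^ (4 - 1 / 44 + ε) / T ^ 2 + M ^ (2 + ε) / T) := by
      gcongr
      have h3 : 0 ≤ M ^ (2 + ε) / T := by positivity
      have h4 : 1 / T ^ 2 ≤ M ^ (4 - 1 / 44 + ε) / T ^ 2 := by gcongr
      linarith
    _ = _ := by ring

/-- **Proposition 3.** For `M^η ≤ T ≤ M^{2-η}`,
`∫_{𝒟*} |𝒢_α(M,T) - V̂*(0)Ŵ(0)M²/T|² d*_hyp α ≪_ε M^{4-1/44+ε}/T² + M^{2+ε}/T`.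
Here `V̂*(0) = ∫₀^∞ V` and `Ŵ(0) = ∫_ℝ W`. -/
theorem prop3 (V W : ℝ → ℝ) (hV : ContDiff ℝ (⊤ : ℕ∞) V) (hVs : HasCompactSupport V)
    (hW : ContDiff ℝ (⊤ : ℕ∞) W) (hWs : HasCompactSupport W)
    (K : Set (ℝ × ℝ)) (hKc : IsCompact K) (hK : K ⊆ {a : ℝ × ℝ | 1 ≤ a.1 ∧ a.1 ≤ a.2})
    (η : ℝ) (hη : 0 < η) (ε : ℝ) (hε : 0 < ε) :
    ∃ C : ℝ, 0 < C ∧ ∀ M T : ℝ, 1 ≤ M → 1 ≤ T → M ^ η ≤ T → T ≤ M ^ (2 - η) →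
      (∫ a in K, |Gsum V W a M T -
          (∫ x in Set.Ioi (0 : ℝ), V x) * (∫ x : ℝ, W x) * M ^ 2 / T| ^ 2 ∂hypStar)
        ≤ C * (M ^ (4 - 1 / 44 + ε) / T ^ 2 + M ^ (2 + ε) / T) := by
  obtain ⟨b₁, r₁, hV₁⟩ := exists_isProfile hV hVs
  obtain ⟨b₂, r₂, hW₁⟩ := exists_isProfile hW hWs
  set b := max 1 (max b₁ b₂)
  set r := max 1 (max r₁ r₂)
  have hb : 1 ≤ b := le_max_left _ _
  have hr : 1 ≤ r := le_max_left _ _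
  have hV' : IsProfile b r V := hV₁.mono ((le_max_left _ _).trans (le_max_right _ _))
    ((le_max_left _ _).trans (le_max_right _ _))
  have hW' : IsProfile b r W := hW₁.mono ((le_max_right _ _).trans (le_max_right _ _))
    ((le_max_right _ _).trans (le_max_right _ _))
  obtain ⟨R, hR, hKR⟩ := exists_box hKc hK
  obtain ⟨C, u₀, T₀, hC, H⟩ := integral_errBound_le hV' hW' hb hr hR hε
  set M₀ := max (max u₀ 1 ^ 44) (max T₀ 1 ^ η⁻¹)
  obtain ⟨B, hB⟩ := exists_sq_Gsum_sub_le hV' hW' hr hR M₀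
  set v := volume.real (box R)
  have hM₀ : 0 ≤ M₀ := by positivity
  refine ⟨C + v * |B| * M₀ ^ 4 + 1, by positivity, fun M T hM hT hTη hTM => ?_⟩
  have hM0 : 0 < M := by linarith
  have hT0 : 0 < T := by linarith
  set Z := M ^ (4 - 1 / 44 + ε) / T ^ 2 + M ^ (2 + ε) / T with hZ
  have hZ0 : 0 ≤ Z := by positivity
  have hm := hKc.measurableSet
  rcases le_total M M₀ with hMM | hMM
  · have h1 := setIntegral_hypStar_le (R := R) (g := fun _ => |B|)
      (f := fun α => |Gsum V W α M T -
        (∫ x in Set.Ioi (0 : ℝ), V x) * (∫ x : ℝ, W x) * M ^ 2 / T| ^ 2)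
      hm hK (fun α hα => (hKR α hα).1) (fun _ => sq_nonneg _) (fun _ => abs_nonneg _)
      (fun α hα => (hB M T α (hKR α hα).1 hM hMM hT).trans (le_abs_self _)) (integrable_const _)
    rw [setIntegral_const, smul_eq_mul] at h1
    have h2 := mul_le_mul_of_nonneg_left (one_le_mul_rpow_div hη hε hM hMM hT hTM)
      (show 0 ≤ v * |B| by positivity)
    rw [← hZ] at h2
    have h3 : 0 ≤ C * Z := by positivity
    linarith
  · set u := M ^ (1 / 44 : ℝ) with hu
    have hu0 : 0 ≤ u := by positivity
    have hpow : ∀ k : ℕ, u ^ k = M ^ (k / 44 : ℝ) := fun k => by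
      rw [hu, ← Real.rpow_natCast, ← Real.rpow_mul hM0.le]
      congr 1
      ring
    have hu44 : u ^ 44 = M := by
      rw [hpow]
      norm_num
    have huu : u₀ ≤ u := by
      refine (le_max_left u₀ 1).trans (le_of_pow_le_pow_left₀ (n := 44) (by norm_num) hu0 ?_)
      rw [hu44]
      exact (le_max_left _ _).trans hMM
    have hTT : T₀ ≤ T := by
      have h1 : max T₀ 1 ^ η⁻¹ ≤ M := (le_max_right _ _).trans hMM
      have h2 := Real.rpow_le_rpow (by positivity) h1 hη.le
      rw [Real.rpow_inv_rpow (by positivity) hη.ne'] at h2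
      exact (le_max_left _ _).trans (h2.trans hTη)
    obtain ⟨N, l, -, -, hl, hN, hI⟩ := H u T huu hTT
    rw [hu44] at hN hI
    have h1 := setIntegral_hypStar_le (R := R) (g := errBound V W b r M T R l N) hm hK
      (fun α hα => (hKR α hα).1) (fun _ => sq_nonneg _)
      (errBound_nonneg V W b r M T R l N)
      (fun α hα => sq_Gsum_sub_le hV' hW' hr hR hM hT hl hN (hKR α hα).1 (hKR α hα).2)
      (integrable_errBound hV' hW')
    have h2 : M ^ ε * (u ^ 175 / T ^ 2 + u ^ 88 / T) = Z := by
      rw [hpow, hpow, hZ, mul_add, ← mul_div_assoc, ← mul_div_assoc, ← Real.rpow_add hM0,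
        ← Real.rpow_add hM0]
      congr 3 <;> norm_num <;> ring
    rw [h2] at hI
    have h3 : 0 ≤ (v * |B| * M₀ ^ 4 + 1) * Z := by positivity
    linarith
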